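/- The system of stochastic differential equations (1.1)–(1.2) admits a pathwise unique, strong solution; in particular the solution (X₁(·), X₂(·)) is adapted to the augmented filtration generated by the driving planar Brownian motion (B₁(·), B₂(·)), i.e. 𝔉^{(X₁,X₂)}(t) ⊆ 𝔉^{(B₁,B₂)}(t) for all 0 ≤ t < ∞. -/

import Mathlib

open MeasureTheory ProbabilityTheory Filter Set

noncomputable section

namespace SDEPaper

/-- The signum convention of the paper: `psgn y = 1` for `y > 0`, `= -1` for `y ≤ 0`. -/
def psgn (y : ℝ) : ℝ := if 0 < y then 1 else -1

variable {Ω : Type*} [m : MeasurableSpace Ω]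

/-- The σ-algebra generated by the process `Ξ` on the time interval `[0, t]`. -/
def natSA {E : Type*} [MeasurableSpace E] (Ξ : ℝ → Ω → E) (t : ℝ) : MeasurableSpace Ω :=
  ⨆ s ∈ Icc (0 : ℝ) t, MeasurableSpace.comap (Ξ s) inferInstance

/-- The `μ`-augmentation of a σ-algebra. -/
def augSA (μ : Measure Ω) (m' : MeasurableSpace Ω) : MeasurableSpace Ω :=
  m' ⊔ MeasurableSpace.generateFrom {A : Set Ω | μ A = 0}

/-- `𝔉^Ξ(t)`: the `μ`-augmented σ-algebra generated by the process `Ξ` up to time `t`. -/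
def natFilt {E : Type*} [MeasurableSpace E] (μ : Measure Ω) (Ξ : ℝ → Ω → E) (t : ℝ) :
    MeasurableSpace Ω := augSA μ (natSA Ξ t)

/-- Dyadic left-point Riemann sum of `H` against `X` on `[0,t]`. -/
def rsum (H X : ℝ → Ω → ℝ) (t : ℝ) (n : ℕ) (ω : Ω) : ℝ :=
  ∑ i ∈ Finset.range (2 ^ n),
    H (t * i / 2 ^ n) ω * (X (t * (i + 1) / 2 ^ n) ω - X (t * i / 2 ^ n) ω)

/-- `I = ∫₀^· H dX`: dyadic Riemann sums converge in probability, and `I 0 = 0` a.s. -/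
def IsSI (μ : Measure Ω) (H X I : ℝ → Ω → ℝ) : Prop :=
  (∀ᵐ ω ∂μ, I 0 ω = 0) ∧
  ∀ t : ℝ, 0 ≤ t → TendstoInMeasure μ (fun n => rsum H X t n) atTop (I t)

/-- `I = ∫₀^· H₁ dX₁ + ∫₀^· H₂ dX₂` in the sense of convergence in probability
of dyadic Riemann sums. -/
def IsSI2 (μ : Measure Ω) (H₁ X₁ H₂ X₂ I : ℝ → Ω → ℝ) : Prop :=
  (∀ᵐ ω ∂μ, I 0 ω = 0) ∧
  ∀ t : ℝ, 0 ≤ t →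
    TendstoInMeasure μ (fun n ω => rsum H₁ X₁ t n ω + rsum H₂ X₂ t n ω) atTop (I t)

/-- Dyadic sums of products of increments. -/
def qsum (X Y : ℝ → Ω → ℝ) (t : ℝ) (n : ℕ) (ω : Ω) : ℝ :=
  ∑ i ∈ Finset.range (2 ^ n),
    (X (t * (i + 1) / 2 ^ n) ω - X (t * i / 2 ^ n) ω) *
      (Y (t * (i + 1) / 2 ^ n) ω - Y (t * i / 2 ^ n) ω)

/-- `C = ⟨X,Y⟩`: the quadratic covariation, as a limit in probability of dyadic sums. -/
def IsQV (μ : Measure Ω) (X Y C : ℝ → Ω → ℝ) : Prop :=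
  ∀ t : ℝ, 0 ≤ t → TendstoInMeasure μ (fun n => qsum X Y t n) atTop (C t)

/-- `W` is a standard one-dimensional Brownian motion with respect to the family of
σ-algebras `F` (a filtration contained in the ambient σ-algebra). -/
structure IsBM (μ : Measure Ω) (F : ℝ → MeasurableSpace Ω) (W : ℝ → Ω → ℝ) : Prop where
  le : ∀ t : ℝ, F t ≤ m
  mono : Monotone F
  adapted : ∀ t : ℝ, 0 ≤ t → MeasurableSpace.comap (W t) inferInstance ≤ F t
  init : ∀ᵐ ω ∂μ, W 0 ω = 0
  cont : ∀ᵐ ω ∂μ, Continuous fun t => W t ω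
  law : ∀ s t : ℝ, 0 ≤ s → s ≤ t →
    μ.map (fun ω => W t ω - W s ω) = gaussianReal 0 ((t - s).toNNReal)
  indep : ∀ s t : ℝ, 0 ≤ s → s ≤ t →
    Indep (MeasurableSpace.comap (fun ω => W t ω - W s ω) inferInstance) (F s) μ

/-- `(B₁, B₂)` is a planar Brownian motion: two independent standard Brownian motions
with respect to the common filtration `F`. -/
def IsPlanarBM (μ : Measure Ω) (F : ℝ → MeasurableSpace Ω) (B₁ B₂ : ℝ → Ω → ℝ) : Prop :=
  IsBM μ F B₁ ∧ IsBM μ F B₂ ∧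
    IndepFun (fun ω => (fun t => B₁ t ω)) (fun ω => (fun t => B₂ t ω)) μ

/-- `L` is the (right) local time at the origin of the process `Y`:
`L t = lim_{ε ↓ 0} (4ε)⁻¹ ∫₀ᵗ 1{|Y(s)| < ε} ds`. -/
def IsLocalTime (μ : Measure Ω) (Y L : ℝ → Ω → ℝ) : Prop :=
  ∀ᵐ ω ∂μ, ∀ t : ℝ, 0 ≤ t →
    Tendsto (fun ε : ℝ =>
        (4 * ε)⁻¹ * ∫ s in (0:ℝ)..t, (if |Y s ω| < ε then (1:ℝ) else 0))
      (nhdsWithin 0 (Ioi 0)) (nhds (L t ω))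

/-- A continuous local martingale with respect to the filtration `F`. -/
def IsContLocMart (μ : Measure Ω) (F : Filtration ℝ m) (M : ℝ → Ω → ℝ) : Prop :=
  (∀ᵐ ω ∂μ, Continuous fun t => M t ω) ∧ StronglyAdapted F M ∧
    ∃ τ : ℕ → Ω → ℝ, (∀ n, IsStoppingTime F (fun ω => (τ n ω : WithTop ℝ))) ∧
      (∀ᵐ ω ∂μ, Tendsto (fun n => τ n ω) atTop atTop) ∧
      ∀ n, Martingale (fun t ω => M (min t (τ n ω)) ω) F μ

/-- Orthogonality: the cross-variation `⟨M,N⟩` vanishes identically. -/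
def Orthogonal (μ : Measure Ω) (M N : ℝ → Ω → ℝ) : Prop :=
  IsQV μ M N fun _ _ => 0

/-- Domination: `⟨M⟩(t) = ∫₀ᵗ q(s) d⟨N⟩(s)` for a progressively measurable
process `q` with values in `[0,c]`. -/
def Dominated (μ : Measure Ω) (F : Filtration ℝ m) (M N : ℝ → Ω → ℝ) (c : ℝ) : Prop :=
  ∃ QM QN q : ℝ → Ω → ℝ, IsQV μ M M QM ∧ IsQV μ N N QN ∧
    ProgMeasurable F q ∧ (∀ t ω, q t ω ∈ Icc (0:ℝ) c) ∧
    ∀ᵐ ω ∂μ, ∃ ν : Measure ℝ,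
      (∀ a b : ℝ, 0 ≤ a → a ≤ b → ν (Ioc a b) = ENNReal.ofReal (QN b ω - QN a ω)) ∧
      ∀ t : ℝ, 0 ≤ t → QM t ω = ∫ s in Ioc (0:ℝ) t, q s ω ∂ν

/-- The law of the two-dimensional process `(X₁, X₂)` on path space. -/
def pathLaw (μ : Measure Ω) (X₁ X₂ : ℝ → Ω → ℝ) : Measure (ℝ → ℝ × ℝ) :=
  μ.map fun ω => (fun t => (X₁ t ω, X₂ t ω))
/-- `(X₁, X₂)` solves the system (1.1)-(1.2) driven by `(B₁, B₂)`. -/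
def Solves11 (μ : Measure Ω) (F : ℝ → MeasurableSpace Ω) (g h ρ σ x₁ x₂ : ℝ)
    (B₁ B₂ X₁ X₂ : ℝ → Ω → ℝ) : Prop :=
  (∀ t : ℝ, 0 ≤ t →
    MeasurableSpace.comap (fun ω => (X₁ t ω, X₂ t ω)) inferInstance ≤ F t) ∧
  (∀ᵐ ω ∂μ, Continuous (fun t => X₁ t ω) ∧ Continuous (fun t => X₂ t ω)) ∧
  ∃ I₁ I₂ : ℝ → Ω → ℝ,
    IsSI μ (fun s ω => if X₁ s ω ≤ X₂ s ω then σ else ρ) B₁ I₁ ∧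
    IsSI μ (fun s ω => if X₁ s ω ≤ X₂ s ω then ρ else σ) B₂ I₂ ∧
    ∀ᵐ ω ∂μ, ∀ t : ℝ, 0 ≤ t →
      X₁ t ω = x₁ + (∫ s in (0:ℝ)..t, (if X₁ s ω ≤ X₂ s ω then g else -h)) + I₁ t ω ∧
      X₂ t ω = x₂ + (∫ s in (0:ℝ)..t, (if X₁ s ω ≤ X₂ s ω then -h else g)) + I₂ t ω

/-- `(X₁, X₂)` solves the system (4.7)-(4.8), driven by the single Brownian motion `W`. -/
def Solves47 (μ : Measure Ω) (F : ℝ → MeasurableSpace Ω) (g h x₁ x₂ : ℝ)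
    (W X₁ X₂ : ℝ → Ω → ℝ) : Prop :=
  (∀ t : ℝ, 0 ≤ t →
    MeasurableSpace.comap (fun ω => (X₁ t ω, X₂ t ω)) inferInstance ≤ F t) ∧
  (∀ᵐ ω ∂μ, Continuous (fun t => X₁ t ω) ∧ Continuous (fun t => X₂ t ω)) ∧
  ∃ I₁ I₂ : ℝ → Ω → ℝ,
    IsSI μ (fun s ω => if X₁ s ω ≤ X₂ s ω then (0:ℝ) else 1) W I₁ ∧
    IsSI μ (fun s ω => if X₁ s ω ≤ X₂ s ω then (-1:ℝ) else 0) W I₂ ∧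
    ∀ᵐ ω ∂μ, ∀ t : ℝ, 0 ≤ t →
      X₁ t ω = x₁ + (∫ s in (0:ℝ)..t, (if X₁ s ω ≤ X₂ s ω then g else -h)) + I₁ t ω ∧
      X₂ t ω = x₂ + (∫ s in (0:ℝ)..t, (if X₁ s ω ≤ X₂ s ω then -h else g)) + I₂ t ω

/-- `(X₁, X₂)` solves the system (4.9)-(4.10), driven by the single Brownian motion `V`. -/
def Solves49 (μ : Measure Ω) (F : ℝ → MeasurableSpace Ω) (g h x₁ x₂ : ℝ)
    (V X₁ X₂ : ℝ → Ω → ℝ) : Prop :=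
  (∀ t : ℝ, 0 ≤ t →
    MeasurableSpace.comap (fun ω => (X₁ t ω, X₂ t ω)) inferInstance ≤ F t) ∧
  (∀ᵐ ω ∂μ, Continuous (fun t => X₁ t ω) ∧ Continuous (fun t => X₂ t ω)) ∧
  ∃ I₁ I₂ : ℝ → Ω → ℝ,
    IsSI μ (fun s ω => if X₁ s ω ≤ X₂ s ω then (0:ℝ) else 1) V I₁ ∧
    IsSI μ (fun s ω => if X₁ s ω ≤ X₂ s ω then (1:ℝ) else 0) V I₂ ∧
    ∀ᵐ ω ∂μ, ∀ t : ℝ, 0 ≤ t →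
      X₁ t ω = x₁ + (∫ s in (0:ℝ)..t, (if X₁ s ω ≤ X₂ s ω then g else -h)) + I₁ t ω ∧
      X₂ t ω = x₂ + (∫ s in (0:ℝ)..t, (if X₁ s ω ≤ X₂ s ω then -h else g)) + I₂ t ω

/-- `(X₁, X₂)` solves the system (2.12)-(2.13), driven by the planar BM `(W₁, W₂)`. -/
def Solves212 (μ : Measure Ω) (F : ℝ → MeasurableSpace Ω) (g h ρ σ x₁ x₂ : ℝ)
    (W₁ W₂ X₁ X₂ : ℝ → Ω → ℝ) : Prop :=
  (∀ t : ℝ, 0 ≤ t →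
    MeasurableSpace.comap (fun ω => (X₁ t ω, X₂ t ω)) inferInstance ≤ F t) ∧
  (∀ᵐ ω ∂μ, Continuous (fun t => X₁ t ω) ∧ Continuous (fun t => X₂ t ω)) ∧
  ∃ I₁ I₂ : ℝ → Ω → ℝ,
    IsSI2 μ (fun s ω => if X₁ s ω ≤ X₂ s ω then 0 else ρ) W₁
            (fun s ω => if X₁ s ω ≤ X₂ s ω then σ else 0) W₂ I₁ ∧
    IsSI2 μ (fun s ω => if X₁ s ω ≤ X₂ s ω then -ρ else 0) W₁
            (fun s ω => if X₁ s ω ≤ X₂ s ω then 0 else -σ) W₂ I₂ ∧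
    ∀ᵐ ω ∂μ, ∀ t : ℝ, 0 ≤ t →
      X₁ t ω = x₁ + (∫ s in (0:ℝ)..t, (if X₁ s ω ≤ X₂ s ω then g else -h)) + I₁ t ω ∧
      X₂ t ω = x₂ + (∫ s in (0:ℝ)..t, (if X₁ s ω ≤ X₂ s ω then -h else g)) + I₂ t ω

/-- `(X₁, X₂)` solves the system (2.14)-(2.15), driven by the planar BM `(V₁, V₂)`. -/
def Solves214 (μ : Measure Ω) (F : ℝ → MeasurableSpace Ω) (g h ρ σ x₁ x₂ : ℝ)
    (V₁ V₂ X₁ X₂ : ℝ → Ω → ℝ) : Prop :=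
  (∀ t : ℝ, 0 ≤ t →
    MeasurableSpace.comap (fun ω => (X₁ t ω, X₂ t ω)) inferInstance ≤ F t) ∧
  (∀ᵐ ω ∂μ, Continuous (fun t => X₁ t ω) ∧ Continuous (fun t => X₂ t ω)) ∧
  ∃ I₁ I₂ : ℝ → Ω → ℝ,
    IsSI2 μ (fun s ω => if X₁ s ω ≤ X₂ s ω then 0 else ρ) V₁
            (fun s ω => if X₁ s ω ≤ X₂ s ω then σ else 0) V₂ I₁ ∧
    IsSI2 μ (fun s ω => if X₁ s ω ≤ X₂ s ω then ρ else 0) V₁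
            (fun s ω => if X₁ s ω ≤ X₂ s ω then 0 else σ) V₂ I₂ ∧
    ∀ᵐ ω ∂μ, ∀ t : ℝ, 0 ≤ t →
      X₁ t ω = x₁ + (∫ s in (0:ℝ)..t, (if X₁ s ω ≤ X₂ s ω then g else -h)) + I₁ t ω ∧
      X₂ t ω = x₂ + (∫ s in (0:ℝ)..t, (if X₁ s ω ≤ X₂ s ω then -h else g)) + I₂ t ω

/-- `(X₁, X₂)` solves the system `dX = Σ(X) dU + G(X) dt` of (eq:xSigma), where
`Σ(x) = Σ₊ 1{x₁ > x₂} + Σ₋ 1{x₁ ≤ x₂}`. -/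
def SolvesGen (μ : Measure Ω) (F : ℝ → MeasurableSpace Ω) (g h : ℝ)
    (Sp Sm : Matrix (Fin 2) (Fin 2) ℝ) (x₁ x₂ : ℝ)
    (U₁ U₂ X₁ X₂ : ℝ → Ω → ℝ) : Prop :=
  (∀ t : ℝ, 0 ≤ t →
    MeasurableSpace.comap (fun ω => (X₁ t ω, X₂ t ω)) inferInstance ≤ F t) ∧
  (∀ᵐ ω ∂μ, Continuous (fun t => X₁ t ω) ∧ Continuous (fun t => X₂ t ω)) ∧
  ∃ I₁ I₂ : ℝ → Ω → ℝ,
    IsSI2 μ (fun s ω => if X₁ s ω ≤ X₂ s ω then Sm 0 0 else Sp 0 0) U₁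
            (fun s ω => if X₁ s ω ≤ X₂ s ω then Sm 0 1 else Sp 0 1) U₂ I₁ ∧
    IsSI2 μ (fun s ω => if X₁ s ω ≤ X₂ s ω then Sm 1 0 else Sp 1 0) U₁
            (fun s ω => if X₁ s ω ≤ X₂ s ω then Sm 1 1 else Sp 1 1) U₂ I₂ ∧
    ∀ᵐ ω ∂μ, ∀ t : ℝ, 0 ≤ t →
      X₁ t ω = x₁ + (∫ s in (0:ℝ)..t, (if X₁ s ω ≤ X₂ s ω then g else -h)) + I₁ t ω ∧
      X₂ t ω = x₂ + (∫ s in (0:ℝ)..t, (if X₁ s ω ≤ X₂ s ω then -h else g)) + I₂ t ω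



set_option linter.all false
set_option linter.unusedSectionVars false
set_option linter.unusedVariables false
set_option linter.unnecessarySimpa false

/-! ### Taylor expansion -/

lemma taylor3 {f f1 f2 : ℝ → ℝ} {K : ℝ} (hf : ∀ x, HasDerivAt f (f1 x) x)
    (hf1 : ∀ x, HasDerivAt f1 (f2 x) x) (hK : ∀ x y, |f2 x - f2 y| ≤ K * |x - y|) (x z : ℝ) :
    |f (x + z) - f x - f1 x * z - f2 x * z ^ 2 / 2| ≤ K * |z| ^ 3 := by
  have hK0 : 0 ≤ K := by
    have := hK 1 0
    simp at this
    exact (abs_nonneg _).trans this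
  have key1 : ∀ w, |f1 (x + w) - f1 x - f2 x * w| ≤ K * |w| * |w| := by
    intro w
    have := Convex.norm_image_sub_le_of_norm_hasDerivWithin_le (s := uIcc 0 w)
      (f := fun w => f1 (x + w) - f2 x * w) (f' := fun w => f2 (x + w) - f2 x) (C := K * |w|)
      (x := 0) (y := w) ?_ ?_ (convex_uIcc 0 w) (by simp) (by simp)
    · simp only [Real.norm_eq_abs, add_zero, mul_zero, sub_zero] at this
      convert this using 2
      ring
    · intro y _
      have h1 : HasDerivAt (fun w => f1 (x + w)) (f2 (x + y)) y := by
        simpa using (hf1 (x + y)).comp_const_add x y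
      have h2 : HasDerivAt (fun w => f2 x * w) (f2 x) y := by
        simpa using (hasDerivAt_id y).const_mul (f2 x)
      exact (h1.sub h2).hasDerivWithinAt
    · intro y hy
      rw [Real.norm_eq_abs]
      refine (hK _ _).trans ?_
      have : |y| ≤ |w| := by
        have := abs_sub_left_of_mem_uIcc hy
        simpa using this
      simpa using mul_le_mul_of_nonneg_left this hK0
  have := Convex.norm_image_sub_le_of_norm_hasDerivWithin_le (s := uIcc 0 z)
      (f := fun w => f (x + w) - f1 x * w - f2 x * w ^ 2 / 2)
      (f' := fun w => f1 (x + w) - f1 x - f2 x * w) (C := K * |z| * |z|)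
      (x := 0) (y := z) ?_ ?_ (convex_uIcc 0 z) (by simp) (by simp)
  · simp only [Real.norm_eq_abs, add_zero, mul_zero, sub_zero] at this
    calc _ = |f (x + z) - f1 x * z - f2 x * z ^ 2 / 2 - (f x - f2 x * 0 ^ 2 / 2)| := by
          congr 1; ring
      _ ≤ _ := by simpa using this
      _ = _ := by ring
  · intro y _
    have h1 : HasDerivAt (fun w => f (x + w)) (f1 (x + y)) y := by
      simpa using (hf (x + y)).comp_const_add x y
    have h2 : HasDerivAt (fun w => f1 x * w) (f1 x) y := by
      simpa using (hasDerivAt_id y).const_mul (f1 x)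
    have h3 : HasDerivAt (fun w => f2 x * w ^ 2 / 2) (f2 x * y) y := by
      have := ((hasDerivAt_pow 2 y).const_mul (f2 x)).div_const 2
      have e : f2 x * y = f2 x * (((2 : ℕ) : ℝ) * y ^ (2 - 1)) / 2 := by
        norm_num
        ring
      rw [e]
      exact this
    exact ((h1.sub h2).sub h3).hasDerivWithinAt
  · intro y hy
    rw [Real.norm_eq_abs]
    refine (key1 y).trans ?_
    have : |y| ≤ |z| := by
      have := abs_sub_left_of_mem_uIcc hy
      simpa using this
    gcongr

/-! ### Gaussian moments -/

/-- The fourth moment of a standard normal variable. -/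
def K4 : ℝ := ∫ x, x ^ 4 ∂(gaussianReal 0 1)

lemma K4_nonneg : 0 ≤ K4 := integral_nonneg fun x => by positivity

lemma gauss_four (v : NNReal) : ∫ x, x ^ 4 ∂(gaussianReal 0 v) = K4 * (v : ℝ) ^ 2 := by
  have h := gaussianReal_map_const_mul (μ := 0) (v := 1) (Real.sqrt v)
  have e : gaussianReal 0 v = (gaussianReal 0 1).map (fun x => Real.sqrt v * x) := by
    rw [show (fun x => Real.sqrt v * x) = (Real.sqrt v * ·) from rfl, h]
    congr 1
    · simp
    · ext; simp
  rw [e, integral_map (by fun_prop) (by fun_prop)]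
  simp only [mul_pow]
  rw [integral_const_mul, K4, mul_comm]
  congr 1
  rw [show (4 : ℕ) = 2 * 2 from rfl, pow_mul, Real.sq_sqrt (NNReal.coe_nonneg v)]

lemma gauss_two (v : NNReal) : ∫ x, x ^ 2 ∂(gaussianReal 0 v) = v := by
  have := variance_fun_id_gaussianReal (μ := 0) (v := v)
  rw [variance_eq_integral measurable_id'.aemeasurable] at this
  simpa using this

/-- Discrete noise: two sequences of centered increments, each independent of the past. -/
structure DN0 (μ : Measure Ω) (G : ℕ → MeasurableSpace Ω) (ξ η : ℕ → Ω → ℝ) (δ : ℝ) : Prop where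
  pos : 0 < δ
  le : ∀ j, G j ≤ m
  mono : Monotone G
  m1 : ∀ j, Measurable[G (j + 1)] (ξ j)
  m2 : ∀ j, Measurable[G (j + 1)] (η j)
  i1 : ∀ j, Indep (MeasurableSpace.comap (ξ j) inferInstance) (G j) μ
  i2 : ∀ j, Indep (MeasurableSpace.comap (η j) inferInstance) (G j) μ
  lp1 : ∀ j, MemLp (ξ j) 4 μ
  lp2 : ∀ j, MemLp (η j) 4 μ
  mean1 : ∀ j, ∫ ω, ξ j ω ∂μ = 0
  mean2 : ∀ j, ∫ ω, η j ω ∂μ = 0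
  var1 : ∀ j, ∫ ω, (ξ j ω) ^ 2 ∂μ = δ
  var2 : ∀ j, ∫ ω, (η j ω) ^ 2 ∂μ = δ
  four1 : ∀ j, ∫ ω, (ξ j ω) ^ 4 ∂μ = K4 * δ ^ 2
  four2 : ∀ j, ∫ ω, (η j ω) ^ 4 ∂μ = K4 * δ ^ 2

/-- Discrete planar noise. -/
structure DN (μ : Measure Ω) (G : ℕ → MeasurableSpace Ω) (ξ η : ℕ → Ω → ℝ) (δ : ℝ) : Prop
    extends DN0 μ G ξ η δ where
  cross : ∀ j (Z : Ω → ℝ), Measurable[G j] Z → (∃ C, ∀ ω, |Z ω| ≤ C) →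
    ∫ ω, Z ω * (ξ j ω * η j ω) ∂μ = 0

lemma DN0.swap {μ : Measure Ω} {G : ℕ → MeasurableSpace Ω} {ξ η : ℕ → Ω → ℝ} {δ : ℝ}
    (h : DN0 μ G ξ η δ) : DN0 μ G η ξ δ :=
  ⟨h.pos, h.le, h.mono, h.m2, h.m1, h.i2, h.i1, h.lp2, h.lp1, h.mean2, h.mean1, h.var2, h.var1,
    h.four2, h.four1⟩

section DN0
variable {μ : Measure Ω} [IsProbabilityMeasure μ] {G : ℕ → MeasurableSpace Ω}
  {ξ η : ℕ → Ω → ℝ} {δ : ℝ}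

lemma DN0.mξ (h : DN0 μ G ξ η δ) (j : ℕ) : Measurable (ξ j) := (h.m1 j).mono (h.le _) le_rfl
lemma DN0.mη (h : DN0 μ G ξ η δ) (j : ℕ) : Measurable (η j) := (h.m2 j).mono (h.le _) le_rfl

lemma DN0.indepFun (h : DN0 μ G ξ η δ) {j : ℕ} {β : Type*} [mb : MeasurableSpace β] {Z : Ω → β}
    (hZ : Measurable[G j] Z) : IndepFun Z (ξ j) μ := by
  rw [IndepFun_iff_Indep]
  exact (indep_of_indep_of_le_right (h.i1 j) (measurable_iff_comap_le.1 hZ)).symm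

/-- products with the past factorize -/
lemma DN0.integral_mul (h : DN0 μ G ξ η δ) {j : ℕ} {Z : Ω → ℝ} (hZ : Measurable[G j] Z) (k : ℕ) :
    ∫ ω, Z ω * (ξ j ω) ^ k ∂μ = (∫ ω, Z ω ∂μ) * ∫ ω, (ξ j ω) ^ k ∂μ := by
  have := (h.indepFun hZ).comp (measurable_id) (measurable_id.pow_const k)
  exact this.integral_fun_mul_eq_mul_integral (hZ.mono (h.le _) le_rfl).aestronglyMeasurable
    ((h.mξ j).pow_const k).aestronglyMeasurable

lemma DN0.intPow (h : DN0 μ G ξ η δ) (j : ℕ) {k : ℕ} (hk : k ≤ 4) :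
    Integrable (fun ω => (ξ j ω) ^ k) μ := by
  have : MemLp (ξ j) k μ := (h.lp1 j).mono_exponent (by exact_mod_cast hk)
  exact (this.integrable_norm_pow' ).mono ((h.mξ j).pow_const k).aestronglyMeasurable
    (ae_of_all _ fun ω => by simp)

lemma DN0.integrable_mul (h : DN0 μ G ξ η δ) {j : ℕ} {Z : Ω → ℝ} (hZ : Measurable[G j] Z)
    (hi : Integrable Z μ) {k : ℕ} (hk : k ≤ 4) :
    Integrable (fun ω => Z ω * (ξ j ω) ^ k) μ := by
  have := (h.indepFun hZ).comp (measurable_id) (measurable_id.pow_const k)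
  exact this.integrable_mul hi (h.intPow j hk)

lemma DN0.integral_mul_one (h : DN0 μ G ξ η δ) {j : ℕ} {Z : Ω → ℝ} (hZ : Measurable[G j] Z) :
    ∫ ω, Z ω * ξ j ω ∂μ = 0 := by
  have := h.integral_mul hZ 1
  simpa [h.mean1] using this

lemma DN0.integral_mul_two (h : DN0 μ G ξ η δ) {j : ℕ} {Z : Ω → ℝ} (hZ : Measurable[G j] Z) :
    ∫ ω, Z ω * (ξ j ω) ^ 2 ∂μ = δ * ∫ ω, Z ω ∂μ := by
  rw [h.integral_mul hZ 2, h.var1, mul_comm]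

lemma DN0.mL (h : DN0 μ G ξ η δ) {j : ℕ} {β : Type*} [MeasurableSpace β] {Z : Ω → β}
    (hZ : Measurable[G j] Z) : Measurable Z := hZ.mono (h.le _) le_rfl

lemma DN0.memLp_mul (h : DN0 μ G ξ η δ) {j : ℕ} {Z : Ω → ℝ} (hZ : Measurable[G j] Z)
    (hi : MemLp Z 4 μ) : MemLp (fun ω => Z ω * ξ j ω) 4 μ := by
  have h4 : (4 : ENNReal) = ((4 : ℕ) : ENNReal) := by norm_num
  have hi' : Integrable (fun ω => Z ω ^ 4) μ := by
    have := hi.integrable_norm_pow (p := 4) (by norm_num)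
    refine this.congr (ae_of_all _ fun ω => ?_)
    simp only [Real.norm_eq_abs]
    exact (even_two_mul 2).pow_abs _
  have := h.integrable_mul (j := j) (Z := fun ω => Z ω ^ 4) (hZ.pow_const 4) hi' (k := 4) le_rfl
  rw [← memLp_one_iff_integrable] at this
  have hm : AEStronglyMeasurable (fun ω => Z ω * ξ j ω) μ :=
    ((h.mL hZ).mul (h.mξ j)).aestronglyMeasurable
  rw [h4, ← integrable_norm_rpow_iff (p := ((4 : ℕ) : ENNReal)) hm (by norm_num) (by norm_num)]
  rw [memLp_one_iff_integrable] at this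
  refine this.congr (ae_of_all _ fun ω => ?_)
  simp only [ENNReal.toReal_natCast, Real.rpow_natCast, Real.norm_eq_abs]
  rw [(show Even 4 from even_two_mul 2).pow_abs, mul_pow]

end DN0

/-! ### From Brownian motion to discrete noise -/

/-- increments on a uniform grid -/
def inc (B : ℝ → Ω → ℝ) (a δ : ℝ) (j : ℕ) (ω : Ω) : ℝ := B (a + (j + 1) * δ) ω - B (a + j * δ) ω

section BM
variable {μ : Measure Ω} [IsProbabilityMeasure μ] {F : ℝ → MeasurableSpace Ω}
  {W B₁ B₂ : ℝ → Ω → ℝ} {a δ : ℝ}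

lemma IsBM.meas (h : IsBM μ F W) {s t : ℝ} (hs : 0 ≤ s) (hst : s ≤ t) : Measurable[F t] (W s) :=
  (measurable_iff_comap_le.2 (h.adapted s hs)).mono (h.mono hst) le_rfl

lemma IsBM.meas' (h : IsBM μ F W) {s : ℝ} (hs : 0 ≤ s) : Measurable (W s) :=
  (h.meas hs le_rfl).mono (h.le _) le_rfl

lemma IsBM.law_inc (h : IsBM μ F W) (ha : 0 ≤ a) (hδ : 0 < δ) (j : ℕ) :
    μ.map (inc W a δ j) = gaussianReal 0 δ.toNNReal := by
  have := h.law (a + j * δ) (a + (j + 1) * δ) (by positivity) (by nlinarith)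
  rw [show a + (j + 1) * δ - (a + j * δ) = δ by ring] at this
  exact this

lemma IsBM.meas_inc (h : IsBM μ F W) (ha : 0 ≤ a) (hδ : 0 < δ) (j : ℕ) :
    Measurable[F (a + (j + 1 : ℕ) * δ)] (inc W a δ j) := by
  refine Measurable.sub (h.meas (by positivity) ?_) (h.meas (by positivity) ?_)
  · push_cast; exact le_rfl
  · push_cast; nlinarith

lemma IsBM.indep_inc (h : IsBM μ F W) (ha : 0 ≤ a) (hδ : 0 < δ) (j : ℕ) :
    Indep (MeasurableSpace.comap (inc W a δ j) inferInstance) (F (a + j * δ)) μ :=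
  h.indep (a + j * δ) (a + (j + 1) * δ) (by positivity) (by nlinarith)

lemma IsBM.lp_inc (h : IsBM μ F W) (ha : 0 ≤ a) (hδ : 0 < δ) (j : ℕ) :
    MemLp (inc W a δ j) 4 μ := by
  have hm : Measurable (inc W a δ j) := (h.meas_inc ha hδ j).mono (h.le _) le_rfl
  have := memLp_id_gaussianReal' (μ := 0) (v := δ.toNNReal) 4 (by norm_num)
  rw [← h.law_inc ha hδ j, memLp_map_measure_iff (by fun_prop) hm.aemeasurable] at this
  exact this

lemma IsBM.int_inc (h : IsBM μ F W) (ha : 0 ≤ a) (hδ : 0 < δ) (j k : ℕ) :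
    ∫ ω, inc W a δ j ω ^ k ∂μ = ∫ x, x ^ k ∂(gaussianReal 0 δ.toNNReal) := by
  have hm : Measurable (inc W a δ j) := (h.meas_inc ha hδ j).mono (h.le _) le_rfl
  rw [← h.law_inc ha hδ j, integral_map hm.aemeasurable (by fun_prop)]

lemma IsBM.dn0 (h : IsBM μ F B₁) (h' : IsBM μ F B₂) (ha : 0 ≤ a) (hδ : 0 < δ) :
    DN0 μ (fun j => F (a + j * δ)) (inc B₁ a δ) (inc B₂ a δ) δ where
  pos := hδ
  le := fun j => h.le _
  mono := fun i j hij => h.mono (by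
    have : (i : ℝ) ≤ j := by exact_mod_cast hij
    nlinarith)
  m1 := h.meas_inc ha hδ
  m2 := h'.meas_inc ha hδ
  i1 := h.indep_inc ha hδ
  i2 := h'.indep_inc ha hδ
  lp1 := h.lp_inc ha hδ
  lp2 := h'.lp_inc ha hδ
  mean1 := fun j => by
    have := h.int_inc ha hδ j 1
    simpa using this
  mean2 := fun j => by
    have := h'.int_inc ha hδ j 1
    simpa using this
  var1 := fun j => by rw [h.int_inc ha hδ, gauss_two, Real.coe_toNNReal _ hδ.le]
  var2 := fun j => by rw [h'.int_inc ha hδ, gauss_two, Real.coe_toNNReal _ hδ.le]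
  four1 := fun j => by rw [h.int_inc ha hδ, gauss_four, Real.coe_toNNReal _ hδ.le]
  four2 := fun j => by rw [h'.int_inc ha hδ, gauss_four, Real.coe_toNNReal _ hδ.le]

lemma inc_sum (B : ℝ → Ω → ℝ) (a δ : ℝ) (n : ℕ) (ω : Ω) :
    ∑ j ∈ Finset.range n, inc B a δ j ω = B (a + n * δ) ω - B a ω := by
  induction n with
  | zero => simp
  | succ n ih =>
    rw [Finset.sum_range_succ, ih, inc]
    push_cast
    ring

lemma indep_paths (hI : IndepFun (fun ω => (fun t => B₁ t ω)) (fun ω => (fun t => B₂ t ω)) μ)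
    (i j : ℕ) :
    IndepFun (fun ω => inc B₁ a δ i ω * inc B₁ a δ j ω) (fun ω => inc B₂ a δ i ω * inc B₂ a δ j ω) μ := by
  have hm : ∀ i j : ℕ, Measurable (fun w : ℝ → ℝ => (w (a + (i + 1) * δ) - w (a + i * δ)) *
      (w (a + (j + 1) * δ) - w (a + j * δ))) := by
    intro i j
    fun_prop
  exact hI.comp (hm i j) (hm i j)

/-- the discrete covariation has small second moment -/
lemma qcov_sq (h : IsPlanarBM μ F B₁ B₂) (ha : 0 ≤ a) (hδ : 0 < δ) (n : ℕ) :
    MemLp (fun ω => ∑ j ∈ Finset.range n, inc B₁ a δ j ω * inc B₂ a δ j ω) 2 μ ∧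
    ∫ ω, (∑ j ∈ Finset.range n, inc B₁ a δ j ω * inc B₂ a δ j ω) ^ 2 ∂μ = n * δ ^ 2 := by
  obtain ⟨h1, h2, hI⟩ := h
  have d := h1.dn0 h2 ha hδ
  have l2 : ∀ j, MemLp (fun ω => inc B₁ a δ j ω * inc B₂ a δ j ω) 2 μ := by
    intro j
    haveI : ENNReal.HolderTriple 4 4 2 := ⟨by
      rw [← two_mul, show (4 : ENNReal) = 2 * 2 by norm_num,
        ENNReal.mul_inv (by norm_num) (by norm_num), ← mul_assoc,
        ENNReal.mul_inv_cancel (by norm_num) (by norm_num), one_mul]⟩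
    exact (d.lp2 j).mul (d.lp1 j)
  induction n with
  | zero => simp
  | succ n ih =>
    obtain ⟨ih1, ih2⟩ := ih
    simp only [Finset.sum_range_succ]
    refine ⟨ih1.add (l2 n), ?_⟩
    have e : ∀ ω, (∑ j ∈ Finset.range n, inc B₁ a δ j ω * inc B₂ a δ j ω +
        inc B₁ a δ n ω * inc B₂ a δ n ω) ^ 2 =
        (∑ j ∈ Finset.range n, inc B₁ a δ j ω * inc B₂ a δ j ω) ^ 2 +
        2 * (∑ j ∈ Finset.range n, (inc B₁ a δ j ω * inc B₁ a δ n ω) *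
          (inc B₂ a δ j ω * inc B₂ a δ n ω)) +
        (inc B₁ a δ n ω * inc B₁ a δ n ω) * (inc B₂ a δ n ω * inc B₂ a δ n ω) := by
      intro ω
      have : ∑ j ∈ Finset.range n, (inc B₁ a δ j ω * inc B₁ a δ n ω) *
          (inc B₂ a δ j ω * inc B₂ a δ n ω) = (∑ j ∈ Finset.range n, inc B₁ a δ j ω * inc B₂ a δ j ω)
            * (inc B₁ a δ n ω * inc B₂ a δ n ω) := by
        rw [Finset.sum_mul]
        exact Finset.sum_congr rfl fun _ _ => by ring
      rw [this]; ring
    have prod_int : ∀ j, Integrable (fun ω => (inc B₁ a δ j ω * inc B₁ a δ n ω) *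
          (inc B₂ a δ j ω * inc B₂ a δ n ω)) μ := by
      intro j
      have := (l2 j).integrable_mul (l2 n)
      refine this.congr (ae_of_all _ fun ω => ?_)
      simp only [Pi.mul_apply]
      ring
    have prod_eq : ∀ j, ∫ ω, (inc B₁ a δ j ω * inc B₁ a δ n ω) *
          (inc B₂ a δ j ω * inc B₂ a δ n ω) ∂μ = (∫ ω, inc B₁ a δ j ω * inc B₁ a δ n ω ∂μ) *
          ∫ ω, inc B₂ a δ j ω * inc B₂ a δ n ω ∂μ := by
      intro j
      exact (indep_paths hI j n).integral_fun_mul_eq_mul_integral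
        ((d.mξ j).mul (d.mξ n)).aestronglyMeasurable ((d.mη j).mul (d.mη n)).aestronglyMeasurable
    simp_rw [e]
    rw [integral_add, integral_add, ih2, integral_const_mul, integral_finsetSum, prod_eq]
    · have z : ∑ j ∈ Finset.range n, ∫ ω, (inc B₁ a δ j ω * inc B₁ a δ n ω) *
          (inc B₂ a δ j ω * inc B₂ a δ n ω) ∂μ = 0 := by
        refine Finset.sum_eq_zero fun j hj => ?_
        rw [prod_eq, d.integral_mul_one ((d.m1 j).mono (d.mono (Finset.mem_range.1 hj)) le_rfl),
          zero_mul]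
      rw [z]
      have v1 := d.var1 n
      have v2 := d.var2 n
      simp only [pow_two] at v1 v2
      rw [v1, v2]
      push_cast
      ring
    · exact fun j _ => prod_int j
    · exact ih1.integrable_sq
    · exact (integrable_finsetSum _ fun j _ => prod_int j).const_mul 2
    · exact ih1.integrable_sq.add ((integrable_finsetSum _ fun j _ => prod_int j).const_mul 2)
    · exact prod_int n

lemma cross_sum {G : ℕ → MeasurableSpace Ω} {ξ η : ℕ → Ω → ℝ} (d : DN0 μ G ξ η δ)
    {Z : Ω → ℝ} (hZ : Measurable[G 0] Z) {C : ℝ} (hC : ∀ ω, |Z ω| ≤ C) (n : ℕ) :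
    ∫ ω, Z ω * ((∑ j ∈ Finset.range n, ξ j ω) * (∑ j ∈ Finset.range n, η j ω)) ∂μ =
      ∫ ω, Z ω * (∑ j ∈ Finset.range n, ξ j ω * η j ω) ∂μ := by
  have l2 : ∀ i j, Integrable (fun ω => ξ i ω * η j ω) μ := by
    intro i j
    exact ((d.lp1 i).mono_exponent (by norm_num : (2 : ENNReal) ≤ 4)).integrable_mul
      ((d.lp2 j).mono_exponent (by norm_num : (2 : ENNReal) ≤ 4))
  have l2' : ∀ i j, Integrable (fun ω => Z ω * (ξ i ω * η j ω)) μ := by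
    intro i j
    exact (l2 i j).bdd_mul (c := C) ((hZ.mono (d.le 0) le_rfl)).aestronglyMeasurable
      (ae_of_all _ hC)
  have e1 : ∀ ω, Z ω * ((∑ j ∈ Finset.range n, ξ j ω) * (∑ j ∈ Finset.range n, η j ω)) =
      ∑ i ∈ Finset.range n, ∑ j ∈ Finset.range n, Z ω * (ξ i ω * η j ω) := by
    intro ω
    rw [Finset.sum_mul_sum, Finset.mul_sum]
    exact Finset.sum_congr rfl fun _ _ => by rw [Finset.mul_sum]
  simp_rw [e1, Finset.mul_sum]
  rw [integral_finsetSum _ fun i _ => integrable_finsetSum _ fun j _ => l2' i j,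
    integral_finsetSum _ fun i _ => l2' i i]
  refine Finset.sum_congr rfl fun i hi => ?_
  rw [integral_finsetSum _ fun j _ => l2' i j]
  refine Finset.sum_eq_single_of_mem i hi fun j _ hji => ?_
  rcases lt_or_gt_of_ne hji with h | h
  · have := d.integral_mul_one (j := i) (Z := fun ω => Z ω * η j ω)
      ((hZ.mono (d.mono (Nat.zero_le i)) le_rfl).mul ((d.m2 j).mono (d.mono h) le_rfl))
    rw [← this]
    congr 1; ext ω; ring
  · have := d.swap.integral_mul_one (j := j) (Z := fun ω => Z ω * ξ i ω)
      ((hZ.mono (d.mono (Nat.zero_le j)) le_rfl).mul ((d.m1 i).mono (d.mono h) le_rfl))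
    rw [← this]
    congr 1; ext ω; ring

lemma cross_zero (h : IsPlanarBM μ F B₁ B₂) (ha : 0 ≤ a) (hδ : 0 < δ)
    {Z : Ω → ℝ} (hZ : Measurable[F a] Z) {C : ℝ} (hC : ∀ ω, |Z ω| ≤ C) :
    ∫ ω, Z ω * ((B₁ (a + δ) ω - B₁ a ω) * (B₂ (a + δ) ω - B₂ a ω)) ∂μ = 0 := by
  have hC0 : 0 ≤ C := by
    obtain ⟨ω⟩ : Nonempty Ω := by
      by_contra hne
      rw [not_nonempty_iff] at hne
      have := measure_univ (μ := μ)
      rw [univ_eq_empty_iff.2 hne] at this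
      simp at this
    exact (abs_nonneg _).trans (hC ω)
  set c := ∫ ω, Z ω * ((B₁ (a + δ) ω - B₁ a ω) * (B₂ (a + δ) ω - B₂ a ω)) ∂μ with hc
  have key : ∀ n : ℕ, ∀ r : ℝ, 0 < r → |c| ≤ C * (r + r⁻¹ * (δ ^ 2 / (n + 1))) := by
    intro n r hr
    have hδ' : 0 < δ / (n + 1) := by positivity
    obtain ⟨q1, q2⟩ := qcov_sq h ha hδ' (n + 1)
    have d := h.1.dn0 h.2.1 ha hδ'
    have e := cross_sum d (Z := Z) (by
      have : a + ((0 : ℕ) : ℝ) * (δ / (n + 1)) = a := by simp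
      have h' : F (a + ((0 : ℕ) : ℝ) * (δ / (n + 1))) = F a := by rw [this]
      exact hZ.mono h'.ge le_rfl) hC (n + 1)
    simp only [inc_sum] at e
    have e2 : a + ((n + 1 : ℕ) : ℝ) * (δ / (n + 1)) = a + δ := by
      push_cast
      field_simp
    rw [e2, ← hc] at e
    rw [e]
    set Q := fun ω => ∑ j ∈ Finset.range (n + 1), inc B₁ a (δ / (n + 1)) j ω * inc B₂ a (δ / (n + 1)) j ω
    have hQ : ∫ ω, Q ω ^ 2 ∂μ = δ ^ 2 / (n + 1) := by
      rw [q2]; push_cast; field_simp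
    have hQi : Integrable (fun ω => Q ω ^ 2) μ := q1.integrable_sq
    calc |∫ ω, Z ω * Q ω ∂μ| ≤ ∫ ω, |Z ω * Q ω| ∂μ := abs_integral_le_integral_abs
      _ ≤ ∫ ω, C * (r + r⁻¹ * Q ω ^ 2) ∂μ := by
        refine integral_mono_of_nonneg (ae_of_all _ fun _ => abs_nonneg _) ?_ (ae_of_all _ fun ω => ?_)
        · exact ((integrable_const r).add (hQi.const_mul _)).const_mul C
        · simp only [abs_mul]
          refine mul_le_mul (hC ω) ?_ (abs_nonneg _) hC0
          have : 2 * |Q ω| ≤ r + r⁻¹ * Q ω ^ 2 := by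
            have h2 : 0 ≤ r⁻¹ * (r - |Q ω|) ^ 2 := by positivity
            have h3 : r⁻¹ * (r - |Q ω|) ^ 2 = r + r⁻¹ * Q ω ^ 2 - 2 * |Q ω| := by
              rw [← sq_abs (Q ω)]
              field_simp
              ring
            linarith
          linarith [abs_nonneg (Q ω)]
      _ = _ := by
        rw [integral_const_mul, integral_add (integrable_const r) (hQi.const_mul _),
          integral_const_mul, hQ]
        simp
  have key2 : ∀ r : ℝ, 0 < r → |c| ≤ C * r := by
    intro r hr
    have t1 : Tendsto (fun n : ℕ => C * (r + r⁻¹ * (δ ^ 2 * (1 / ((n : ℝ) + 1))))) atTop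
        (nhds (C * (r + r⁻¹ * (δ ^ 2 * 0)))) :=
      ((((tendsto_one_div_add_atTop_nhds_zero_nat).const_mul _).const_mul _).const_add _).const_mul _
    have := ge_of_tendsto' t1 (fun n => (key n r hr).trans_eq (by ring))
    simpa using this
  have t2 : Tendsto (fun n : ℕ => C * (1 / ((n : ℝ) + 1))) atTop (nhds (C * 0)) :=
      (tendsto_one_div_add_atTop_nhds_zero_nat).const_mul _
  have := ge_of_tendsto' t2 (fun n => key2 _ Nat.one_div_pos_of_nat)
  rw [mul_zero] at this
  exact abs_eq_zero.1 (le_antisymm this (abs_nonneg _))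

/-- A planar Brownian motion sampled on a grid is a discrete planar noise. -/
lemma IsPlanarBM.dn (h : IsPlanarBM μ F B₁ B₂) (ha : 0 ≤ a) (hδ : 0 < δ) :
    DN μ (fun j => F (a + j * δ)) (inc B₁ a δ) (inc B₂ a δ) δ where
  toDN0 := h.1.dn0 h.2.1 ha hδ
  cross := by
    rintro j Z hZ ⟨C, hC⟩
    have := cross_zero h (a := a + j * δ) (by positivity) hδ hZ hC
    rw [← this]
    congr 1
    ext ω
    simp only [inc]
    rw [show a + (j + 1) * δ = a + j * δ + δ by ring]

end BM

/-! ### Discrete stochastic calculus -/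

/-- adapted and bounded -/
structure AD (G : ℕ → MeasurableSpace Ω) (h : ℕ → Ω → ℝ) (c : ℝ) : Prop where
  ms : ∀ j, Measurable[G j] (h j)
  bd : ∀ j ω, |h j ω| ≤ c

/-- discrete Itô process -/
def PS (V0 : Ω → ℝ) (β h1 h2 ξ η : ℕ → Ω → ℝ) (δ : ℝ) (k : ℕ) (ω : Ω) : ℝ :=
  V0 ω + ∑ j ∈ Finset.range k, (β j ω * δ + (h1 j ω * ξ j ω + h2 j ω * η j ω))

/-- Test functions with bounded derivatives -/
structure TF (f f1 f2 : ℝ → ℝ) (K : ℝ) : Prop where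
  d1 : ∀ x, HasDerivAt f (f1 x) x
  d2 : ∀ x, HasDerivAt f1 (f2 x) x
  b1 : ∀ x, |f1 x| ≤ K
  b2 : ∀ x, |f2 x| ≤ K
  lip : ∀ x y, |f2 x - f2 y| ≤ K * |x - y|

lemma lip_of_deriv {f f1 : ℝ → ℝ} {K : ℝ} (h : ∀ x, HasDerivAt f (f1 x) x) (b : ∀ x, |f1 x| ≤ K)
    (x y : ℝ) : |f x - f y| ≤ K * |x - y| := by
  have := Convex.norm_image_sub_le_of_norm_hasDerivWithin_le (s := univ) (f := f) (f' := f1)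
    (C := K) (x := y) (y := x) (fun x _ => (h x).hasDerivWithinAt) (fun x _ => b x) convex_univ
    (mem_univ _) (mem_univ _)
  simpa using this

lemma TF.K0 {f f1 f2 : ℝ → ℝ} {K : ℝ} (h : TF f f1 f2 K) : 0 ≤ K := (abs_nonneg _).trans (h.b1 0)

lemma TF.c0 {f f1 f2 : ℝ → ℝ} {K : ℝ} (h : TF f f1 f2 K) : Measurable f :=
  (continuous_iff_continuousAt.2 fun x => (h.d1 x).continuousAt).measurable
lemma TF.c1 {f f1 f2 : ℝ → ℝ} {K : ℝ} (h : TF f f1 f2 K) : Measurable f1 :=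
  (continuous_iff_continuousAt.2 fun x => (h.d2 x).continuousAt).measurable
lemma TF.c2 {f f1 f2 : ℝ → ℝ} {K : ℝ} (h : TF f f1 f2 K) : Measurable f2 := by
  have : LipschitzWith ⟨K, h.K0⟩ f2 := LipschitzWith.of_dist_le_mul fun x y => by
    simp only [Real.dist_eq]
    exact h.lip x y
  exact this.continuous.measurable

section disc
variable {μ : Measure Ω} [IsProbabilityMeasure μ] {G : ℕ → MeasurableSpace Ω}
  {ξ η : ℕ → Ω → ℝ} {δ : ℝ}

lemma bdd_int {Z : Ω → ℝ} (hZ : Measurable Z) {C : ℝ} (hC : ∀ ω, |Z ω| ≤ C) : Integrable Z μ :=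
  Integrable.of_bound hZ.aestronglyMeasurable C (ae_of_all _ hC)

lemma iadd {f g : Ω → ℝ} (hf : Integrable f μ) (hg : Integrable g μ) :
    Integrable (fun ω => f ω + g ω) μ := hf.add hg

/-- the Itô error constant -/
def CI (b : ℝ) : ℝ := 2 * b + b ^ 2 + 4 * (1 + K4)

lemma CI_nonneg {b : ℝ} (hb : 0 ≤ b) : 0 ≤ CI b := by
  have := K4_nonneg
  unfold CI
  positivity

lemma abs_le_sq {s x : ℝ} (hs : 0 < s) : |x| ≤ (s + x ^ 2 / s) / 2 := by
  have h2 : 0 ≤ (s - |x|) ^ 2 / s := by positivity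
  have h3 : (s - |x|) ^ 2 / s = s + x ^ 2 / s - 2 * |x| := by
    rw [← sq_abs x]; field_simp; ring
  linarith

lemma abs_cube_le {s x : ℝ} (hs : 0 < s) : |x| ^ 3 ≤ (s * x ^ 2 + x ^ 4 / s) / 2 := by
  have := mul_le_mul_of_nonneg_left (abs_le_sq (x := x) hs) (sq_nonneg |x|)
  calc |x| ^ 3 = |x| ^ 2 * |x| := by ring
    _ ≤ |x| ^ 2 * ((s + x ^ 2 / s) / 2) := this
    _ = _ := by rw [sq_abs]; ring

lemma ito_maj (d : DN μ G ξ η δ) (hδ1 : δ ≤ 1) {b : ℝ} (hb : 0 ≤ b) (k : ℕ) :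
    ∃ M : Ω → ℝ, Integrable M μ ∧ ∫ ω, M ω ∂μ ≤ CI b * (δ * √δ) ∧
      ∀ ω, b * δ * (|ξ k ω| + |η k ω| + b * δ) + 4 * (|ξ k ω| ^ 3 + |η k ω| ^ 3) ≤ M ω := by
  have hs : 0 < √δ := Real.sqrt_pos.2 d.pos
  have hss : √δ * √δ = δ := Real.mul_self_sqrt d.pos.le
  have hs1 : √δ ≤ 1 := Real.sqrt_le_one.2 hδ1
  set s := √δ
  have i2 := d.intPow k (k := 2) (by norm_num)
  have i4 := d.intPow k (k := 4) (by norm_num)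
  have j2 := d.swap.intPow k (k := 2) (by norm_num)
  have j4 := d.swap.intPow k (k := 4) (by norm_num)
  have I1 : Integrable (fun ω => ξ k ω ^ 2 * (b * δ / (2 * s) + 2 * s)) μ := i2.mul_const _
  have I2 : Integrable (fun ω => ξ k ω ^ 4 * (2 / s)) μ := i4.mul_const _
  have J1 : Integrable (fun ω => η k ω ^ 2 * (b * δ / (2 * s) + 2 * s)) μ := j2.mul_const _
  have J2 : Integrable (fun ω => η k ω ^ 4 * (2 / s)) μ := j4.mul_const _
  refine ⟨fun ω => (ξ k ω ^ 2 * (b * δ / (2 * s) + 2 * s) + ξ k ω ^ 4 * (2 / s)) +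
    (η k ω ^ 2 * (b * δ / (2 * s) + 2 * s) + η k ω ^ 4 * (2 / s)) + b * δ * (s + b * δ),
    iadd (iadd (iadd I1 I2) (iadd J1 J2)) (integrable_const _), ?_, ?_⟩
  · rw [integral_add (iadd (iadd I1 I2) (iadd J1 J2)) (integrable_const _),
      integral_add (iadd I1 I2) (iadd J1 J2), integral_add I1 I2, integral_add J1 J2,
      integral_mul_const, integral_mul_const, integral_mul_const, integral_mul_const,
      d.var1, d.var2, d.four1, d.four2]
    simp only [integral_const, probReal_univ, smul_eq_mul, one_mul]
    have e1 : δ * (b * δ / (2 * s) + 2 * s) = b * δ * s / 2 + 2 * δ * s := by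
      rw [← hss]; field_simp
    have e2 : K4 * δ ^ 2 * (2 / s) = 2 * K4 * (δ * s) := by
      rw [← hss]; field_simp
    rw [e1, e2, CI]
    have : b ^ 2 * δ * δ ≤ b ^ 2 * δ * s := by
      refine mul_le_mul_of_nonneg_left ?_ (by have := d.pos; positivity)
      nlinarith
    nlinarith
  · intro ω
    have a1 := abs_le_sq (x := ξ k ω) hs
    have a2 := abs_le_sq (x := η k ω) hs
    have a3 := abs_cube_le (x := ξ k ω) hs
    have a4 := abs_cube_le (x := η k ω) hs
    have hbδ : 0 ≤ b * δ := mul_nonneg hb d.pos.le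
    have a5 := mul_le_mul_of_nonneg_left (add_le_add a1 a2) hbδ
    have : b * δ * ((s + ξ k ω ^ 2 / s) / 2 + (s + η k ω ^ 2 / s) / 2) =
      ξ k ω ^ 2 * (b * δ / (2 * s)) + η k ω ^ 2 * (b * δ / (2 * s)) + b * δ * s := by
      field_simp; ring
    have h4 : (s * ξ k ω ^ 2 + ξ k ω ^ 4 / s) / 2 * 4 = ξ k ω ^ 2 * (2 * s) + ξ k ω ^ 4 * (2 / s) := by
      ring
    have h5 : (s * η k ω ^ 2 + η k ω ^ 4 / s) / 2 * 4 = η k ω ^ 2 * (2 * s) + η k ω ^ 4 * (2 / s) := by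
      ring
    nlinarith

lemma DN.int_cross (d : DN μ G ξ η δ) (k : ℕ) : Integrable (fun ω => ξ k ω * η k ω) μ :=
  ((d.lp1 k).mono_exponent (by norm_num : (2 : ENNReal) ≤ 4)).integrable_mul
      ((d.lp2 k).mono_exponent (by norm_num : (2 : ENNReal) ≤ 4))

lemma ito_step (d : DN μ G ξ η δ) (hδ1 : δ ≤ 1) {k : ℕ} {V β h1 h2 : Ω → ℝ} {b : ℝ}
    (hV : Measurable[G k] V) (mβ : Measurable β) (bβ : ∀ ω, |β ω| ≤ b)
    (m1 : Measurable[G k] h1) (b1 : ∀ ω, |h1 ω| ≤ 1)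
    (m2 : Measurable[G k] h2) (b2 : ∀ ω, |h2 ω| ≤ 1)
    {f f1 f2 : ℝ → ℝ} {K : ℝ} (t : TF f f1 f2 K) (hi : Integrable (fun ω => f (V ω)) μ) :
    Integrable (fun ω => f (V ω + (β ω * δ + (h1 ω * ξ k ω + h2 ω * η k ω)))) μ ∧
    |∫ ω, f (V ω + (β ω * δ + (h1 ω * ξ k ω + h2 ω * η k ω))) ∂μ - ∫ ω, f (V ω) ∂μ -
      δ * ∫ ω, (f1 (V ω) * β ω + f2 (V ω) * (h1 ω ^ 2 + h2 ω ^ 2) / 2) ∂μ| ≤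
      K * CI b * (δ * √δ) := by
  have hb : 0 ≤ b := by
    obtain ⟨ω⟩ : Nonempty Ω := by
      by_contra hne
      rw [not_nonempty_iff] at hne
      have := measure_univ (μ := μ)
      rw [univ_eq_empty_iff.2 hne] at this
      simp at this
    exact (abs_nonneg _).trans (bβ ω)
  obtain ⟨M, hM, hMi, hMb⟩ := ito_maj d hδ1 hb k
  have hK := t.K0
  have c0 := t.c0
  have c1 := t.c1
  have c2 := t.c2
  have V' := d.mL hV
  have m1' := d.mL m1
  have m2' := d.mL m2
  have mξ := d.mξ k
  have mη := d.mη k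
  set z : Ω → ℝ := fun ω => h1 ω * ξ k ω + h2 ω * η k ω with hz
  set R : Ω → ℝ := fun ω => f (V ω + (β ω * δ + z ω)) - f (V ω) - f1 (V ω) * z ω
    - f2 (V ω) * z ω ^ 2 / 2 - δ * (f1 (V ω) * β ω) with hR
  have mR : Measurable R := by
    simp only [hR, hz]
    fun_prop
  have zb : ∀ ω, |z ω| ≤ |ξ k ω| + |η k ω| := by
    intro ω
    refine (abs_add_le _ _).trans (add_le_add ?_ ?_)
    · rw [abs_mul]; exact mul_le_of_le_one_left (abs_nonneg _) (b1 ω)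
    · rw [abs_mul]; exact mul_le_of_le_one_left (abs_nonneg _) (b2 ω)
  have Rb : ∀ ω, |R ω| ≤ K * M ω := by
    intro ω
    refine le_trans ?_ (mul_le_mul_of_nonneg_left (hMb ω) hK)
    have t1 := taylor3 t.d1 t.d2 t.lip (V ω) (z ω)
    have hβδ : |β ω * δ| ≤ b * δ := by
      rw [abs_mul, abs_of_pos d.pos]
      exact mul_le_mul_of_nonneg_right (bβ ω) d.pos.le
    have t2 : |f (V ω + (β ω * δ + z ω)) - f (V ω + z ω) - f1 (V ω) * (β ω * δ)| ≤
        K * (|z ω| + b * δ) * (b * δ) := by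
      have := Convex.norm_image_sub_le_of_norm_hasDerivWithin_le (s := uIcc 0 (β ω * δ))
        (f := fun w => f (V ω + z ω + w) - f1 (V ω) * w)
        (f' := fun w => f1 (V ω + z ω + w) - f1 (V ω)) (C := K * (|z ω| + b * δ))
        (x := 0) (y := β ω * δ) ?_ ?_ (convex_uIcc 0 _) (by simp) (by simp)
      · simp only [Real.norm_eq_abs, add_zero, mul_zero, sub_zero] at this
        calc _ = |f (V ω + z ω + β ω * δ) - f1 (V ω) * (β ω * δ) - f (V ω + z ω)| := by
              rw [show V ω + (β ω * δ + z ω) = V ω + z ω + β ω * δ by ring]; congr 1; ring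
          _ ≤ K * (|z ω| + b * δ) * |β ω * δ| := this
          _ ≤ _ := by
            refine mul_le_mul_of_nonneg_left hβδ ?_
            have := d.pos.le
            positivity
      · intro y _
        have e1 : HasDerivAt (fun w => f (V ω + z ω + w)) (f1 (V ω + z ω + y)) y := by
          simpa using (t.d1 (V ω + z ω + y)).comp_const_add (V ω + z ω) y
        have e2 : HasDerivAt (fun w => f1 (V ω) * w) (f1 (V ω)) y := by
          simpa using (hasDerivAt_id y).const_mul (f1 (V ω))
        exact (e1.sub e2).hasDerivWithinAt
      · intro y hy
        rw [Real.norm_eq_abs]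
        refine (lip_of_deriv t.d2 t.b2 _ _).trans ?_
        refine mul_le_mul_of_nonneg_left ?_ hK
        have : |y| ≤ |β ω * δ| := by
          have := abs_sub_left_of_mem_uIcc hy
          simpa using this
        calc |V ω + z ω + y - V ω| = |z ω + y| := by congr 1; ring
          _ ≤ |z ω| + |y| := abs_add_le _ _
          _ ≤ _ := by linarith
    have e : R ω = (f (V ω + (β ω * δ + z ω)) - f (V ω + z ω) - f1 (V ω) * (β ω * δ)) +
        (f (V ω + z ω) - f (V ω) - f1 (V ω) * z ω - f2 (V ω) * z ω ^ 2 / 2) := by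
      simp only [hR]; ring
    rw [e]
    refine (abs_add_le _ _).trans ((add_le_add t2 t1).trans ?_)
    have z3 : |z ω| ^ 3 ≤ 4 * (|ξ k ω| ^ 3 + |η k ω| ^ 3) := by
      refine (pow_le_pow_left₀ (abs_nonneg _) (zb ω) 3).trans ?_
      have p := abs_nonneg (ξ k ω)
      have q := abs_nonneg (η k ω)
      nlinarith [mul_nonneg (add_nonneg p q) (sq_nonneg (|ξ k ω| - |η k ω|))]
    rw [mul_assoc, ← mul_add]
    refine mul_le_mul_of_nonneg_left (add_le_add ?_ z3) hK
    rw [mul_comm]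
    refine mul_le_mul_of_nonneg_left (by linarith [zb ω]) (mul_nonneg hb d.pos.le)
  have hRi : Integrable R μ := (hM.const_mul K).mono' mR.aestronglyMeasurable (ae_of_all _ Rb)
  -- the individual terms
  have g1 : Measurable[G k] (fun ω => f1 (V ω) * h1 ω) := (c1.comp hV).mul m1
  have g2 : Measurable[G k] (fun ω => f1 (V ω) * h2 ω) := (c1.comp hV).mul m2
  have q1 : Measurable[G k] (fun ω => f2 (V ω) * h1 ω ^ 2 / 2) :=
    ((c2.comp hV).mul (m1.pow_const 2)).div_const 2
  have q2 : Measurable[G k] (fun ω => f2 (V ω) * h2 ω ^ 2 / 2) :=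
    ((c2.comp hV).mul (m2.pow_const 2)).div_const 2
  have q3 : Measurable[G k] (fun ω => f2 (V ω) * h1 ω * h2 ω) := ((c2.comp hV).mul m1).mul m2
  have bm : ∀ {x y c d : ℝ}, |x| ≤ c → |y| ≤ d → |x * y| ≤ c * d := by
    intro x y c d hx hy
    rw [abs_mul]
    exact mul_le_mul hx hy (abs_nonneg _) ((abs_nonneg _).trans hx)
  have sq1 : ∀ {x : ℝ}, |x| ≤ 1 → |x ^ 2| ≤ 1 := by
    intro x hx
    rw [abs_pow]
    exact pow_le_one₀ (abs_nonneg _) hx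
  have g1b : ∀ ω, |f1 (V ω) * h1 ω| ≤ K * 1 := fun ω => bm (t.b1 _) (b1 ω)
  have g2b : ∀ ω, |f1 (V ω) * h2 ω| ≤ K * 1 := fun ω => bm (t.b1 _) (b2 ω)
  have q1b : ∀ ω, |f2 (V ω) * h1 ω ^ 2 / 2| ≤ K * 1 / 2 := fun ω => by
    rw [abs_div, abs_two]
    exact div_le_div_of_nonneg_right (bm (t.b2 _) (sq1 (b1 ω))) two_pos.le
  have q2b : ∀ ω, |f2 (V ω) * h2 ω ^ 2 / 2| ≤ K * 1 / 2 := fun ω => by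
    rw [abs_div, abs_two]
    exact div_le_div_of_nonneg_right (bm (t.b2 _) (sq1 (b2 ω))) two_pos.le
  have q3b : ∀ ω, |f2 (V ω) * h1 ω * h2 ω| ≤ K * 1 * 1 := fun ω =>
    bm (bm (t.b2 _) (b1 ω)) (b2 ω)
  have i1 := d.integrable_mul g1 (bdd_int (d.mL g1) g1b) (k := 1) (by norm_num)
  have i2 := d.swap.integrable_mul g2 (bdd_int (d.mL g2) g2b) (k := 1) (by norm_num)
  have i3 := d.integrable_mul q1 (bdd_int (d.mL q1) q1b) (k := 2) (by norm_num)
  have i4 := d.swap.integrable_mul q2 (bdd_int (d.mL q2) q2b) (k := 2) (by norm_num)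
  have i5 : Integrable (fun ω => f2 (V ω) * h1 ω * h2 ω * (ξ k ω * η k ω)) μ :=
    (d.int_cross k).bdd_mul (c := K * 1 * 1) (d.mL q3).aestronglyMeasurable (ae_of_all _ q3b)
  have i6 : Integrable (fun ω => f1 (V ω) * β ω) μ :=
    bdd_int ((c1.comp V').mul mβ) (fun ω => bm (t.b1 _) (bβ ω))
  simp only [pow_one] at i1 i2
  have E1 := d.integral_mul_one g1
  have E2 := d.swap.integral_mul_one g2
  have E3 := d.integral_mul_two q1
  have E4 := d.swap.integral_mul_two q2
  have E5 := d.cross k _ q3 ⟨_, q3b⟩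
  have dec : ∀ ω, f (V ω + (β ω * δ + z ω)) = (f (V ω) + (f1 (V ω) * h1 ω * ξ k ω +
      (f1 (V ω) * h2 ω * η k ω + (f2 (V ω) * h1 ω ^ 2 / 2 * ξ k ω ^ 2 +
      (f2 (V ω) * h2 ω ^ 2 / 2 * η k ω ^ 2 + (f2 (V ω) * h1 ω * h2 ω * (ξ k ω * η k ω) +
      (δ * (f1 (V ω) * β ω) + R ω))))))) := by
    intro ω
    simp only [hR, hz]
    ring
  have i7 := iadd (i6.const_mul δ) hRi
  have i8 := iadd i5 i7
  have i9 := iadd i4 i8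
  have i10 := iadd i3 i9
  have i11 := iadd i2 i10
  have i12 := iadd i1 i11
  refine ⟨?_, ?_⟩
  · refine (iadd hi i12).congr (ae_of_all _ fun ω => ?_)
    exact (dec ω).symm
  · have tot : ∫ ω, f (V ω + (β ω * δ + z ω)) ∂μ = ∫ ω, f (V ω) ∂μ +
        (δ * ∫ ω, f2 (V ω) * h1 ω ^ 2 / 2 ∂μ + (δ * ∫ ω, f2 (V ω) * h2 ω ^ 2 / 2 ∂μ +
        (δ * ∫ ω, f1 (V ω) * β ω ∂μ + ∫ ω, R ω ∂μ))) := by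
      simp_rw [dec]
      rw [integral_add hi i12, integral_add i1 i11, integral_add i2 i10, integral_add i3 i9,
        integral_add i4 i8, integral_add i5 i7, integral_add (i6.const_mul δ) hRi, E1, E2, E3, E4,
        E5, integral_const_mul]
      ring
    have e3 : ∫ ω, (f1 (V ω) * β ω + f2 (V ω) * (h1 ω ^ 2 + h2 ω ^ 2) / 2) ∂μ =
        ∫ ω, f1 (V ω) * β ω ∂μ + (∫ ω, f2 (V ω) * h1 ω ^ 2 / 2 ∂μ +
          ∫ ω, f2 (V ω) * h2 ω ^ 2 / 2 ∂μ) := by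
      rw [← integral_add (bdd_int (d.mL q1) q1b) (bdd_int (d.mL q2) q2b),
        ← integral_add i6 (iadd (bdd_int (d.mL q1) q1b) (bdd_int (d.mL q2) q2b))]
      congr 1; ext ω; ring
    rw [tot, e3]
    have : ∫ ω, f (V ω) ∂μ +
        (δ * ∫ ω, f2 (V ω) * h1 ω ^ 2 / 2 ∂μ + (δ * ∫ ω, f2 (V ω) * h2 ω ^ 2 / 2 ∂μ +
        (δ * ∫ ω, f1 (V ω) * β ω ∂μ + ∫ ω, R ω ∂μ))) - ∫ ω, f (V ω) ∂μ -
        δ * (∫ ω, f1 (V ω) * β ω ∂μ + (∫ ω, f2 (V ω) * h1 ω ^ 2 / 2 ∂μ +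
          ∫ ω, f2 (V ω) * h2 ω ^ 2 / 2 ∂μ)) = ∫ ω, R ω ∂μ := by ring
    rw [this]
    calc |∫ ω, R ω ∂μ| ≤ ∫ ω, |R ω| ∂μ := abs_integral_le_integral_abs
      _ ≤ ∫ ω, K * M ω ∂μ := integral_mono hRi.abs (hM.const_mul K) Rb
      _ = K * ∫ ω, M ω ∂μ := integral_const_mul _ _
      _ ≤ K * (CI b * (δ * √δ)) := mul_le_mul_of_nonneg_left hMi hK
      _ = _ := by ring

lemma PS_succ (V0 : Ω → ℝ) (β h1 h2 ξ η : ℕ → Ω → ℝ) (δ : ℝ) (k : ℕ) (ω : Ω) :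
    PS V0 β h1 h2 ξ η δ (k + 1) ω = PS V0 β h1 h2 ξ η δ k ω +
      (β k ω * δ + (h1 k ω * ξ k ω + h2 k ω * η k ω)) := by
  simp only [PS, Finset.sum_range_succ]
  ring

lemma PS_meas (d : DN0 μ G ξ η δ) {V0 : Ω → ℝ} (hV : Measurable[G 0] V0) {β h1 h2 : ℕ → Ω → ℝ}
    {b : ℝ} (aβ : AD G β b) (a1 : AD G h1 1) (a2 : AD G h2 1) (k : ℕ) :
    Measurable[G k] (PS V0 β h1 h2 ξ η δ k) := by
  refine Measurable.add (hV.mono (d.mono (Nat.zero_le k)) le_rfl) ?_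
  refine Finset.measurable_fun_sum _ fun j hj => ?_
  have hj' : j + 1 ≤ k := Finset.mem_range.1 hj
  have l1 : G j ≤ G k := d.mono (by omega)
  have l2 : G (j + 1) ≤ G k := d.mono hj'
  exact (((aβ.ms j).mono l1 le_rfl).mul_const δ).add
    ((((a1.ms j).mono l1 le_rfl).mul ((d.m1 j).mono l2 le_rfl)).add
      (((a2.ms j).mono l1 le_rfl).mul ((d.m2 j).mono l2 le_rfl)))

lemma ito_sum (d : DN μ G ξ η δ) (hδ1 : δ ≤ 1) {V0 : Ω → ℝ} (hV : Measurable[G 0] V0)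
    {β h1 h2 : ℕ → Ω → ℝ} {b : ℝ} (aβ : AD G β b) (a1 : AD G h1 1) (a2 : AD G h2 1)
    {f f1 f2 : ℝ → ℝ} {K : ℝ} (t : TF f f1 f2 K) (hi : Integrable (fun ω => f (V0 ω)) μ) (n : ℕ) :
    Integrable (fun ω => f (PS V0 β h1 h2 ξ η δ n ω)) μ ∧
    |∫ ω, f (PS V0 β h1 h2 ξ η δ n ω) ∂μ - ∫ ω, f (V0 ω) ∂μ -
      δ * ∑ j ∈ Finset.range n, ∫ ω, (f1 (PS V0 β h1 h2 ξ η δ j ω) * β j ω +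
        f2 (PS V0 β h1 h2 ξ η δ j ω) * (h1 j ω ^ 2 + h2 j ω ^ 2) / 2) ∂μ| ≤
      n * (K * CI b * (δ * √δ)) := by
  induction n with
  | zero => simpa [PS] using hi
  | succ n ih =>
    obtain ⟨ih1, ih2⟩ := ih
    obtain ⟨s1, s2⟩ := ito_step d hδ1 (k := n) (PS_meas d.toDN0 hV aβ a1 a2 n) (d.mL (aβ.ms n))
      (aβ.bd n) (a1.ms n) (a1.bd n) (a2.ms n) (a2.bd n) t ih1
    simp only [PS_succ]
    refine ⟨s1, ?_⟩
    rw [Finset.sum_range_succ]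
    push_cast
    have := (abs_add_le _ _).trans (add_le_add ih2 s2)
    refine le_trans (le_of_eq ?_) (this.trans (le_of_eq ?_))
    · congr 1; ring
    · ring

end disc

/-! ### Isometry, maximal inequality and anti-concentration -/

/-- discrete stochastic integrals -/
def LS (h1 h2 ξ η : ℕ → Ω → ℝ) (k : ℕ) (ω : Ω) : ℝ :=
  ∑ j ∈ Finset.range k, (h1 j ω * ξ j ω + h2 j ω * η j ω)

section disc2
variable {μ : Measure Ω} [IsProbabilityMeasure μ] {G : ℕ → MeasurableSpace Ω}
  {ξ η : ℕ → Ω → ℝ} {δ : ℝ}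

lemma LS_meas (d : DN0 μ G ξ η δ) {h1 h2 : ℕ → Ω → ℝ}
    (a1 : AD G h1 1) (a2 : AD G h2 1) (k : ℕ) :
    Measurable[G k] (LS h1 h2 ξ η k) := by
  refine Finset.measurable_fun_sum _ fun j hj => ?_
  have hj' : j + 1 ≤ k := Finset.mem_range.1 hj
  have l1 : G j ≤ G k := d.mono (by omega)
  have l2 : G (j + 1) ≤ G k := d.mono hj'
  exact ((((a1.ms j).mono l1 le_rfl).mul ((d.m1 j).mono l2 le_rfl)).add
      (((a2.ms j).mono l1 le_rfl).mul ((d.m2 j).mono l2 le_rfl)))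

lemma LS_memLp (d : DN0 μ G ξ η δ) {h1 h2 : ℕ → Ω → ℝ}
    (a1 : AD G h1 1) (a2 : AD G h2 1) (k : ℕ) :
    MemLp (LS h1 h2 ξ η k) 2 μ := by
  have : MemLp (fun ω => ∑ j ∈ Finset.range k, (h1 j ω * ξ j ω + h2 j ω * η j ω)) 2 μ := by
    refine memLp_finsetSum _ fun j _ => ?_
    have e1 : MemLp (fun ω => h1 j ω * ξ j ω) 2 μ :=
      MemLp.of_le ((d.lp1 j).mono_exponent (by norm_num : (2 : ENNReal) ≤ 4))
        ((d.mL (a1.ms j)).mul (d.mξ j)).aestronglyMeasurable (ae_of_all _ fun ω => by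
          rw [norm_mul]; exact mul_le_of_le_one_left (norm_nonneg _) (a1.bd j ω))
    have e2 : MemLp (fun ω => h2 j ω * η j ω) 2 μ :=
      MemLp.of_le ((d.lp2 j).mono_exponent (by norm_num : (2 : ENNReal) ≤ 4))
        ((d.mL (a2.ms j)).mul (d.mη j)).aestronglyMeasurable (ae_of_all _ fun ω => by
          rw [norm_mul]; exact mul_le_of_le_one_left (norm_nonneg _) (a2.bd j ω))
    exact e1.add e2
  exact this

lemma LS_succ (h1 h2 ξ η : ℕ → Ω → ℝ) (k : ℕ) (ω : Ω) :
    LS h1 h2 ξ η (k + 1) ω = LS h1 h2 ξ η k ω + (h1 k ω * ξ k ω + h2 k ω * η k ω) :=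
  Finset.sum_range_succ _ _

lemma bmul {x y c d : ℝ} (hx : |x| ≤ c) (hy : |y| ≤ d) : |x * y| ≤ c * d := by
  rw [abs_mul]
  exact mul_le_mul hx hy (abs_nonneg _) ((abs_nonneg _).trans hx)

lemma LS_step (d : DN μ G ξ η δ) {h1 h2 : ℕ → Ω → ℝ}
    (a1 : AD G h1 1) (a2 : AD G h2 1) (k : ℕ) {Z : Ω → ℝ} (hZ : Measurable[G k] Z)
    (bZ : ∀ ω, |Z ω| ≤ 1) :
    ∫ ω, Z ω * LS h1 h2 ξ η (k + 1) ω ^ 2 ∂μ = ∫ ω, Z ω * LS h1 h2 ξ η k ω ^ 2 ∂μ +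
      δ * ∫ ω, Z ω * (h1 k ω ^ 2 + h2 k ω ^ 2) ∂μ := by
  have mS := LS_meas d.toDN0 a1 a2 k
  have lS := LS_memLp d.toDN0 a1 a2 k
  have m1 := a1.ms k
  have m2 := a2.ms k
  have b1 := a1.bd k
  have b2 := a2.bd k
  set S := LS h1 h2 ξ η k
  have iS : Integrable S μ := lS.integrable (by norm_num)
  have iS2 : Integrable (fun ω => S ω ^ 2) μ := lS.integrable_sq
  have i0 : Integrable (fun ω => Z ω * S ω ^ 2) μ :=
    iS2.bdd_mul (c := 1) (d.mL hZ).aestronglyMeasurable (ae_of_all _ bZ)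
  have iZh : ∀ h : Ω → ℝ, Measurable[G k] h → (∀ ω, |h ω| ≤ 1) →
      Integrable (fun ω => Z ω * (2 * h ω) * S ω) μ := by
    intro h mh bh
    refine iS.bdd_mul (c := 1 * (2 * 1)) ((d.mL hZ).mul ((d.mL mh).const_mul 2)).aestronglyMeasurable
      (ae_of_all _ fun ω => bmul (bZ ω) (bmul ?_ (bh ω)))
    norm_num
  have g1 : Measurable[G k] (fun ω => Z ω * (2 * h1 k ω) * S ω) := (hZ.mul (m1.const_mul 2)).mul mS
  have g2 : Measurable[G k] (fun ω => Z ω * (2 * h2 k ω) * S ω) := (hZ.mul (m2.const_mul 2)).mul mS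
  have q1 : Measurable[G k] (fun ω => Z ω * (h1 k ω * h1 k ω)) := hZ.mul (m1.mul m1)
  have q2 : Measurable[G k] (fun ω => Z ω * (h2 k ω * h2 k ω)) := hZ.mul (m2.mul m2)
  have q3 : Measurable[G k] (fun ω => Z ω * (2 * (h1 k ω * h2 k ω))) :=
    hZ.mul ((m1.mul m2).const_mul 2)
  have q1b : ∀ ω, |Z ω * (h1 k ω * h1 k ω)| ≤ 1 * (1 * 1) := fun ω =>
    bmul (bZ ω) (bmul (b1 ω) (b1 ω))
  have q2b : ∀ ω, |Z ω * (h2 k ω * h2 k ω)| ≤ 1 * (1 * 1) := fun ω =>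
    bmul (bZ ω) (bmul (b2 ω) (b2 ω))
  have q3b : ∀ ω, |Z ω * (2 * (h1 k ω * h2 k ω))| ≤ 1 * (2 * (1 * 1)) := fun ω =>
    bmul (bZ ω) (bmul (by norm_num) (bmul (b1 ω) (b2 ω)))
  have i1 := d.integrable_mul g1 (iZh _ m1 b1) (k := 1) (by norm_num)
  have i2 := d.swap.integrable_mul g2 (iZh _ m2 b2) (k := 1) (by norm_num)
  simp only [pow_one] at i1 i2
  have i3 := d.integrable_mul q1 (bdd_int (d.mL q1) q1b) (k := 2) (by norm_num)
  have i4 := d.swap.integrable_mul q2 (bdd_int (d.mL q2) q2b) (k := 2) (by norm_num)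
  have i5 : Integrable (fun ω => Z ω * (2 * (h1 k ω * h2 k ω)) * (ξ k ω * η k ω)) μ :=
    (d.int_cross k).bdd_mul (c := 1 * (2 * (1 * 1))) (d.mL q3).aestronglyMeasurable (ae_of_all _ q3b)
  have dec : ∀ ω, Z ω * LS h1 h2 ξ η (k + 1) ω ^ 2 = Z ω * S ω ^ 2 +
      (Z ω * (2 * h1 k ω) * S ω * ξ k ω + (Z ω * (2 * h2 k ω) * S ω * η k ω +
      (Z ω * (h1 k ω * h1 k ω) * ξ k ω ^ 2 + (Z ω * (h2 k ω * h2 k ω) * η k ω ^ 2 +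
      Z ω * (2 * (h1 k ω * h2 k ω)) * (ξ k ω * η k ω))))) := by
    intro ω
    rw [LS_succ]
    ring
  have i9 := iadd i4 i5
  have i10 := iadd i3 i9
  have i11 := iadd i2 i10
  have i12 := iadd i1 i11
  simp_rw [dec]
  rw [integral_add i0 i12, integral_add i1 i11, integral_add i2 i10, integral_add i3 i9,
    integral_add i4 i5, d.integral_mul_one g1, d.swap.integral_mul_one g2, d.integral_mul_two q1,
    d.swap.integral_mul_two q2, d.cross k _ q3 ⟨_, q3b⟩]
  have : ∫ ω, Z ω * (h1 k ω ^ 2 + h2 k ω ^ 2) ∂μ = ∫ ω, Z ω * (h1 k ω * h1 k ω) ∂μ +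
      ∫ ω, Z ω * (h2 k ω * h2 k ω) ∂μ := by
    rw [← integral_add (bdd_int (d.mL q1) q1b) (bdd_int (d.mL q2) q2b)]
    congr 1; ext ω; ring
  rw [this]
  ring

lemma isometry (d : DN μ G ξ η δ) {h1 h2 : ℕ → Ω → ℝ}
    (a1 : AD G h1 1) (a2 : AD G h2 1) (n : ℕ) :
    ∫ ω, LS h1 h2 ξ η n ω ^ 2 ∂μ = δ * ∑ j ∈ Finset.range n, ∫ ω, (h1 j ω ^ 2 + h2 j ω ^ 2) ∂μ := by
  induction n with
  | zero => simp [LS]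
  | succ n ih =>
    have := LS_step d a1 a2 n (Z := fun _ => 1) measurable_const (by simp)
    simp only [one_mul] at this
    rw [this, ih, Finset.sum_range_succ]
    ring

lemma doob (d : DN μ G ξ η δ) {h1 h2 : ℕ → Ω → ℝ}
    (a1 : AD G h1 1) (a2 : AD G h2 1) (n : ℕ) {ε : ℝ} (hε : 0 < ε) :
    μ.real {ω | ∃ k ≤ n, ε ≤ |LS h1 h2 ξ η k ω|} ≤
      ε⁻¹ ^ 2 * (δ * ∑ j ∈ Finset.range n, ∫ ω, (h1 j ω ^ 2 + h2 j ω ^ 2) ∂μ) := by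
  have lS := LS_memLp d.toDN0 a1 a2
  have hsub : Submartingale (fun k ω => LS h1 h2 ξ η k ω ^ 2) (⟨G, d.mono, d.le⟩ : Filtration ℕ m) μ := by
    refine submartingale_of_setIntegral_le_succ ?_ (fun i => (lS i).integrable_sq) ?_
    · intro k
      exact ((LS_meas d.toDN0 a1 a2 k).pow_const 2).stronglyMeasurable
    · intro k s hs
      have hs' : MeasurableSet s := d.le k _ hs
      have := LS_step d a1 a2 k (Z := s.indicator 1) (Measurable.indicator (m := G k) (@measurable_const _ _ _ (G k) (1 : ℝ)) hs) (by
        intro ω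
        by_cases h : ω ∈ s <;> simp [h])
      have e : ∀ g : Ω → ℝ, ∫ ω in s, g ω ∂μ = ∫ ω, s.indicator 1 ω * g ω ∂μ := by
        intro g
        rw [← integral_indicator hs']
        congr 1
        ext ω
        by_cases h : ω ∈ s <;> simp [h]
      rw [e, e, this]
      have p : 0 ≤ ∫ ω, s.indicator 1 ω * (h1 k ω ^ 2 + h2 k ω ^ 2) ∂μ := by
        refine integral_nonneg fun ω => mul_nonneg (indicator_nonneg (fun _ _ => zero_le_one) ω) ?_
        positivity
      have := mul_nonneg d.pos.le p
      linarith
  obtain ⟨e, he⟩ : ∃ e : NNReal, (e : ℝ) = ε ^ 2 := ⟨⟨ε ^ 2, by positivity⟩, rfl⟩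
  have key := maximal_ineq hsub (fun k ω => sq_nonneg _) (ε := e) n
  have setEq : {ω | (e : ℝ) ≤ (Finset.range (n + 1)).sup'
      Finset.nonempty_range_add_one fun k => LS h1 h2 ξ η k ω ^ 2} =
      {ω | ∃ k ≤ n, ε ≤ |LS h1 h2 ξ η k ω|} := by
    ext ω
    simp only [mem_setOf_eq, Finset.le_sup'_iff, Finset.mem_range, Nat.lt_succ_iff]
    refine exists_congr fun k => and_congr_right fun _ => ?_
    rw [he, ← sq_abs (LS h1 h2 ξ η k ω)]
    exact pow_le_pow_iff_left₀ hε.le (abs_nonneg _) two_ne_zero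
  rw [setEq] at key
  have k2 := ENNReal.toReal_mono (by simp) key
  rw [ENNReal.toReal_mul, ENNReal.toReal_ofReal (setIntegral_nonneg_of_ae (ae_of_all _ fun ω => sq_nonneg _))] at k2
  have k3 : ∫ ω in {ω | ∃ k ≤ n, ε ≤ |LS h1 h2 ξ η k ω|}, LS h1 h2 ξ η n ω ^ 2 ∂μ ≤
      ∫ ω, LS h1 h2 ξ η n ω ^ 2 ∂μ :=
    setIntegral_le_integral (lS n).integrable_sq (ae_of_all _ fun ω => sq_nonneg _)
  rw [isometry d a1 a2] at k3
  have k4 := k2.trans k3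
  change (e : ℝ) * μ.real _ ≤ _ at k4
  rw [he] at k4
  rw [inv_pow, inv_mul_eq_div, le_div_iff₀ (by positivity), mul_comm]
  exact k4

lemma TF_cos (u : ℝ) : TF (fun x => Real.cos (u * x)) (fun x => -(u * Real.sin (u * x)))
    (fun x => -(u ^ 2 * Real.cos (u * x))) (3 * (1 + u ^ 4)) := by
  have h1 : |u| ≤ 3 * (1 + u ^ 4) := by
    rw [← (show Even 4 by decide).pow_abs u]
    nlinarith [sq_nonneg (|u| - 1), sq_nonneg (|u| ^ 2 - 1)]
  have h2 : u ^ 2 ≤ 3 * (1 + u ^ 4) := by nlinarith [sq_nonneg (u ^ 2 - 1)]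
  have h3 : u ^ 2 * |u| ≤ 3 * (1 + u ^ 4) := by
    rw [← (show Even 4 by decide).pow_abs u, ← sq_abs u]
    nlinarith [sq_nonneg (|u| - 1), sq_nonneg (|u| ^ 2 - 1), sq_nonneg (|u| ^ 2 - |u|)]
  have d0 : ∀ x : ℝ, HasDerivAt (fun x => u * x) u x := fun x => by
    simpa using (hasDerivAt_id x).const_mul u
  refine ⟨fun x => ?_, fun x => ?_, fun x => ?_, fun x => ?_, fun x y => ?_⟩
  · convert (d0 x).cos using 1; ring
  · have := ((d0 x).sin.const_mul u).neg
    rw [show -(u * (Real.cos (u * x) * u)) = -(u ^ 2 * Real.cos (u * x)) by ring] at this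
    exact this
  · rw [abs_neg, abs_mul]
    exact (mul_le_of_le_one_right (abs_nonneg _) (Real.abs_sin_le_one _)).trans h1
  · rw [abs_neg, abs_mul, abs_of_nonneg (sq_nonneg u)]
    exact (mul_le_of_le_one_right (sq_nonneg _) (Real.abs_cos_le_one _)).trans h2
  · rw [show -(u ^ 2 * Real.cos (u * x)) - -(u ^ 2 * Real.cos (u * y)) =
      u ^ 2 * (Real.cos (u * y) - Real.cos (u * x)) by ring, abs_mul, abs_of_nonneg (sq_nonneg u)]
    calc u ^ 2 * |Real.cos (u * y) - Real.cos (u * x)| ≤ u ^ 2 * |u * y - u * x| :=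
          mul_le_mul_of_nonneg_left (Real.abs_cos_sub_cos_le _ _) (sq_nonneg u)
      _ = (u ^ 2 * |u|) * |x - y| := by rw [← mul_sub, abs_mul, abs_sub_comm y x]; ring
      _ ≤ _ := mul_le_mul_of_nonneg_right h3 (abs_nonneg _)

lemma cos_bound (d : DN μ G ξ η δ) (hδ1 : δ ≤ 1) {V0 : Ω → ℝ} (hV : Measurable[G 0] V0)
    {h1 h2 : ℕ → Ω → ℝ} (a1 : AD G h1 1) (a2 : AD G h2 1)
    (hu : ∀ j ω, h1 j ω ^ 2 + h2 j ω ^ 2 = 1) (u : ℝ) (n : ℕ) :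
    |∫ ω, Real.cos (u * (V0 ω + LS h1 h2 ξ η n ω)) ∂μ| ≤ Real.exp (-(n * δ / 2 * u ^ 2)) +
      (3 * CI 0 * (n * δ) + 1) * √δ * (1 + u ^ 4) := by
  have hs : 0 < √δ := Real.sqrt_pos.2 d.pos
  have hss : √δ * √δ = δ := Real.mul_self_sqrt d.pos.le
  have hs1 : √δ ≤ 1 := Real.sqrt_le_one.2 hδ1
  have hC := CI_nonneg (b := 0) le_rfl
  have hδ := d.pos
  have a_le : ∀ V : Ω → ℝ, |∫ ω, Real.cos (u * V ω) ∂μ| ≤ 1 := by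
    intro V
    have := norm_integral_le_of_norm_le_const (μ := μ) (f := fun ω => Real.cos (u * V ω)) (C := 1)
      (ae_of_all _ fun ω => Real.abs_cos_le_one _)
    simpa using this
  rcases le_or_gt (u ^ 2 * δ) 2 with hsmall | hbig
  · have mV : ∀ n, Measurable[G n] (fun ω => V0 ω + LS h1 h2 ξ η n ω) := fun n =>
      (hV.mono (d.mono (Nat.zero_le n)) le_rfl).add (LS_meas d.toDN0 a1 a2 n)
    have main : ∀ n : ℕ, |∫ ω, Real.cos (u * (V0 ω + LS h1 h2 ξ η n ω)) ∂μ| ≤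
        Real.exp (-(n * δ / 2 * u ^ 2)) + n * (3 * (1 + u ^ 4) * CI 0 * (δ * √δ)) := by
      intro n
      induction n with
      | zero => simpa using a_le _
      | succ n ih =>
        have st := (ito_step d hδ1 (k := n) (mV n) (β := fun _ => 0) (b := 0) measurable_const
          (by simp) (a1.ms n) (a1.bd n) (a2.ms n) (a2.bd n) (TF_cos u)
          (bdd_int (C := 1) (by have := d.mL (mV n); fun_prop) fun ω => Real.abs_cos_le_one _)).2
        simp only [hu, zero_mul, mul_zero, zero_add, mul_one] at st
        have e : ∀ ω, V0 ω + LS h1 h2 ξ η n ω + (h1 n ω * ξ n ω + h2 n ω * η n ω) =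
            V0 ω + LS h1 h2 ξ η (n + 1) ω := by
          intro ω; rw [LS_succ]; ring
        simp only [e] at st
        have e2 : ∫ ω, -(u ^ 2 * Real.cos (u * (V0 ω + LS h1 h2 ξ η n ω))) / 2 ∂μ =
            -(u ^ 2 / 2) * ∫ ω, Real.cos (u * (V0 ω + LS h1 h2 ξ η n ω)) ∂μ := by
          rw [← integral_const_mul]
          congr 1; ext ω; ring
        rw [e2] at st
        set A := ∫ ω, Real.cos (u * (V0 ω + LS h1 h2 ξ η n ω)) ∂μ
        set A' := ∫ ω, Real.cos (u * (V0 ω + LS h1 h2 ξ η (n + 1) ω)) ∂μ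
        set e0 := 3 * (1 + u ^ 4) * CI 0 * (δ * √δ)
        have he0 : 0 ≤ e0 := by positivity
        have hfac : 0 ≤ 1 - u ^ 2 * δ / 2 := by linarith
        have hexp : 1 - u ^ 2 * δ / 2 ≤ Real.exp (-(u ^ 2 * δ / 2)) := by
          have := Real.add_one_le_exp (-(u ^ 2 * δ / 2))
          linarith
        have h3 : |A'| ≤ (1 - u ^ 2 * δ / 2) * |A| + e0 := by
          have : A' = (1 - u ^ 2 * δ / 2) * A + (A' - A - δ * (-(u ^ 2 / 2) * A)) := by ring
          rw [this]
          refine (abs_add_le _ _).trans (add_le_add ?_ st)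
          rw [abs_mul, abs_of_nonneg hfac]
        have h4 : (1 - u ^ 2 * δ / 2) * |A| ≤ Real.exp (-(u ^ 2 * δ / 2)) *
            Real.exp (-(n * δ / 2 * u ^ 2)) + n * e0 := by
          calc (1 - u ^ 2 * δ / 2) * |A| ≤ (1 - u ^ 2 * δ / 2) *
                (Real.exp (-(n * δ / 2 * u ^ 2)) + n * e0) := mul_le_mul_of_nonneg_left ih hfac
            _ = (1 - u ^ 2 * δ / 2) * Real.exp (-(n * δ / 2 * u ^ 2)) +
                (1 - u ^ 2 * δ / 2) * (n * e0) := by ring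
            _ ≤ _ := by
              refine add_le_add (mul_le_mul_of_nonneg_right hexp (Real.exp_pos _).le) ?_
              refine mul_le_of_le_one_left (by positivity) ?_
              have : 0 ≤ u ^ 2 * δ := by positivity
              linarith
        rw [← Real.exp_add] at h4
        have h5 : -(u ^ 2 * δ / 2) + -(n * δ / 2 * u ^ 2) = -(((n + 1 : ℕ) : ℝ) * δ / 2 * u ^ 2) := by
          push_cast; ring
        rw [h5] at h4
        push_cast at h4 ⊢
        linarith
    refine (main n).trans (add_le_add le_rfl ?_)
    have : (3 * CI 0 * (n * δ) + 1) * √δ * (1 + u ^ 4) = n * (3 * (1 + u ^ 4) * CI 0 * (δ * √δ)) +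
      √δ * (1 + u ^ 4) := by ring
    rw [this]
    have : 0 ≤ √δ * (1 + u ^ 4) := by positivity
    linarith
  · refine (a_le _).trans ?_
    have h1 : (1 : ℝ) ≤ √δ * (1 + u ^ 4) := by
      have h1 : δ ≤ √δ := by nlinarith
      have h2 : u ^ 2 ≤ (1 + u ^ 4) / 2 := by nlinarith [sq_nonneg (u ^ 2 - 1)]
      have h3 : 0 ≤ u ^ 2 := sq_nonneg u
      nlinarith
    have h2 : 0 ≤ 3 * CI 0 * (n * δ) * (√δ * (1 + u ^ 4)) := by positivity
    have := Real.exp_pos (-(n * δ / 2 * u ^ 2))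
    nlinarith

lemma gauss_cos (v : NNReal) (x : ℝ) :
    ∫ u, Real.cos (u * x) ∂(gaussianReal 0 v) = Real.exp (-(v * x ^ 2 / 2)) := by
  have h := charFun_gaussianReal (μ := 0) (v := v) x
  rw [charFun_apply_real] at h
  have h2 := congrArg Complex.re h
  have hInt : Integrable (fun u : ℝ => Complex.exp (x * u * Complex.I)) (gaussianReal 0 v) := by
    refine Integrable.of_bound (by fun_prop) 1 (ae_of_all _ fun u => ?_)
    rw [← Complex.ofReal_mul, Complex.norm_exp_ofReal_mul_I]
  have h3 := integral_re hInt
  simp only [RCLike.re_to_complex] at h3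
  rw [← h3] at h2
  have e : ∀ u : ℝ, (Complex.exp (x * u * Complex.I)).re = Real.cos (u * x) := by
    intro u
    rw [← Complex.ofReal_mul, Complex.exp_ofReal_mul_I_re, mul_comm]
  simp only [e] at h2
  rw [h2, show ((x : ℂ) * ((0 : ℝ) : ℂ) * Complex.I - (v : ℂ) * (x : ℂ) ^ 2 / 2) =
    ((-(v * x ^ 2 / 2) : ℝ) : ℂ) by push_cast; ring, Complex.exp_ofReal_re]

/-- anti-concentration from the decay of the characteristic function -/
lemma anticonc {V : Ω → ℝ} (hV : Measurable V) {ε η E : ℝ} (hε : 0 < ε) (hη : 0 < η) (hE : 0 ≤ E)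
    (h : ∀ u : ℝ, |∫ ω, Real.cos (u * V ω) ∂μ| ≤ Real.exp (-(η / 2 * u ^ 2)) + E * (1 + u ^ 4)) :
    μ.real {ω | |V ω| ≤ ε} ≤ 2 * (ε / √η + E * (1 + K4 * ε⁻¹ ^ 4)) := by
  set v : NNReal := ⟨ε⁻¹ ^ 2, by positivity⟩ with hv
  have hv' : (v : ℝ) = ε⁻¹ ^ 2 := rfl
  have hv0 : v ≠ 0 := by
    intro h0
    have : (v : ℝ) = 0 := by rw [h0]; rfl
    rw [hv'] at this
    have : 0 < ε⁻¹ ^ 2 := by positivity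
    linarith
  set N := gaussianReal 0 v
  have mS : MeasurableSet {ω | |V ω| ≤ ε} := measurableSet_le hV.abs measurable_const
  -- step 1
  have s1 : μ.real {ω | |V ω| ≤ ε} ≤ 2 * ∫ ω, Real.exp (-(v * V ω ^ 2 / 2)) ∂μ := by
    rw [← integral_indicator_one mS, ← integral_const_mul]
    have hb : ∀ ω, |Real.exp (-(v * V ω ^ 2 / 2))| ≤ 1 := fun ω => by
      rw [abs_of_pos (Real.exp_pos _), Real.exp_le_one_iff]
      have : 0 ≤ (v : ℝ) * V ω ^ 2 := by positivity
      linarith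
    refine integral_mono ((integrable_const (1 : ℝ)).indicator mS)
      ((bdd_int (by fun_prop) hb).const_mul 2) fun ω => ?_
    by_cases hω : ω ∈ {ω | |V ω| ≤ ε}
    · rw [indicator_of_mem hω]
      have h1 : (v : ℝ) * V ω ^ 2 ≤ 1 := by
        rw [hv', ← mul_pow, ← sq_abs, abs_mul, abs_of_pos (inv_pos.2 hε)]
        refine pow_le_one₀ (by positivity) ?_
        rw [inv_mul_le_iff₀ hε, mul_one]
        exact hω
      have h2 := Real.add_one_le_exp (-(v * V ω ^ 2 / 2))
      simp only [Pi.one_apply]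
      linarith
    · rw [indicator_of_notMem hω]
      positivity
  -- step 2
  have s2 : ∫ ω, Real.exp (-(v * V ω ^ 2 / 2)) ∂μ = ∫ u, ∫ ω, Real.cos (u * V ω) ∂μ ∂N := by
    simp_rw [← gauss_cos]
    rw [integral_integral_swap]
    refine Integrable.of_bound (by fun_prop) 1 (ae_of_all _ fun p => ?_)
    exact Real.abs_cos_le_one _
  have i4 : Integrable (fun u : ℝ => u ^ 4) N := by
    have := (memLp_id_gaussianReal' (μ := 0) (v := v) 4 (by norm_num))
    have := this.integrable_norm_pow (p := 4) (by norm_num)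
    refine this.congr (ae_of_all _ fun u => ?_)
    simp only [id, Real.norm_eq_abs]
    exact (even_two_mul 2).pow_abs _
  have ie : Integrable (fun u : ℝ => Real.exp (-(η / 2 * u ^ 2))) N := by
    refine Integrable.of_bound (by fun_prop) 1 (ae_of_all _ fun u => ?_)
    rw [Real.norm_eq_abs, abs_of_pos (Real.exp_pos _), Real.exp_le_one_iff]
    have : 0 ≤ η / 2 * u ^ 2 := by positivity
    linarith
  have iE : Integrable (fun u : ℝ => E * (1 + u ^ 4)) N :=
    ((integrable_const _).add i4).const_mul E
  have s3 : ∫ u, ∫ ω, Real.cos (u * V ω) ∂μ ∂N ≤ ∫ u, Real.exp (-(η / 2 * u ^ 2)) ∂N +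
      E * (1 + K4 * ε⁻¹ ^ 4) := by
    have e : E * (1 + K4 * ε⁻¹ ^ 4) = ∫ u, E * (1 + u ^ 4) ∂N := by
      rw [integral_const_mul, integral_add (integrable_const _) i4, gauss_four, hv']
      simp only [integral_const, probReal_univ, one_smul, smul_eq_mul, mul_one]
      ring
    rw [e, ← integral_add ie iE]
    refine (le_abs_self _).trans ?_
    exact norm_integral_le_of_norm_le (f := fun u => ∫ ω, Real.cos (u * V ω) ∂μ) (iadd ie iE) (ae_of_all _ h)
  have s4 : ∫ u, Real.exp (-(η / 2 * u ^ 2)) ∂N ≤ ε / √η := by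
    rw [integral_gaussianReal_eq_integral_smul hv0]
    have hpi := Real.pi_pos
    have b : ∀ u : ℝ, gaussianPDFReal 0 v u • Real.exp (-(η / 2 * u ^ 2)) ≤
        (√(2 * Real.pi * v))⁻¹ * Real.exp (-(η / 2) * u ^ 2) := by
      intro u
      rw [smul_eq_mul, gaussianPDFReal, neg_mul]
      refine mul_le_mul_of_nonneg_right ?_ (Real.exp_pos _).le
      refine mul_le_of_le_one_right (by positivity) (Real.exp_le_one_iff.2 ?_)
      rw [neg_div, neg_nonpos]
      positivity
    have ig : Integrable (fun u : ℝ => Real.exp (-(η / 2) * u ^ 2)) :=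
      integrable_exp_neg_mul_sq (by positivity)
    refine (integral_mono_of_nonneg (ae_of_all _ fun u => ?_) (ig.const_mul _) (ae_of_all _ b)).trans ?_
    · exact mul_nonneg (gaussianPDFReal_nonneg _ _ _) (Real.exp_pos _).le
    · rw [integral_const_mul, integral_gaussian, hv']
      apply le_of_eq
      rw [← Real.sqrt_inv, ← Real.sqrt_mul (by positivity)]
      have : (2 * Real.pi * ε⁻¹ ^ 2)⁻¹ * (Real.pi / (η / 2)) = ε ^ 2 / η := by
        field_simp
      rw [this, Real.sqrt_div (by positivity), Real.sqrt_sq hε.le]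
  rw [s2] at s1
  linarith

end disc2

/-! ### Driven schemes and anti-concentration -/

/-- diffusion coefficient as a function of the indicator -/
def Ha (ρ σ p : ℝ) : ℝ := σ + (ρ - σ) * p

/-- adapted zero-one valued sequences -/
structure BP (G : ℕ → MeasurableSpace Ω) (p : ℕ → Ω → ℝ) : Prop where
  ms : ∀ j, Measurable[G j] (p j)
  bd : ∀ j ω, p j ω = 0 ∨ p j ω = 1

/-- admissible parameters -/
structure PR (ρ σ lam : ℝ) : Prop where
  r0 : 0 ≤ ρ
  s0 : 0 ≤ σ
  nm : ρ ^ 2 + σ ^ 2 = 1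
  l0 : 0 ≤ lam

lemma PR.r1 {ρ σ lam : ℝ} (h : PR ρ σ lam) : ρ ≤ 1 := by nlinarith [h.r0, h.s0, h.nm]
lemma PR.s1 {ρ σ lam : ℝ} (h : PR ρ σ lam) : σ ≤ 1 := by nlinarith [h.r0, h.s0, h.nm]
lemma PR.swap {ρ σ lam : ℝ} (h : PR ρ σ lam) : PR σ ρ lam := ⟨h.s0, h.r0, by linarith [h.nm], h.l0⟩

/-- driven scheme for the difference process -/
def YS (ρ σ lam y : ℝ) (p ξ η : ℕ → Ω → ℝ) (δ : ℝ) : ℕ → Ω → ℝ :=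
  PS (fun _ => y) (fun j ω => lam * (1 - 2 * p j ω)) (fun j ω => Ha ρ σ (p j ω))
    (fun j ω => -Ha σ ρ (p j ω)) ξ η δ

section drv
variable {μ : Measure Ω} [IsProbabilityMeasure μ] {G : ℕ → MeasurableSpace Ω}
  {ξ η : ℕ → Ω → ℝ} {δ : ℝ} {ρ σ lam y : ℝ} {p : ℕ → Ω → ℝ}

lemma Ha_abs (h : PR ρ σ lam) {q : ℝ} (hq : q = 0 ∨ q = 1) : |Ha ρ σ q| ≤ 1 := by
  have := h.r1; have := h.s1; have := h.r0; have := h.s0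
  rw [abs_le]
  rcases hq with rfl | rfl <;> simp [Ha] <;> constructor <;> linarith

lemma Ha_sq (h : PR ρ σ lam) {q : ℝ} (hq : q = 0 ∨ q = 1) : Ha ρ σ q ^ 2 + Ha σ ρ q ^ 2 = 1 := by
  have := h.nm
  rcases hq with rfl | rfl <;> simp [Ha] <;> linarith

lemma BP.ad1 (b : BP G p) (h : PR ρ σ lam) : AD G (fun j ω => Ha ρ σ (p j ω)) 1 :=
  ⟨fun j => measurable_const.add (measurable_const.mul (b.ms j)), fun j ω => Ha_abs h (b.bd j ω)⟩

lemma AD.neg {f : ℕ → Ω → ℝ} {c : ℝ} (b : AD G f c) : AD G (fun j ω => -f j ω) c :=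
  ⟨fun j => (b.ms j).neg, fun j ω => by rw [abs_neg]; exact b.bd j ω⟩

lemma BP.ad2 (b : BP G p) (h : PR ρ σ lam) : AD G (fun j ω => -Ha σ ρ (p j ω)) 1 :=
  (b.ad1 h.swap).neg

lemma BP.adb (b : BP G p) (h : PR ρ σ lam) : AD G (fun j ω => lam * (1 - 2 * p j ω)) lam :=
  ⟨fun j => measurable_const.mul (measurable_const.sub (measurable_const.mul (b.ms j))), fun j ω => by
    have := h.l0
    rcases b.bd j ω with e | e <;> rw [e, abs_mul, abs_of_nonneg h.l0] <;> norm_num⟩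

lemma DN.shift (d : DN μ G ξ η δ) (k : ℕ) :
    DN μ (fun j => G (k + j)) (fun j => ξ (k + j)) (fun j => η (k + j)) δ where
  pos := d.pos
  le := fun j => d.le _
  mono := fun i j h => d.mono (by omega)
  m1 := fun j => d.m1 (k + j)
  m2 := fun j => d.m2 (k + j)
  i1 := fun j => d.i1 _
  i2 := fun j => d.i2 _
  lp1 := fun j => d.lp1 _
  lp2 := fun j => d.lp2 _
  mean1 := fun j => d.mean1 _
  mean2 := fun j => d.mean2 _
  var1 := fun j => d.var1 _
  var2 := fun j => d.var2 _
  four1 := fun j => d.four1 _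
  four2 := fun j => d.four2 _
  cross := fun j => d.cross _

lemma AD.shift {f : ℕ → Ω → ℝ} {c : ℝ} (b : AD G f c) (k : ℕ) :
    AD (fun j => G (k + j)) (fun j => f (k + j)) c := ⟨fun j => b.ms _, fun j => b.bd _⟩

lemma ac_disc (d : DN μ G ξ η δ) (hδ1 : δ ≤ 1) {V0 : Ω → ℝ} (hV : Measurable[G 0] V0)
    {β h1 h2 : ℕ → Ω → ℝ} {b : ℝ} (hb : 0 ≤ b) (aβ : AD G β b) (a1 : AD G h1 1) (a2 : AD G h2 1)
    (hu : ∀ j ω, h1 j ω ^ 2 + h2 j ω ^ 2 = 1) (k l : ℕ) (hl : 0 < l) {ε : ℝ} (hε : 0 < ε) :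
    μ.real {ω | |PS V0 β h1 h2 ξ η δ (k + l) ω| ≤ ε} ≤
      2 * ((ε + b * (l * δ)) / √(l * δ) + ((3 * CI 0 * (l * δ) + 1) * √δ) *
        (1 + K4 * (ε + b * (l * δ))⁻¹ ^ 4)) := by
  have hδ := d.pos
  have hC := CI_nonneg (b := 0) le_rfl
  have hl' : (0 : ℝ) < l := by exact_mod_cast hl
  set W : Ω → ℝ := fun ω => PS V0 β h1 h2 ξ η δ k ω + LS (fun j => h1 (k + j)) (fun j => h2 (k + j))
    (fun j => ξ (k + j)) (fun j => η (k + j)) l ω with hW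
  have mP := PS_meas d.toDN0 hV aβ a1 a2 k
  have mW : Measurable W := (d.mL mP).add
    ((d.shift k).mL (LS_meas (d.shift k).toDN0 (a1.shift k) (a2.shift k) l))
  have cb := fun u => cos_bound (d.shift k) hδ1 (V0 := PS V0 β h1 h2 ξ η δ k) mP (a1.shift k)
    (a2.shift k) (fun j ω => hu _ ω) u l
  have ac := anticonc (μ := μ) mW (ε := ε + b * (l * δ)) (η := l * δ)
    (E := (3 * CI 0 * (l * δ) + 1) * √δ) (by positivity) (by positivity) (by positivity) cb
  refine le_trans (measureReal_mono fun ω hω => ?_) ac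
  simp only [mem_setOf_eq] at hω ⊢
  have e : PS V0 β h1 h2 ξ η δ (k + l) ω = W ω + ∑ j ∈ Finset.range l, β (k + j) ω * δ := by
    simp only [hW, PS, LS, Finset.sum_range_add]
    have : ∑ x ∈ Finset.range l, (β (k + x) ω * δ + (h1 (k + x) ω * ξ (k + x) ω +
        h2 (k + x) ω * η (k + x) ω)) = ∑ x ∈ Finset.range l, β (k + x) ω * δ +
        ∑ x ∈ Finset.range l, (h1 (k + x) ω * ξ (k + x) ω + h2 (k + x) ω * η (k + x) ω) :=
      Finset.sum_add_distrib
    rw [this]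
    ring
  have e2 : |∑ j ∈ Finset.range l, β (k + j) ω * δ| ≤ b * (l * δ) := by
    refine (Finset.abs_sum_le_sum_abs _ _).trans ?_
    refine (Finset.sum_le_card_nsmul _ _ (b * δ) fun j _ => ?_).trans (le_of_eq ?_)
    · rw [abs_mul, abs_of_pos hδ]
      exact mul_le_mul_of_nonneg_right (aβ.bd _ _) hδ.le
    · rw [Finset.card_range, nsmul_eq_mul]; ring
  have : W ω = PS V0 β h1 h2 ξ η δ (k + l) ω - ∑ j ∈ Finset.range l, β (k + j) ω * δ := by
    rw [e]; ring
  rw [this]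
  exact (abs_sub _ _).trans (add_le_add hω e2)

/-- uniform anti-concentration for driven schemes at dyadic levels -/
lemma ac_unif (h : PR ρ σ lam) {κ θ : ℝ} (hκ : 0 < κ) (hθ : 0 < θ) :
    ∃ ε > 0, ∃ N0 : ℕ, ∀ N ≥ N0, ∀ (G : ℕ → MeasurableSpace Ω) (ξ η p : ℕ → Ω → ℝ) (y : ℝ),
      DN μ G ξ η (1 / 2 ^ N) → BP G p → ∀ k : ℕ, κ ≤ k / 2 ^ N →
        μ.real {ω | |YS ρ σ lam y p ξ η (1 / 2 ^ N) k ω| ≤ ε} ≤ θ := by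
  have hl := h.l0
  have h0 : Tendsto (fun a : ℕ => 2 * ((1 + lam) * √((1 / 2 : ℝ) ^ a))) atTop (nhds 0) := by
    have : Tendsto (fun a : ℕ => (1 / 2 : ℝ) ^ a) atTop (nhds 0) :=
      tendsto_pow_atTop_nhds_zero_of_lt_one (by norm_num) (by norm_num)
    have := (((Real.continuous_sqrt.tendsto 0).comp this).const_mul (1 + lam)).const_mul 2
    simpa using this
  have h1 : Tendsto (fun a : ℕ => (1 / 2 : ℝ) ^ a) atTop (nhds 0) :=
    tendsto_pow_atTop_nhds_zero_of_lt_one (by norm_num) (by norm_num)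
  obtain ⟨a, ha1, ha2⟩ := ((h0.eventually (gt_mem_nhds (half_pos hθ))).and
    (h1.eventually (gt_mem_nhds hκ))).exists
  set e : ℝ := (1 / 2 : ℝ) ^ a with he
  have he0 : 0 < e := by positivity
  have h2 : Tendsto (fun N : ℕ => 2 * (((3 * CI 0 * e + 1) * √(1 / 2 ^ N)) *
        (1 + K4 * (e + lam * e)⁻¹ ^ 4))) atTop (nhds 0) := by
    have : Tendsto (fun a : ℕ => (1 / 2 ^ a : ℝ)) atTop (nhds 0) := by simpa using h1
    have := ((((Real.continuous_sqrt.tendsto 0).comp this).const_mul (3 * CI 0 * e + 1)).mul_const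
      (1 + K4 * (e + lam * e)⁻¹ ^ 4)).const_mul 2
    simpa using this
  obtain ⟨N0, hN0⟩ := eventually_atTop.1 (h2.eventually (gt_mem_nhds (half_pos hθ)))
  refine ⟨e, he0, max N0 a, fun N hN G ξ η p y d b k hk => ?_⟩
  have hNa : a ≤ N := le_trans (le_max_right _ _) hN
  have hb := hN0 N (le_trans (le_max_left _ _) hN)
  have hle : ((2 ^ (N - a) : ℕ) : ℝ) * (1 / 2 ^ N) = e := by
    rw [he]
    push_cast
    rw [one_div_pow, mul_one_div, div_eq_div_iff (by positivity) (by positivity), one_mul, ← pow_add]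
    congr 1; omega
  have hkl : 2 ^ (N - a) ≤ k := by
    have : ((2 ^ (N - a) : ℕ) : ℝ) ≤ k := by
      have h3 : e ≤ k / 2 ^ N := ha2.le.trans hk
      rw [← hle, mul_one_div, div_le_div_iff_of_pos_right (by positivity)] at h3
      exact h3
    exact_mod_cast this
  obtain ⟨k', rfl⟩ : ∃ k', k = k' + 2 ^ (N - a) := ⟨k - 2 ^ (N - a), by omega⟩
  have hδ1 : (1 : ℝ) / 2 ^ N ≤ 1 := by
    rw [div_le_one (by positivity)]; exact one_le_pow₀ (by norm_num)
  have := ac_disc d hδ1 (V0 := fun _ => y) measurable_const hl (b.adb h) (b.ad1 h) (b.ad2 h)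
    (fun j ω => by rw [neg_sq]; exact Ha_sq h (b.bd j ω)) k' (2 ^ (N - a)) (by positivity) he0
  rw [hle] at this
  refine this.trans ?_
  have e3 : (e + lam * e) / √e = (1 + lam) * √e := by
    rw [div_eq_iff (by positivity), mul_assoc, Real.mul_self_sqrt he0.le]; ring
  rw [e3, mul_add]
  linarith

end drv

/-! ### Test functions -/

/-- `√(1 + (k x)²)` -/
def tr (k x : ℝ) : ℝ := √(1 + (k * x) ^ 2)
/-- second derivative building block -/
def tq (k x : ℝ) : ℝ := k * (tr k x)⁻¹
/-- smooth absolute value, first derivative -/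
def th1 (k x : ℝ) : ℝ := x * tq k x
/-- smooth absolute value, second derivative -/
def th2 (k x : ℝ) : ℝ := k * (tr k x ^ 3)⁻¹
/-- first derivative of the blow-up function -/
def bf1 (k x : ℝ) : ℝ := Real.arsinh (k * x) - Real.arsinh x
/-- second derivative of the blow-up function -/
def bf2 (k x : ℝ) : ℝ := tq k x - tq 1 x
/-- blow-up function -/
def bf (k x : ℝ) : ℝ := ∫ u in (0:ℝ)..x, bf1 k u

lemma tr_one (k x : ℝ) : 1 ≤ tr k x := by
  rw [tr, Real.one_le_sqrt]; nlinarith [sq_nonneg (k * x)]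
lemma tr_pos (k x : ℝ) : 0 < tr k x := lt_of_lt_of_le one_pos (tr_one k x)
lemma tr_abs (k x : ℝ) : |k * x| ≤ tr k x := by
  rw [tr, ← Real.sqrt_sq_eq_abs]; exact Real.sqrt_le_sqrt (by linarith)
lemma tr_sq (k x : ℝ) : tr k x ^ 2 = 1 + (k * x) ^ 2 := Real.sq_sqrt (by positivity)

lemma tr_deriv (k x : ℝ) : HasDerivAt (tr k) (k * (k * x) / tr k x) x := by
  have h1 : HasDerivAt (fun x : ℝ => 1 + (k * x) ^ 2) (2 * (k * x) * k) x := by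
    have := (((hasDerivAt_id x).const_mul k).pow 2).const_add 1
    simpa using this
  have h2 := h1.sqrt (by positivity)
  have e : 2 * (k * x) * k / (2 * √(1 + (k * x) ^ 2)) = k * (k * x) / tr k x := by
    have := (tr_pos k x).ne'
    unfold tr at this ⊢
    field_simp
  rw [e] at h2
  exact h2

lemma tq_deriv (k x : ℝ) : HasDerivAt (tq k) (-(k * (k * (k * x) / tr k x) / tr k x ^ 2)) x := by
  have := ((tr_deriv k x).inv (tr_pos k x).ne').const_mul k
  refine this.congr_deriv ?_
  ring

lemma tq_deriv_bd {k : ℝ} (hk : 1 ≤ k) (x : ℝ) :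
    |-(k * (k * (k * x) / tr k x) / tr k x ^ 2)| ≤ k ^ 2 := by
  have h0 := tr_pos k x
  have h1 := tr_one k x
  rw [abs_neg, abs_div, abs_mul, abs_div, abs_mul k (k * x), abs_of_pos h0, abs_of_pos (by positivity : 0 < k), abs_of_pos (by positivity : 0 < tr k x ^ 2)]
  rw [div_le_iff₀ (by positivity)]
  have h2 : k * |k * x| / tr k x ≤ k := by
    rw [div_le_iff₀ h0]
    exact mul_le_mul_of_nonneg_left (tr_abs k x) (by positivity)
  have h3 : 1 ≤ tr k x ^ 2 := one_le_pow₀ h1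
  nlinarith

lemma tq_nonneg {k : ℝ} (hk : 0 ≤ k) (x : ℝ) : 0 ≤ tq k x := mul_nonneg hk (inv_nonneg.2 (tr_pos k x).le)

lemma tq_le {k : ℝ} (hk : 0 ≤ k) (x : ℝ) : tq k x ≤ k :=
  mul_le_of_le_one_right hk (inv_le_one_of_one_le₀ (tr_one k x))

/-- `tq` is decreasing in `|x|` -/
lemma tq_anti {k : ℝ} (hk : 0 ≤ k) {x z : ℝ} (h : |x| ≤ |z|) : tq k z ≤ tq k x := by
  refine mul_le_mul_of_nonneg_left (inv_anti₀ (tr_pos k x) ?_) hk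
  refine Real.sqrt_le_sqrt ?_
  have := sq_le_sq.2 h
  rw [mul_pow, mul_pow]
  nlinarith [sq_nonneg k]

/-- `tq` is increasing in `k` -/
lemma tq_mono {k : ℝ} (hk : 1 ≤ k) (x : ℝ) : tq 1 x ≤ tq k x := by
  unfold tq
  rw [← div_eq_mul_inv, ← div_eq_mul_inv, div_le_div_iff₀ (tr_pos _ _) (tr_pos _ _)]
  refine abs_le_of_sq_le_sq' ?_ (by have := tr_pos 1 x; positivity) |>.2
  rw [mul_pow, mul_pow, tr_sq, tr_sq]
  nlinarith [sq_nonneg x, mul_pow k x 2]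

lemma TF_th {k : ℝ} (hk : 1 ≤ k) : TF (fun x => tr k x / k) (th1 k) (th2 k) (3 * k ^ 2) := by
  have hk0 : 0 < k := by linarith
  have dd : ∀ x, HasDerivAt (th2 k) (-(k * (3 * tr k x ^ 2 * (k * (k * x) / tr k x)) / (tr k x ^ 3) ^ 2)) x := by
    intro x
    have := (((tr_deriv k x).pow 3).inv (pow_pos (tr_pos k x) 3).ne').const_mul k
    refine this.congr_deriv ?_
    simp
    ring
  refine ⟨fun x => ?_, fun x => ?_, fun x => ?_, fun x => ?_, ?_⟩
  · refine ((tr_deriv k x).div_const k).congr_deriv ?_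
    unfold th1 tq
    field_simp
  · refine ((hasDerivAt_id x).mul (tq_deriv k x)).congr_deriv ?_
    have h := tr_sq k x
    have h0 := tr_pos k x
    unfold th2 tq
    simp only [id]
    field_simp
    rw [h]; ring
  · unfold th1 tq
    have h0 := tr_pos k x
    rw [show x * (k * (tr k x)⁻¹) = (k * x) / tr k x by field_simp, abs_div, abs_of_pos h0, div_le_iff₀ h0]
    have := tr_abs k x
    have h3 : 1 ≤ 3 * k ^ 2 := by nlinarith
    nlinarith
  · unfold th2
    have h0 := tr_pos k x
    rw [abs_of_nonneg (by positivity)]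
    have : (tr k x ^ 3)⁻¹ ≤ 1 := inv_le_one_of_one_le₀ (one_le_pow₀ (tr_one k x))
    nlinarith
  · refine lip_of_deriv dd fun x => ?_
    have h0 := tr_pos k x
    have h1 := tr_one k x
    have ha := tr_abs k x
    rw [abs_neg, abs_div, abs_of_pos (by positivity : 0 < (tr k x ^ 3) ^ 2), div_le_iff₀ (by positivity)]
    have e : k * (3 * tr k x ^ 2 * (k * (k * x) / tr k x)) = 3 * k ^ 2 * (tr k x * (k * x)) := by
      field_simp
    rw [e, abs_mul, abs_of_pos (by positivity : 0 < 3 * k ^ 2), abs_mul, abs_of_pos h0]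
    refine mul_le_mul_of_nonneg_left ?_ (by positivity)
    calc tr k x * |k * x| ≤ tr k x * tr k x := mul_le_mul_of_nonneg_left ha h0.le
      _ = tr k x ^ 2 := by ring
      _ ≤ tr k x ^ 6 := pow_le_pow_right₀ h1 (by norm_num)
      _ = _ := by ring

lemma th2_nonneg {k : ℝ} (hk : 1 ≤ k) (x : ℝ) : 0 ≤ th2 k x := by
  have h0 := tr_pos k x
  unfold th2; positivity

lemma th1_abs {k : ℝ} (hk : 1 ≤ k) (x : ℝ) : |th1 k x| ≤ 1 := by
  have h0 := tr_pos k x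
  unfold th1 tq
  rw [show x * (k * (tr k x)⁻¹) = (k * x) / tr k x by field_simp, abs_div, abs_of_pos h0, div_le_iff₀ h0, one_mul]
  exact tr_abs k x

/-- straddling lower bound -/
lemma straddle {k : ℝ} (hk : 1 ≤ k) {x z : ℝ} (hx : x ≤ 0) (hz : 0 < z) :
    tq k (z - x) ≤ ∫ α in (0:ℝ)..1, th2 k ((1 - α) * x + α * z) := by
  have hk0 : 0 ≤ k := by linarith
  have hxz : 0 < z - x := by linarith
  have T := TF_th hk
  have e : ∫ α in (0:ℝ)..1, th2 k ((1 - α) * x + α * z) = (th1 k z - th1 k x) / (z - x) := by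
    have hd : ∀ α ∈ uIcc (0:ℝ) 1, HasDerivAt (fun α => th1 k ((1 - α) * x + α * z) / (z - x))
        (th2 k ((1 - α) * x + α * z)) α := by
      intro α _
      have h1 : HasDerivAt (fun α : ℝ => (1 - α) * x + α * z) (z - x) α := by
        have := (((hasDerivAt_id α).const_sub 1).mul_const x).add ((hasDerivAt_id α).mul_const z)
        refine this.congr_deriv ?_
        ring
      have h2 := ((T.d2 _).comp α h1).div_const (z - x)
      rw [mul_div_cancel_right₀ _ hxz.ne'] at h2
      exact h2
    have hc : Continuous (th2 k) := by
      have : LipschitzWith ⟨3 * k ^ 2, T.K0⟩ (th2 k) := LipschitzWith.of_dist_le_mul fun x y => by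
        simp only [Real.dist_eq]
        exact T.lip x y
      exact this.continuous
    rw [intervalIntegral.integral_eq_sub_of_hasDerivAt hd
      (Continuous.intervalIntegrable (by fun_prop) _ _)]
    simp
    ring
  rw [e, le_div_iff₀ hxz]
  have a1 : tq k (z - x) ≤ tq k z := tq_anti hk0 (by
    rw [abs_of_pos hz, abs_of_pos hxz]; linarith)
  have a2 : tq k (z - x) ≤ tq k x := tq_anti hk0 (by
    rw [abs_of_nonpos hx, abs_of_pos hxz]; linarith)
  unfold th1
  nlinarith

lemma bf2_nonneg {k : ℝ} (hk : 1 ≤ k) (x : ℝ) : 0 ≤ bf2 k x := sub_nonneg.2 (tq_mono hk x)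

lemma bf2_le {k : ℝ} (hk : 1 ≤ k) (x : ℝ) : bf2 k x ≤ tq k x := by
  have := tq_nonneg zero_le_one x
  unfold bf2; linarith

lemma bf1_deriv (k x : ℝ) : HasDerivAt (bf1 k) (bf2 k x) x := by
  have h1 : HasDerivAt (fun x : ℝ => k * x) k x := by simpa using (hasDerivAt_id x).const_mul k
  have := ((Real.hasDerivAt_arsinh (k * x)).comp x h1).sub (Real.hasDerivAt_arsinh x)
  refine this.congr_deriv ?_
  simp [bf2, tq, tr, mul_comm]

lemma bf1_odd (k x : ℝ) : bf1 k (-x) = -bf1 k x := by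
  simp [bf1, Real.arsinh_neg]; ring

lemma bf1_mono {k : ℝ} (hk : 1 ≤ k) : Monotone (bf1 k) :=
  monotone_of_deriv_nonneg (fun x => (bf1_deriv k x).differentiableAt) fun x => by
    rw [(bf1_deriv k x).deriv]; exact bf2_nonneg hk x

lemma bf1_zero (k : ℝ) : bf1 k 0 = 0 := by simp [bf1]

lemma bf1_le {k : ℝ} (hk : 1 ≤ k) (x : ℝ) : bf1 k x ≤ Real.log k := by
  have pos : ∀ x : ℝ, 0 < x + √(1 + x ^ 2) := fun x => by
    rw [← Real.exp_arsinh]; exact Real.exp_pos _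
  unfold bf1 Real.arsinh
  rw [sub_le_iff_le_add, ← Real.log_mul (by positivity) (pos x).ne']
  refine Real.log_le_log (pos _) ?_
  have : √(1 + (k * x) ^ 2) ≤ k * √(1 + x ^ 2) := by
    rw [Real.sqrt_le_left (by positivity), mul_pow, mul_pow, Real.sq_sqrt (by positivity)]
    nlinarith
  nlinarith

lemma bf1_abs {k : ℝ} (hk : 1 ≤ k) (x : ℝ) : |bf1 k x| ≤ Real.log k := by
  rw [abs_le]
  have := bf1_le hk x
  have h2 := bf1_le hk (-x)
  rw [bf1_odd] at h2
  constructor <;> linarith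

lemma bf1_cont (k : ℝ) : Continuous (bf1 k) :=
  continuous_iff_continuousAt.2 fun x => (bf1_deriv k x).continuousAt

/-- the Lipschitz constant for `bf` -/
def KB (k : ℝ) : ℝ := Real.log k + (k ^ 2 + 1)

lemma TF_bf {k : ℝ} (hk : 1 ≤ k) : TF (bf k) (bf1 k) (bf2 k) (KB k) := by
  have hlog : 0 ≤ Real.log k := Real.log_nonneg hk
  refine ⟨fun x => ?_, bf1_deriv k, fun x => ?_, fun x => ?_, ?_⟩
  · exact intervalIntegral.integral_hasDerivAt_right ((bf1_cont k).intervalIntegrable _ _)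
      ((bf1_cont k).stronglyMeasurableAtFilter _ _) (bf1_cont k).continuousAt
  · refine (bf1_abs hk x).trans ?_
    unfold KB; nlinarith
  · rw [abs_of_nonneg (bf2_nonneg hk x)]
    refine (bf2_le hk x).trans ((tq_le (by linarith) x).trans ?_)
    unfold KB; nlinarith
  · refine lip_of_deriv (fun x => (tq_deriv k x).sub (tq_deriv 1 x)) fun x => ?_
    refine (abs_sub _ _).trans ?_
    have h1 := tq_deriv_bd hk x
    have h2 := tq_deriv_bd (le_refl (1:ℝ)) x
    unfold KB
    linarith

lemma bf_zero (k : ℝ) : bf k 0 = 0 := by simp [bf]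

lemma bf_even (k x : ℝ) : bf k (-x) = bf k x := by
  unfold bf
  have := intervalIntegral.integral_comp_neg (a := 0) (b := x) (bf1 k)
  simp only [bf1_odd, neg_zero] at this
  rw [intervalIntegral.integral_neg, intervalIntegral.integral_symm 0 (-x)] at this
  linarith

lemma bf_nonneg_aux {k : ℝ} (hk : 1 ≤ k) {x : ℝ} (hx : 0 ≤ x) : 0 ≤ bf k x := by
  refine intervalIntegral.integral_nonneg hx fun u hu => ?_
  have := bf1_mono hk hu.1
  rwa [bf1_zero] at this

lemma bf_nonneg {k : ℝ} (hk : 1 ≤ k) (x : ℝ) : 0 ≤ bf k x := by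
  rcases le_total 0 x with h | h
  · exact bf_nonneg_aux hk h
  · rw [← bf_even]; exact bf_nonneg_aux hk (by linarith)

lemma bf_lower_aux {k : ℝ} (hk : 1 ≤ k) {γ x : ℝ} (hγ : 0 < γ) (hx : γ ≤ x) :
    γ / 2 * bf1 k (γ / 2) ≤ bf k x := by
  have hi : ∀ a b, IntervalIntegrable (bf1 k) volume a b := fun a b => (bf1_cont k).intervalIntegrable a b
  have e : bf k x = bf k (γ / 2) + ∫ u in (γ / 2)..x, bf1 k u :=
    (intervalIntegral.integral_add_adjacent_intervals (hi _ _) (hi _ _)).symm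
  have h0 := bf_nonneg_aux hk (x := γ / 2) (by linarith)
  have h1 : ∫ u in (γ / 2)..x, bf1 k (γ / 2) ≤ ∫ u in (γ / 2)..x, bf1 k u :=
    intervalIntegral.integral_mono_on (by linarith) (by simp) (hi _ _) fun u hu => bf1_mono hk hu.1
  rw [intervalIntegral.integral_const, smul_eq_mul] at h1
  have h2 : 0 ≤ bf1 k (γ / 2) := by
    have := bf1_mono hk (show (0:ℝ) ≤ γ / 2 by linarith)
    rwa [bf1_zero] at this
  nlinarith

lemma bf_lower {k : ℝ} (hk : 1 ≤ k) {γ x : ℝ} (hγ : 0 < γ) (hx : γ ≤ |x|) :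
    γ / 2 * bf1 k (γ / 2) ≤ bf k x := by
  rcases le_total 0 x with h | h
  · rw [abs_of_nonneg h] at hx; exact bf_lower_aux hk hγ hx
  · rw [abs_of_nonpos h] at hx; rw [← bf_even]; exact bf_lower_aux hk hγ hx

lemma bf_blow {γ : ℝ} (hγ : 0 < γ) (A : ℝ) : ∃ k : ℝ, 1 ≤ k ∧ A ≤ γ / 2 * bf1 k (γ / 2) := by
  set B := A * (2 / γ) + Real.arsinh (γ / 2)
  refine ⟨max 1 (Real.sinh B * (2 / γ)), le_max_left _ _, ?_⟩
  have h1 : Real.sinh B ≤ max 1 (Real.sinh B * (2 / γ)) * (γ / 2) := by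
    calc Real.sinh B = Real.sinh B * (2 / γ) * (γ / 2) := by field_simp
      _ ≤ _ := mul_le_mul_of_nonneg_right (le_max_right _ _) (by linarith)
  have h2 := Real.arsinh_le_arsinh.2 h1
  rw [Real.arsinh_sinh] at h2
  unfold bf1
  calc A = γ / 2 * (B - Real.arsinh (γ / 2)) := by simp only [B]; field_simp; ring
    _ ≤ _ := mul_le_mul_of_nonneg_left (by linarith) (by linarith)

/-! ### Stability -/

/-- indicator of the positive half line -/
def ind (y : ℝ) : ℝ := if y ≤ 0 then 0 else 1

lemma ind_bd (y : ℝ) : ind y = 0 ∨ ind y = 1 := by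
  unfold ind; split_ifs <;> simp

lemma ind_meas : Measurable ind := Measurable.ite measurableSet_Iic measurable_const measurable_const

lemma tq_even (k x : ℝ) : tq k (-x) = tq k x := by simp [tq, tr]

lemma th2_cont {k : ℝ} (hk : 1 ≤ k) : Continuous (th2 k) := by
  have : LipschitzWith ⟨3 * k ^ 2, (TF_th hk).K0⟩ (th2 k) := LipschitzWith.of_dist_le_mul fun x y => by
    simp only [Real.dist_eq]
    exact (TF_th hk).lip x y
  exact this.continuous

lemma straddle' {k : ℝ} (hk : 1 ≤ k) (x z : ℝ) :
    tq k (x - z) * (ind x - ind z) ^ 2 ≤ ∫ α in (0:ℝ)..1, th2 k ((1 - α) * x + α * z) := by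
  have nn : 0 ≤ ∫ α in (0:ℝ)..1, th2 k ((1 - α) * x + α * z) :=
    intervalIntegral.integral_nonneg zero_le_one fun u _ => th2_nonneg hk _
  unfold ind
  split_ifs with h1 h2 h2
  · simpa using nn
  · have := straddle hk h1 (not_le.1 h2)
    rw [← tq_even] at this
    simpa using this
  · have := straddle hk h2 (not_le.1 h1)
    have e := intervalIntegral.integral_comp_sub_left (a := 0) (b := 1)
      (fun α => th2 k ((1 - α) * z + α * x)) 1
    simp only [sub_self, sub_zero] at e
    rw [← e] at this
    simp only [sub_sub_cancel] at this
    simp only [sub_zero, one_pow, mul_one]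
    refine this.trans (le_of_eq ?_)
    congr 1; ext α; ring_nf
  · simpa using nn

section stab
variable {μ : Measure Ω} [IsProbabilityMeasure μ] {G : ℕ → MeasurableSpace Ω}
  {ξ η : ℕ → Ω → ℝ} {δ : ℝ} {ρ σ lam y : ℝ} {p p' : ℕ → Ω → ℝ}

lemma YS_meas (d : DN μ G ξ η δ) (h : PR ρ σ lam) (b : BP G p) (k : ℕ) :
    Measurable[G k] (YS ρ σ lam y p ξ η δ k) :=
  PS_meas d.toDN0 measurable_const (b.adb h) (b.ad1 h) (b.ad2 h) k

lemma AD.conv {f g : ℕ → Ω → ℝ} {c α : ℝ} (hf : AD G f c) (hg : AD G g c) (h0 : 0 ≤ α) (h1 : α ≤ 1) :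
    AD G (fun j ω => (1 - α) * f j ω + α * g j ω) c :=
  ⟨fun j => (measurable_const.mul (hf.ms j)).add (measurable_const.mul (hg.ms j)), fun j ω => by
    refine (abs_add_le _ _).trans ?_
    rw [abs_mul, abs_mul, abs_of_nonneg h0, abs_of_nonneg (sub_nonneg.2 h1)]
    nlinarith [hf.bd j ω, hg.bd j ω]⟩

lemma PS_eq_LS (V0 : Ω → ℝ) (β h1 h2 : ℕ → Ω → ℝ) (n : ℕ) (ω : Ω) :
    PS V0 β h1 h2 ξ η δ n ω = V0 ω + (∑ j ∈ Finset.range n, β j ω * δ) + LS h1 h2 ξ η n ω := by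
  rw [PS, LS, Finset.sum_add_distrib]; ring

lemma drift_bd (hδ : 0 < δ) {β : ℕ → Ω → ℝ} {b : ℝ} (aβ : AD G β b) (n : ℕ) (ω : Ω) :
    |∑ j ∈ Finset.range n, β j ω * δ| ≤ b * (n * δ) := by
  refine (Finset.abs_sum_le_sum_abs _ _).trans ?_
  refine (Finset.sum_le_card_nsmul _ _ (b * δ) fun j _ => ?_).trans (le_of_eq ?_)
  · rw [abs_mul, abs_of_pos hδ]
    exact mul_le_mul_of_nonneg_right (aβ.bd _ _) hδ.le
  · rw [Finset.card_range, nsmul_eq_mul]; ring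

/-- occupation bound along a non-degenerate scheme -/
lemma occ (d : DN μ G ξ η δ) (hδ1 : δ ≤ 1) (h : PR ρ σ lam) (b : BP G p) (b' : BP G p') {k : ℝ}
    (hk : 1 ≤ k) {T : ℝ} {n : ℕ} (hn : n * δ ≤ T) {α : ℝ} (h0 : 0 ≤ α) (h1 : α ≤ 1) :
    δ * ∑ j ∈ Finset.range n, ∫ ω, th2 k ((1 - α) * YS ρ σ lam y p ξ η δ j ω +
      α * YS ρ σ lam y p' ξ η δ j ω) ∂μ ≤
    4 * (2 * lam * T + 1 + T + T * (3 * k ^ 2 * CI lam * √δ)) := by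
  have hδ := d.pos
  have hl := h.l0
  have hCI := CI_nonneg hl
  set β : ℕ → Ω → ℝ := fun j ω => (1 - α) * (lam * (1 - 2 * p j ω)) + α * (lam * (1 - 2 * p' j ω)) with hβ
  set h1' : ℕ → Ω → ℝ := fun j ω => (1 - α) * Ha ρ σ (p j ω) + α * Ha ρ σ (p' j ω) with hh1
  set h2' : ℕ → Ω → ℝ := fun j ω => (1 - α) * (-Ha σ ρ (p j ω)) + α * (-Ha σ ρ (p' j ω)) with hh2
  have aβ : AD G β lam := (b.adb h).conv (b'.adb h) h0 h1
  have a1 : AD G h1' 1 := (b.ad1 h).conv (b'.ad1 h) h0 h1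
  have a2 : AD G h2' 1 := (b.ad2 h).conv (b'.ad2 h) h0 h1
  have eV : ∀ j ω, (1 - α) * YS ρ σ lam y p ξ η δ j ω + α * YS ρ σ lam y p' ξ η δ j ω =
      PS (fun _ => y) β h1' h2' ξ η δ j ω := by
    intro j ω
    simp only [YS, PS, hβ, hh1, hh2]
    rw [mul_add, mul_add, Finset.mul_sum, Finset.mul_sum,
      show (1 - α) * y + ∑ i ∈ Finset.range j, (1 - α) * _ + (α * y + ∑ i ∈ Finset.range j, α * _) =
      y + (∑ i ∈ Finset.range j, (1 - α) * _ + ∑ i ∈ Finset.range j, α * _) by ring,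
      ← Finset.sum_add_distrib]
    congr 1
    refine Finset.sum_congr rfl fun i _ => ?_
    ring
  simp_rw [eV]
  have T' := TF_th hk
  obtain ⟨I1, I2⟩ := ito_sum d hδ1 (V0 := fun _ => y) measurable_const aβ a1 a2 T'
    (integrable_const _) n
  have mV := fun j => d.mL (PS_meas d.toDN0 (V0 := fun _ => y) measurable_const aβ a1 a2 j)
  have hsq : ∀ j ω, 1 / 2 ≤ h1' j ω ^ 2 + h2' j ω ^ 2 := by
    intro j ω
    have e1 := h.nm; have e2 := mul_nonneg h.r0 h.s0
    simp only [hh1, hh2]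
    have q := mul_nonneg h0 (sub_nonneg.2 h1)
    rcases b.bd j ω with e | e <;> rcases b'.bd j ω with e' | e' <;> rw [e, e'] <;>
      simp only [Ha, mul_zero, mul_one, add_zero] <;>
      nlinarith [sq_nonneg (2 * α - 1), mul_nonneg q e2]
  -- lower bound of the Itô terms
  have low : ∀ j, (∫ ω, th2 k (PS (fun _ => y) β h1' h2' ξ η δ j ω) ∂μ) / 4 - lam ≤
      ∫ ω, (th1 k (PS (fun _ => y) β h1' h2' ξ η δ j ω) * β j ω +
        th2 k (PS (fun _ => y) β h1' h2' ξ η δ j ω) * (h1' j ω ^ 2 + h2' j ω ^ 2) / 2) ∂μ := by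
    intro j
    have i0 : Integrable (fun ω => th2 k (PS (fun _ => y) β h1' h2' ξ η δ j ω)) μ :=
      bdd_int (T'.c2.comp (mV j)) fun ω => T'.b2 _
    have i1 : Integrable (fun ω => th1 k (PS (fun _ => y) β h1' h2' ξ η δ j ω) * β j ω) μ :=
      bdd_int ((T'.c1.comp (mV j)).mul (d.mL (aβ.ms j))) fun ω => bmul (T'.b1 _) (aβ.bd j ω)
    have i2 : Integrable (fun ω => th2 k (PS (fun _ => y) β h1' h2' ξ η δ j ω) *
        (h1' j ω ^ 2 + h2' j ω ^ 2) / 2) μ := by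
      refine Integrable.div_const (bdd_int ((T'.c2.comp (mV j)).mul
        (((d.mL (a1.ms j)).pow_const 2).add ((d.mL (a2.ms j)).pow_const 2))) (C := 3 * k ^ 2 * 2)
        fun ω => bmul (T'.b2 _) ?_) 2
      change |h1' j ω ^ 2 + h2' j ω ^ 2| ≤ 2
      rw [abs_of_nonneg (by positivity)]
      have q1 := sq_le_one_iff_abs_le_one _ |>.2 (a1.bd j ω)
      have q2 := sq_le_one_iff_abs_le_one _ |>.2 (a2.bd j ω)
      linarith
    have i3 : Integrable (fun ω => th2 k (PS (fun _ => y) β h1' h2' ξ η δ j ω) / 4 - lam) μ :=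
      (i0.div_const 4).sub (integrable_const _)
    have e : (∫ ω, th2 k (PS (fun _ => y) β h1' h2' ξ η δ j ω) ∂μ) / 4 - lam =
        ∫ ω, (th2 k (PS (fun _ => y) β h1' h2' ξ η δ j ω) / 4 - lam) ∂μ := by
      rw [integral_sub (i0.div_const 4) (integrable_const _), integral_div]
      simp
    rw [e]
    refine integral_mono i3 (iadd i1 i2) fun ω => ?_
    have q1 := bmul (th1_abs hk (PS (fun _ => y) β h1' h2' ξ η δ j ω)) (aβ.bd j ω)
    rw [abs_le] at q1
    have q2 := th2_nonneg hk (PS (fun _ => y) β h1' h2' ξ η δ j ω)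
    have q3 := hsq j ω
    simp only
    nlinarith [q1.1]
  have low2 := Finset.sum_le_sum fun j (_ : j ∈ Finset.range n) => low j
  rw [Finset.sum_sub_distrib, ← Finset.sum_div, Finset.sum_const, Finset.card_range, nsmul_eq_mul] at low2
  -- upper bound
  have lS := LS_memLp d.toDN0 a1 a2 n
  have up : ∫ ω, tr k (PS (fun _ => y) β h1' h2' ξ η δ n ω) / k ∂μ - ∫ ω, tr k y / k ∂μ ≤
      lam * (n * δ) + 1 + n * δ := by
    rw [← integral_sub I1 (integrable_const _)]
    have ib : Integrable (fun ω => lam * (n * δ) + (1 + LS h1' h2' ξ η n ω ^ 2 / 2)) μ :=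
      (integrable_const _).add ((integrable_const _).add (lS.integrable_sq.div_const 2))
    refine (integral_mono (I1.sub (integrable_const _)) ib fun ω => ?_).trans ?_
    · change tr k (PS (fun _ => y) β h1' h2' ξ η δ n ω) / k - tr k y / k ≤ _
      have q1 := lip_of_deriv T'.d1 (K := 1) (th1_abs hk) (PS (fun _ => y) β h1' h2' ξ η δ n ω) y
      rw [PS_eq_LS] at q1 ⊢
      have q2 := drift_bd hδ aβ n ω
      have q3 : |LS h1' h2' ξ η n ω| ≤ 1 + LS h1' h2' ξ η n ω ^ 2 / 2 := by
        rw [← sq_abs (LS h1' h2' ξ η n ω)]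
        nlinarith [sq_nonneg (|LS h1' h2' ξ η n ω| - 1)]
      have q4 := abs_add_le (∑ j ∈ Finset.range n, β j ω * δ) (LS h1' h2' ξ η n ω)
      rw [show y + ∑ j ∈ Finset.range n, β j ω * δ + LS h1' h2' ξ η n ω - y =
        ∑ j ∈ Finset.range n, β j ω * δ + LS h1' h2' ξ η n ω by ring] at q1
      have q5 := le_abs_self (tr k (y + ∑ j ∈ Finset.range n, β j ω * δ + LS h1' h2' ξ η n ω) / k - tr k y / k)
      linarith
    · rw [integral_add (integrable_const _) (iadd (integrable_const _) (lS.integrable_sq.div_const 2)),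
        integral_add (integrable_const _) (lS.integrable_sq.div_const 2), integral_div, isometry d a1 a2]
      simp only [integral_const, probReal_univ, one_smul]
      have : ∑ j ∈ Finset.range n, ∫ ω, (h1' j ω ^ 2 + h2' j ω ^ 2) ∂μ ≤ n * 2 := by
        refine (Finset.sum_le_card_nsmul _ _ 2 fun j _ => ?_).trans (le_of_eq ?_)
        · have := integral_mono (μ := μ) (f := fun ω => h1' j ω ^ 2 + h2' j ω ^ 2) (g := fun _ => 2)
            (bdd_int (((d.mL (a1.ms j)).pow_const 2).add ((d.mL (a2.ms j)).pow_const 2)) (C := 2)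
              fun ω => ?_) (integrable_const _) fun ω => ?_
          · simpa using this
          · change |h1' j ω ^ 2 + h2' j ω ^ 2| ≤ 2
            rw [abs_of_nonneg (by positivity)]
            have q1 := sq_le_one_iff_abs_le_one _ |>.2 (a1.bd j ω)
            have q2 := sq_le_one_iff_abs_le_one _ |>.2 (a2.bd j ω)
            linarith
          · have q1 := sq_le_one_iff_abs_le_one _ |>.2 (a1.bd j ω)
            have q2 := sq_le_one_iff_abs_le_one _ |>.2 (a2.bd j ω)
            simp only
            linarith
        · rw [Finset.card_range, nsmul_eq_mul]
      nlinarith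
  have I3 := (abs_le.1 I2).1
  have e4 : (n : ℝ) * (3 * k ^ 2 * CI lam * (δ * √δ)) = (n * δ) * (3 * k ^ 2 * CI lam * √δ) := by ring
  rw [e4] at I3
  have e5 : (n * δ) * (3 * k ^ 2 * CI lam * √δ) ≤ T * (3 * k ^ 2 * CI lam * √δ) :=
    mul_le_mul_of_nonneg_right hn (by positivity)
  have e6 := mul_le_mul_of_nonneg_left low2 hδ.le
  have e7 : lam * (n * δ) ≤ lam * T := mul_le_mul_of_nonneg_left hn hl
  rw [mul_sub] at e6
  set S := ∑ j ∈ Finset.range n, ∫ ω, th2 k (PS (fun _ => y) β h1' h2' ξ η δ j ω) ∂μ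
  have e8 : δ * (n * lam) = lam * (n * δ) := by ring
  rw [e8] at e6
  have e9 : δ * S = 4 * (δ * (S / 4)) := by ring
  rw [e9]
  linarith

end stab

section stab2
variable {μ : Measure Ω} [IsProbabilityMeasure μ] {G : ℕ → MeasurableSpace Ω}
  {ξ η : ℕ → Ω → ℝ} {δ : ℝ} {ρ σ lam y : ℝ} {p p' : ℕ → Ω → ℝ}

lemma occ_str (d : DN μ G ξ η δ) (hδ1 : δ ≤ 1) (h : PR ρ σ lam) (b : BP G p) (b' : BP G p') {k : ℝ}
    (hk : 1 ≤ k) {T : ℝ} {n : ℕ} (hn : n * δ ≤ T) :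
    δ * ∑ j ∈ Finset.range n, ∫ ω, tq k (YS ρ σ lam y p ξ η δ j ω - YS ρ σ lam y p' ξ η δ j ω) *
      (ind (YS ρ σ lam y p ξ η δ j ω) - ind (YS ρ σ lam y p' ξ η δ j ω)) ^ 2 ∂μ ≤
    4 * (2 * lam * T + 1 + T + T * (3 * k ^ 2 * CI lam * √δ)) := by
  have T' := TF_th hk
  have mY := fun j => d.mL (YS_meas (y := y) d h b j)
  have mY' := fun j => d.mL (YS_meas (y := y) d h b' j)
  have mtq : Measurable (tq k) := by
    have : Continuous (tq k) := by
      unfold tq tr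
      exact continuous_const.mul (Continuous.inv₀ (by fun_prop) fun x => by positivity)
    exact this.measurable
  have key : ∀ j, ∫ ω, tq k (YS ρ σ lam y p ξ η δ j ω - YS ρ σ lam y p' ξ η δ j ω) *
      (ind (YS ρ σ lam y p ξ η δ j ω) - ind (YS ρ σ lam y p' ξ η δ j ω)) ^ 2 ∂μ ≤
      ∫ α in (0:ℝ)..1, ∫ ω, th2 k ((1 - α) * YS ρ σ lam y p ξ η δ j ω +
      α * YS ρ σ lam y p' ξ η δ j ω) ∂μ := by
    intro j
    have mm : Measurable (Function.uncurry fun (α : ℝ) (ω : Ω) => th2 k ((1 - α) * YS ρ σ lam y p ξ η δ j ω +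
      α * YS ρ σ lam y p' ξ η δ j ω)) :=
      T'.c2.comp (((measurable_const.sub measurable_fst).mul ((mY j).comp measurable_snd)).add
        (measurable_fst.mul ((mY' j).comp measurable_snd)))
    have im : Integrable (Function.uncurry fun (α : ℝ) (ω : Ω) => th2 k ((1 - α) * YS ρ σ lam y p ξ η δ j ω +
      α * YS ρ σ lam y p' ξ η δ j ω)) ((volume.restrict (Ioc 0 1)).prod μ) :=
      Integrable.of_bound mm.aestronglyMeasurable (3 * k ^ 2) (ae_of_all _ fun _ => T'.b2 _)
    rw [intervalIntegral.integral_of_le zero_le_one, integral_integral_swap im]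
    refine integral_mono ?_ im.swap.integral_prod_left fun ω => ?_
    · refine bdd_int ((mtq.comp ((mY j).sub (mY' j))).mul
        (((ind_meas.comp (mY j)).sub (ind_meas.comp (mY' j))).pow_const 2)) (C := k * 1) fun ω => ?_
      refine bmul ?_ ?_
      · change |tq k _| ≤ k
        rw [abs_of_nonneg (tq_nonneg (by linarith) _)]
        exact tq_le (by linarith) _
      · change |(ind (YS ρ σ lam y p ξ η δ j ω) - ind (YS ρ σ lam y p' ξ η δ j ω)) ^ 2| ≤ 1
        rcases ind_bd (YS ρ σ lam y p ξ η δ j ω) with e | e <;>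
          rcases ind_bd (YS ρ σ lam y p' ξ η δ j ω) with e' | e' <;> rw [e, e'] <;> norm_num
    · have := straddle' hk (YS ρ σ lam y p ξ η δ j ω) (YS ρ σ lam y p' ξ η δ j ω)
      rw [intervalIntegral.integral_of_le zero_le_one] at this
      exact this
  have im2 : ∀ j, IntervalIntegrable (fun α => ∫ ω, th2 k ((1 - α) * YS ρ σ lam y p ξ η δ j ω +
      α * YS ρ σ lam y p' ξ η δ j ω) ∂μ) volume 0 1 := by
    intro j
    have mm : Measurable (Function.uncurry fun (α : ℝ) (ω : Ω) => th2 k ((1 - α) * YS ρ σ lam y p ξ η δ j ω +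
      α * YS ρ σ lam y p' ξ η δ j ω)) :=
      T'.c2.comp (((measurable_const.sub measurable_fst).mul ((mY j).comp measurable_snd)).add
        (measurable_fst.mul ((mY' j).comp measurable_snd)))
    have im : Integrable (Function.uncurry fun (α : ℝ) (ω : Ω) => th2 k ((1 - α) * YS ρ σ lam y p ξ η δ j ω +
      α * YS ρ σ lam y p' ξ η δ j ω)) ((volume.restrict (Ioc 0 1)).prod μ) :=
      Integrable.of_bound mm.aestronglyMeasurable (3 * k ^ 2) (ae_of_all _ fun _ => T'.b2 _)
    rw [intervalIntegrable_iff_integrableOn_Ioc_of_le zero_le_one]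
    exact im.integral_prod_left
  refine (mul_le_mul_of_nonneg_left (Finset.sum_le_sum fun j _ => key j) d.pos.le).trans ?_
  rw [← intervalIntegral.integral_finsetSum fun j _ => im2 j, ← intervalIntegral.integral_const_mul]
  have := intervalIntegral.integral_mono_on (μ := volume) (zero_le_one' ℝ)
    ((IntervalIntegrable.sum (Finset.range n) (fun j _ => im2 j)).const_mul δ)
    (intervalIntegrable_const (c := 4 * (2 * lam * T + 1 + T + T * (3 * k ^ 2 * CI lam * √δ))))
    (fun α hα => by
      have := occ (y := y) d hδ1 h b b' hk hn hα.1 hα.2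
      simpa using this)
  simpa using this

lemma stab_pt {k lam ρ σ Y Y' p p' : ℝ} (hk : 1 ≤ k) (h : PR ρ σ lam) (hp : p = 0 ∨ p = 1)
    (hp' : p' = 0 ∨ p' = 1) :
    bf1 k (Y - Y') * (-(2 * lam) * (p - p')) + bf2 k (Y - Y') * (((ρ - σ) * (p - p')) ^ 2 +
      ((ρ - σ) * (p - p')) ^ 2) / 2 ≤
    tq k (Y - Y') * (ind Y - ind Y') ^ 2 + (2 * lam * Real.log k + k) * (|p - ind Y| + |p' - ind Y'|) := by
  have hl := h.l0
  have hlog : 0 ≤ Real.log k := Real.log_nonneg hk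
  have hb1 := bf1_abs hk (Y - Y')
  have hb2 := bf2_nonneg hk (Y - Y')
  have hb3 := bf2_le hk (Y - Y')
  have hb4 := tq_le (by linarith : 0 ≤ k) (Y - Y')
  have hb5 := tq_nonneg (by linarith : 0 ≤ k) (Y - Y')
  have hrs : (ρ - σ) ^ 2 ≤ 1 := by nlinarith [h.nm, mul_nonneg h.r0 h.s0]
  have hrs0 := sq_nonneg (ρ - σ)
  have e1 : bf2 k (Y - Y') * (ρ - σ) ^ 2 ≤ tq k (Y - Y') := by nlinarith
  by_cases m0 : p = ind Y ∧ p' = ind Y'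
  · obtain ⟨rfl, rfl⟩ := m0
    have hd : 0 ≤ bf1 k (Y - Y') * (ind Y - ind Y') := by
      unfold ind
      split_ifs with a1 a2 a2
      · simp
      · have := bf1_mono hk (show Y - Y' ≤ 0 by linarith)
        rw [bf1_zero] at this
        linarith
      · have := bf1_mono hk (show 0 ≤ Y - Y' by linarith)
        rw [bf1_zero] at this
        linarith
      · simp
    simp only [sub_self, abs_zero, add_zero, mul_zero]
    have e2 := mul_le_mul_of_nonneg_right e1 (sq_nonneg (ind Y - ind Y'))
    nlinarith
  · have hm : 1 ≤ |p - ind Y| + |p' - ind Y'| := by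
      rw [not_and_or] at m0
      rcases m0 with m0 | m0
      · have : 1 ≤ |p - ind Y| := by
          rcases hp with e | e <;> rcases ind_bd Y with e' | e' <;> rw [e, e'] at m0 ⊢ <;> simp at m0 ⊢
        linarith [abs_nonneg (p' - ind Y')]
      · have : 1 ≤ |p' - ind Y'| := by
          rcases hp' with e | e <;> rcases ind_bd Y' with e' | e' <;> rw [e, e'] at m0 ⊢ <;> simp at m0 ⊢
        linarith [abs_nonneg (p - ind Y)]
    have h1 : |p - p'| ≤ 1 := by
      rcases hp with e | e <;> rcases hp' with e' | e' <;> rw [e, e'] <;> norm_num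
    have q1 : bf1 k (Y - Y') * (-(2 * lam) * (p - p')) ≤ 2 * lam * Real.log k := by
      have := bmul hb1 (bmul (x := -(2 * lam)) (c := 2 * lam) (le_of_eq (by rw [abs_neg, abs_of_nonneg (by positivity)])) h1)
      have := (abs_le.1 this).2
      linarith
    have h2 : (p - p') ^ 2 ≤ 1 := (sq_le_one_iff_abs_le_one _).2 h1
    have q2 : bf2 k (Y - Y') * (((ρ - σ) * (p - p')) ^ 2 + ((ρ - σ) * (p - p')) ^ 2) / 2 ≤ k := by
      have : bf2 k (Y - Y') * (((ρ - σ) * (p - p')) ^ 2 + ((ρ - σ) * (p - p')) ^ 2) / 2 =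
        bf2 k (Y - Y') * (ρ - σ) ^ 2 * (p - p') ^ 2 := by ring
      rw [this]
      nlinarith [mul_nonneg hb2 hrs0]
    have q3 : (2 * lam * Real.log k + k) * 1 ≤ (2 * lam * Real.log k + k) * (|p - ind Y| + |p' - ind Y'|) :=
      mul_le_mul_of_nonneg_left hm (by positivity)
    have q4 := mul_nonneg hb5 (sq_nonneg (ind Y - ind Y'))
    linarith

/-- mismatch functional -/
def Mis (μ : Measure Ω) (p Y : ℕ → Ω → ℝ) (δ : ℝ) (n : ℕ) : ℝ :=
  δ * ∑ j ∈ Finset.range n, ∫ ω, |p j ω - ind (Y j ω)| ∂μ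

lemma D_eq (j : ℕ) (ω : Ω) : YS ρ σ lam y p ξ η δ j ω - YS ρ σ lam y p' ξ η δ j ω =
    PS (fun _ => 0) (fun j ω => -(2 * lam) * (p j ω - p' j ω)) (fun j ω => (ρ - σ) * (p j ω - p' j ω))
      (fun j ω => (ρ - σ) * (p j ω - p' j ω)) ξ η δ j ω := by
  simp only [YS, PS, Ha]
  rw [add_sub_add_left_eq_sub, ← Finset.sum_sub_distrib, zero_add]
  refine Finset.sum_congr rfl fun i _ => ?_
  ring

lemma BP.sub_ad (b : BP G p) (b' : BP G p') {c C : ℝ} (hc : |c| ≤ C) :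
    AD G (fun j ω => c * (p j ω - p' j ω)) C :=
  ⟨fun j => measurable_const.mul ((b.ms j).sub (b'.ms j)), fun j ω => by
    have h1 : |p j ω - p' j ω| ≤ 1 := by
      rcases b.bd j ω with e | e <;> rcases b'.bd j ω with e' | e' <;> rw [e, e'] <;> norm_num
    have := bmul hc h1
    linarith⟩

lemma stab_E (d : DN μ G ξ η δ) (hδ1 : δ ≤ 1) (h : PR ρ σ lam) (b : BP G p) (b' : BP G p') {k : ℝ}
    (hk : 1 ≤ k) {T : ℝ} {n : ℕ} (hn : n * δ ≤ T) :
    Integrable (fun ω => bf k (YS ρ σ lam y p ξ η δ n ω - YS ρ σ lam y p' ξ η δ n ω)) μ ∧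
    ∫ ω, bf k (YS ρ σ lam y p ξ η δ n ω - YS ρ σ lam y p' ξ η δ n ω) ∂μ ≤
    4 * (2 * lam * T + 1 + T) + (2 * lam * Real.log k + k) *
      (Mis μ p (YS ρ σ lam y p ξ η δ) δ n + Mis μ p' (YS ρ σ lam y p' ξ η δ) δ n) +
      T * (12 * k ^ 2 * CI lam + KB k * CI (2 * lam)) * √δ := by
  have hl := h.l0
  have hδ := d.pos
  have mY := fun j => d.mL (YS_meas (y := y) d h b j)
  have mY' := fun j => d.mL (YS_meas (y := y) d h b' j)
  have mp := fun j => d.mL (b.ms j)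
  have mp' := fun j => d.mL (b'.ms j)
  have hrs : |ρ - σ| ≤ 1 := (sq_le_one_iff_abs_le_one _).1 (by nlinarith [h.nm, mul_nonneg h.r0 h.s0])
  have aβ := b.sub_ad b' (c := -(2 * lam)) (C := 2 * lam) (le_of_eq (by rw [abs_neg, abs_of_nonneg (by positivity)]))
  have a1 := b.sub_ad b' hrs
  have T' := TF_bf hk
  obtain ⟨I1, I2⟩ := ito_sum d hδ1 (V0 := fun _ => 0) measurable_const aβ a1 a1 T'
    (integrable_const _) n
  simp_rw [← D_eq (y := y)] at I1 I2
  refine ⟨I1, ?_⟩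
  have mtq : Measurable (tq k) := by
    have : Continuous (tq k) := by
      unfold tq tr
      exact continuous_const.mul (Continuous.inv₀ (by fun_prop) fun x => by positivity)
    exact this.measurable
  have step : ∀ j, ∫ ω, (bf1 k (YS ρ σ lam y p ξ η δ j ω - YS ρ σ lam y p' ξ η δ j ω) *
        (-(2 * lam) * (p j ω - p' j ω)) + bf2 k (YS ρ σ lam y p ξ η δ j ω - YS ρ σ lam y p' ξ η δ j ω) *
        (((ρ - σ) * (p j ω - p' j ω)) ^ 2 + ((ρ - σ) * (p j ω - p' j ω)) ^ 2) / 2) ∂μ ≤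
      ∫ ω, tq k (YS ρ σ lam y p ξ η δ j ω - YS ρ σ lam y p' ξ η δ j ω) *
      (ind (YS ρ σ lam y p ξ η δ j ω) - ind (YS ρ σ lam y p' ξ η δ j ω)) ^ 2 ∂μ +
      (2 * lam * Real.log k + k) * (∫ ω, |p j ω - ind (YS ρ σ lam y p ξ η δ j ω)| ∂μ +
       ∫ ω, |p' j ω - ind (YS ρ σ lam y p' ξ η δ j ω)| ∂μ) := by
    intro j
    have abs1 : ∀ {x : ℝ} (z : ℝ), x = 0 ∨ x = 1 → |(|x - ind z|)| ≤ 1 := by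
      intro x z hx
      rcases hx with e | e <;> rcases ind_bd z with e' | e' <;> rw [e, e'] <;> norm_num
    have i1 : Integrable (fun ω => tq k (YS ρ σ lam y p ξ η δ j ω - YS ρ σ lam y p' ξ η δ j ω) *
      (ind (YS ρ σ lam y p ξ η δ j ω) - ind (YS ρ σ lam y p' ξ η δ j ω)) ^ 2) μ := by
      refine bdd_int ((mtq.comp ((mY j).sub (mY' j))).mul
        (((ind_meas.comp (mY j)).sub (ind_meas.comp (mY' j))).pow_const 2)) (C := k * 1) fun ω => ?_
      refine bmul ?_ ?_
      · change |tq k _| ≤ k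
        rw [abs_of_nonneg (tq_nonneg (by linarith) _)]
        exact tq_le (by linarith) _
      · change |(ind (YS ρ σ lam y p ξ η δ j ω) - ind (YS ρ σ lam y p' ξ η δ j ω)) ^ 2| ≤ 1
        rcases ind_bd (YS ρ σ lam y p ξ η δ j ω) with e | e <;>
          rcases ind_bd (YS ρ σ lam y p' ξ η δ j ω) with e' | e' <;> rw [e, e'] <;> norm_num
    have i2 : Integrable (fun ω => |p j ω - ind (YS ρ σ lam y p ξ η δ j ω)|) μ :=
      bdd_int ((mp j).sub (ind_meas.comp (mY j))).abs fun ω => abs1 _ (b.bd j ω)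
    have i3 : Integrable (fun ω => |p' j ω - ind (YS ρ σ lam y p' ξ η δ j ω)|) μ :=
      bdd_int ((mp' j).sub (ind_meas.comp (mY' j))).abs fun ω => abs1 _ (b'.bd j ω)
    have i4 : Integrable (fun ω => bf1 k (YS ρ σ lam y p ξ η δ j ω - YS ρ σ lam y p' ξ η δ j ω) *
        (-(2 * lam) * (p j ω - p' j ω))) μ :=
      bdd_int ((T'.c1.comp ((mY j).sub (mY' j))).mul (d.mL (aβ.ms j))) fun ω => bmul (T'.b1 _) (aβ.bd j ω)
    have i5 : Integrable (fun ω => bf2 k (YS ρ σ lam y p ξ η δ j ω - YS ρ σ lam y p' ξ η δ j ω) *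
        (((ρ - σ) * (p j ω - p' j ω)) ^ 2 + ((ρ - σ) * (p j ω - p' j ω)) ^ 2) / 2) μ := by
      refine Integrable.div_const (bdd_int ((T'.c2.comp ((mY j).sub (mY' j))).mul
        (((d.mL (a1.ms j)).pow_const 2).add ((d.mL (a1.ms j)).pow_const 2))) (C := KB k * 2)
        fun ω => bmul (T'.b2 _) ?_) 2
      change |((ρ - σ) * (p j ω - p' j ω)) ^ 2 + ((ρ - σ) * (p j ω - p' j ω)) ^ 2| ≤ 2
      rw [abs_of_nonneg (by positivity)]
      have q1 := sq_le_one_iff_abs_le_one _ |>.2 (a1.bd j ω)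
      linarith
    rw [← integral_add i2 i3, ← integral_const_mul, ← integral_add i1 ((iadd i2 i3).const_mul _)]
    exact integral_mono (iadd i4 i5) (iadd i1 ((iadd i2 i3).const_mul _)) fun ω =>
      stab_pt hk h (b.bd j ω) (b'.bd j ω)
  have s1 := mul_le_mul_of_nonneg_left (Finset.sum_le_sum fun j (_ : j ∈ Finset.range n) => step j) hδ.le
  rw [Finset.sum_add_distrib, ← Finset.mul_sum, Finset.sum_add_distrib, mul_add,
    show ∀ a b c : ℝ, δ * (a * (b + c)) = a * (δ * b + δ * c) by intros; ring] at s1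
  have s2 := occ_str (y := y) d hδ1 h b b' hk hn
  have I3 := (abs_le.1 I2).2
  have e0 : ∫ ω : Ω, bf k 0 ∂μ = 0 := by simp [bf_zero]
  rw [e0] at I3
  have hCI := CI_nonneg (b := 2 * lam) (by positivity)
  have hKB := T'.K0
  have e4 : (n : ℝ) * (KB k * CI (2 * lam) * (δ * √δ)) = (n * δ) * (KB k * CI (2 * lam) * √δ) := by ring
  rw [e4] at I3
  have e5 : (n * δ) * (KB k * CI (2 * lam) * √δ) ≤ T * (KB k * CI (2 * lam) * √δ) :=
    mul_le_mul_of_nonneg_right hn (by positivity)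
  unfold Mis
  linarith

/-- Stability of driven schemes. -/
lemma stab (h : PR ρ σ lam) {T γ κ : ℝ} (hT : 0 ≤ T) (hγ : 0 < γ) (hκ : 0 < κ) :
    ∃ τ > 0, ∀ (G : ℕ → MeasurableSpace Ω) (ξ η p p' : ℕ → Ω → ℝ) (δ y : ℝ) (n : ℕ),
      DN μ G ξ η δ → BP G p → BP G p' → n * δ ≤ T → √δ ≤ τ →
      Mis μ p (YS ρ σ lam y p ξ η δ) δ n ≤ τ → Mis μ p' (YS ρ σ lam y p' ξ η δ) δ n ≤ τ →
      μ.real {ω | γ ≤ |YS ρ σ lam y p ξ η δ n ω - YS ρ σ lam y p' ξ η δ n ω|} ≤ κ := by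
  have hl := h.l0
  obtain ⟨k, hk, hA⟩ := bf_blow hγ ((4 * (2 * lam * T + 1 + T) + 2) / κ)
  set C1 := 2 * lam * Real.log k + k
  set C2 := T * (12 * k ^ 2 * CI lam + KB k * CI (2 * lam))
  have hC1 : 0 < C1 := by have := Real.log_nonneg hk; positivity
  have hC2 : 0 ≤ C2 := by
    have := CI_nonneg hl
    have := CI_nonneg (b := 2 * lam) (by positivity)
    have := (TF_bf hk).K0
    positivity
  have hA0 : 0 < 4 * (2 * lam * T + 1 + T) + 2 := by positivity
  refine ⟨min 1 (1 / (2 * C1 + C2)), by positivity, ?_⟩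
  intro G ξ η p p' δ y n d b b' hn hδ h1 h2
  have hδ1 : δ ≤ 1 := by
    have := hδ.trans (min_le_left _ _)
    rwa [Real.sqrt_le_one] at this
  obtain ⟨J1, J2⟩ := stab_E (y := y) d hδ1 h b b' hk hn
  have q : (2 * C1 + C2) * min 1 (1 / (2 * C1 + C2)) ≤ 1 := by
    refine (mul_le_mul_of_nonneg_left (min_le_right _ _) (by positivity)).trans (le_of_eq ?_)
    field_simp
  set τ := min 1 (1 / (2 * C1 + C2))
  have J3 : ∫ ω, bf k (YS ρ σ lam y p ξ η δ n ω - YS ρ σ lam y p' ξ η δ n ω) ∂μ ≤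
      4 * (2 * lam * T + 1 + T) + 2 := by
    have q1 : C1 * (Mis μ p (YS ρ σ lam y p ξ η δ) δ n + Mis μ p' (YS ρ σ lam y p' ξ η δ) δ n) ≤ C1 * (2 * τ) :=
      mul_le_mul_of_nonneg_left (by linarith) hC1.le
    have q2 : C2 * √δ ≤ C2 * τ := mul_le_mul_of_nonneg_left hδ hC2
    linarith
  have M := mul_meas_ge_le_integral_of_nonneg (ae_of_all _ fun ω => bf_nonneg hk _) J1 (γ / 2 * bf1 k (γ / 2))
  have sub : μ.real {ω | γ ≤ |YS ρ σ lam y p ξ η δ n ω - YS ρ σ lam y p' ξ η δ n ω|} ≤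
      μ.real {ω | γ / 2 * bf1 k (γ / 2) ≤ bf k (YS ρ σ lam y p ξ η δ n ω - YS ρ σ lam y p' ξ η δ n ω)} :=
    measureReal_mono (fun ω hω => bf_lower hk hγ hω)
  have : (4 * (2 * lam * T + 1 + T) + 2) / κ * μ.real {ω | γ ≤ |YS ρ σ lam y p ξ η δ n ω - YS ρ σ lam y p' ξ η δ n ω|}
      ≤ 4 * (2 * lam * T + 1 + T) + 2 := by
    refine le_trans ?_ (M.trans J3)
    exact mul_le_mul hA sub measureReal_nonneg (le_trans (by positivity) hA)
  rw [div_mul_eq_mul_div, div_le_iff₀ hκ] at this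
  exact le_of_mul_le_mul_left this hA0

end stab2

/-! ### Processes: continuity in probability and sampling -/

section proc
variable {μ : Measure Ω} [IsProbabilityMeasure μ]

/-- tail probability -/
def TP (μ : Measure Ω) (Z : Ω → ℝ) (ε : ℝ) : ℝ := μ.real {ω | ε ≤ |Z ω|}

lemma TP_nonneg (Z : Ω → ℝ) (ε : ℝ) : 0 ≤ TP μ Z ε := measureReal_nonneg

lemma TP_add (Z W : Ω → ℝ) (a b : ℝ) : TP μ (fun ω => Z ω + W ω) (a + b) ≤ TP μ Z a + TP μ W b := by
  refine le_trans (measureReal_mono ?_) (measureReal_union_le _ _)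
  intro ω hω
  simp only [mem_setOf_eq, mem_union] at hω ⊢
  by_contra hh
  push Not at hh
  have := abs_add_le (Z ω) (W ω)
  linarith

lemma TP_tri (X Y Z : Ω → ℝ) (a b : ℝ) :
    TP μ (fun ω => X ω - Z ω) (a + b) ≤ TP μ (fun ω => X ω - Y ω) a + TP μ (fun ω => Y ω - Z ω) b := by
  refine le_trans (le_of_eq ?_) (TP_add (fun ω => X ω - Y ω) (fun ω => Y ω - Z ω) a b)
  congr 1; ext ω; ring

lemma TP_mono {Z : Ω → ℝ} {a b : ℝ} (h : a ≤ b) : TP μ Z b ≤ TP μ Z a :=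
  measureReal_mono fun _ hω => h.trans hω

lemma TP_comm (X Y : Ω → ℝ) (a : ℝ) : TP μ (fun ω => X ω - Y ω) a = TP μ (fun ω => Y ω - X ω) a := by
  unfold TP; simp_rw [abs_sub_comm]

lemma TP_sq {Z : Ω → ℝ} (hZ : MemLp Z 2 μ) {ε : ℝ} (hε : 0 < ε) :
    TP μ Z ε ≤ ε⁻¹ ^ 2 * ∫ ω, Z ω ^ 2 ∂μ := by
  have := mul_meas_ge_le_integral_of_nonneg (ae_of_all _ fun ω => sq_nonneg (Z ω)) hZ.integrable_sq (ε ^ 2)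
  have e : {ω | ε ^ 2 ≤ Z ω ^ 2} = {ω | ε ≤ |Z ω|} := by
    ext ω
    simp only [mem_setOf_eq]
    rw [← sq_abs (Z ω)]
    exact pow_le_pow_iff_left₀ hε.le (abs_nonneg _) (by norm_num)
  rw [e] at this
  rw [inv_pow, ← div_eq_inv_mul, le_div_iff₀ (by positivity), mul_comm]
  exact this

lemma TP_L1 {Z : Ω → ℝ} (hZ : Integrable Z μ) {ε : ℝ} (hε : 0 < ε) :
    TP μ Z ε ≤ ε⁻¹ * ∫ ω, |Z ω| ∂μ := by
  have := mul_meas_ge_le_integral_of_nonneg (ae_of_all _ fun ω => abs_nonneg (Z ω)) hZ.abs ε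
  rw [← div_eq_inv_mul, le_div_iff₀ hε, mul_comm]
  exact this

lemma TP_tim {ι : Type*} {l : Filter ι} {f : ι → Ω → ℝ} {g : Ω → ℝ} (h : TendstoInMeasure μ f l g) {ε : ℝ}
    (hε : 0 < ε) : Tendsto (fun i => TP μ (fun ω => f i ω - g ω) ε) l (nhds 0) := by
  have := tendstoInMeasure_iff_measureReal_norm.1 h ε hε
  exact this

lemma tim_TP {ι : Type*} {l : Filter ι} {f : ι → Ω → ℝ} {g : Ω → ℝ}
    (h : ∀ ε > 0, Tendsto (fun i => TP μ (fun ω => f i ω - g ω) ε) l (nhds 0)) : TendstoInMeasure μ f l g :=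
  tendstoInMeasure_iff_measureReal_norm.2 h

lemma ind_abs_le {x z ε : ℝ} : |ind x - ind z| ≤ (if |x| ≤ ε then 1 else 0) + (if ε ≤ |z - x| then 1 else 0) := by
  have n1 : (0:ℝ) ≤ (if |x| ≤ ε then 1 else 0) := by split_ifs <;> norm_num
  have n2 : (0:ℝ) ≤ (if ε ≤ |z - x| then 1 else 0) := by split_ifs <;> norm_num
  by_cases he : ind x = ind z
  · rw [he, sub_self, abs_zero]; linarith
  · have h1 : |ind x - ind z| ≤ 1 := by
      rcases ind_bd x with e | e <;> rcases ind_bd z with e' | e' <;> rw [e, e'] <;> norm_num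
    have hx : |x| ≤ |z - x| := by
      unfold ind at he
      split_ifs at he with h1 h2 h3
      · exact absurd rfl he
      · rw [abs_of_nonpos h1, abs_of_nonneg (by linarith)]; linarith
      · rw [abs_of_nonneg (by linarith), abs_of_nonpos (by linarith)]; linarith
      · exact absurd rfl he
    rcases le_total |x| ε with h | h
    · rw [if_pos h]; linarith
    · rw [if_pos (h.trans hx)] at *; linarith

lemma ind_close {X Z : Ω → ℝ} (hX : Measurable X) (hZ : Measurable Z) (ε : ℝ) :
    ∫ ω, |ind (Z ω) - ind (X ω)| ∂μ ≤ μ.real {ω | |X ω| ≤ ε} + TP μ (fun ω => Z ω - X ω) ε := by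
  have m1 : MeasurableSet {ω | |X ω| ≤ ε} := measurableSet_le hX.abs measurable_const
  have m2 : MeasurableSet {ω | ε ≤ |Z ω - X ω|} := measurableSet_le measurable_const (hZ.sub hX).abs
  rw [TP, ← integral_indicator_one m1, ← integral_indicator_one m2, ← integral_add
    ((integrable_const 1).indicator m1) ((integrable_const 1).indicator m2)]
  refine integral_mono_of_nonneg (ae_of_all _ fun ω => abs_nonneg _)
    (((integrable_const 1).indicator m1).add ((integrable_const 1).indicator m2)) (ae_of_all _ fun ω => ?_)
  have := ind_abs_le (x := X ω) (z := Z ω) (ε := ε)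
  rw [abs_sub_comm] at this
  simpa [Set.indicator] using this

lemma ind_abs_one (x z : ℝ) : |ind x - ind z| ≤ 1 := by
  rcases ind_bd x with e | e <;> rcases ind_bd z with e' | e' <;> rw [e, e'] <;> norm_num

lemma ind_int {X Z : Ω → ℝ} (hX : Measurable X) (hZ : Measurable Z) :
    Integrable (fun ω => |ind (Z ω) - ind (X ω)|) μ :=
  bdd_int ((ind_meas.comp hZ).sub (ind_meas.comp hX)).abs fun ω => by
    rw [abs_abs]; exact ind_abs_one _ _

lemma ind_E_one {X Z : Ω → ℝ} (hX : Measurable X) (hZ : Measurable Z) :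
    ∫ ω, |ind (Z ω) - ind (X ω)| ∂μ ≤ 1 := by
  have := integral_mono (ind_int (μ := μ) hX hZ) (integrable_const 1) fun ω => ind_abs_one (Z ω) (X ω)
  simpa using this

lemma avg_bd {f : ℕ → ℝ} {δ κ T θ : ℝ} (hδ : 0 < δ) (hκ : 0 ≤ κ) (hθ : 0 ≤ θ) {n : ℕ} (hn : n * δ ≤ T)
    (f1 : ∀ j < n, f j ≤ 1) (f2 : ∀ j < n, κ ≤ j * δ → f j ≤ θ) :
    δ * ∑ j ∈ Finset.range n, f j ≤ κ + δ + T * θ := by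
  have : ∑ j ∈ Finset.range n, f j ≤ ∑ j ∈ Finset.range n, ((if j < ⌈κ / δ⌉₊ then 1 else 0) + θ) := by
    refine Finset.sum_le_sum fun j hj => ?_
    have hj := Finset.mem_range.1 hj
    split_ifs with h
    · linarith [f1 j hj]
    · rw [zero_add]
      refine f2 j hj ?_
      rw [← div_le_iff₀ hδ]
      exact Nat.ceil_le.1 (not_lt.1 h)
  have c : ∑ j ∈ Finset.range n, (if j < ⌈κ / δ⌉₊ then (1 : ℝ) else 0) ≤ κ / δ + 1 := by
    rw [Finset.sum_ite, Finset.sum_const_zero, add_zero, Finset.sum_const, nsmul_eq_mul, mul_one]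
    have : (Finset.filter (fun j => j < ⌈κ / δ⌉₊) (Finset.range n)).card ≤ ⌈κ / δ⌉₊ := by
      refine (Finset.card_le_card (t := Finset.range ⌈κ / δ⌉₊) fun j hj => ?_).trans (by simp)
      simp at hj ⊢; exact hj.2
    have h2 := Nat.ceil_lt_add_one (a := κ / δ) (by positivity)
    have h3 : ((Finset.filter (fun j => j < ⌈κ / δ⌉₊) (Finset.range n)).card : ℝ) ≤ (⌈κ / δ⌉₊ : ℝ) := by exact_mod_cast this
    linarith
  rw [Finset.sum_add_distrib, Finset.sum_const, Finset.card_range, nsmul_eq_mul] at this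
  have e := mul_le_mul_of_nonneg_left (this.trans (add_le_add c le_rfl)) hδ.le
  have e2 : δ * (κ / δ + 1 + n * θ) = κ + δ + (n * δ) * θ := by field_simp
  rw [e2] at e
  have := mul_le_mul_of_nonneg_right hn hθ
  linarith

/-- continuous measurable process with uniform anti-concentration -/
structure NP (μ : Measure Ω) (Y : ℝ → Ω → ℝ) : Prop where
  ms : ∀ t, 0 ≤ t → Measurable (Y t)
  ct : ∀ᵐ ω ∂μ, Continuous fun t => Y t ω
  ac : ∀ T κ θ : ℝ, 0 < κ → 0 < θ → ∃ ε > 0, ∀ u, κ ≤ u → u ≤ T → μ.real {ω | |Y u ω| ≤ ε} ≤ θ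

variable {Y : ℝ → Ω → ℝ}

lemma uc (hm : ∀ t, 0 ≤ t → Measurable (Y t)) (hc : ∀ᵐ ω ∂μ, Continuous fun t => Y t ω)
    (T : ℝ) {ε θ : ℝ} (hε : 0 < ε) (hθ : 0 < θ) :
    ∃ c > 0, ∀ u v, 0 ≤ u → u ≤ T → 0 ≤ v → v ≤ T → |u - v| ≤ c → TP μ (fun ω => Y u ω - Y v ω) ε ≤ θ := by
  by_contra hh
  push Not at hh
  choose u v hu0 huT hv0 hvT huv hbig using fun n : ℕ => hh (1 / (n + 1 : ℝ)) (by positivity)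
  obtain ⟨a, ha, φ, hφ, hlim⟩ := isCompact_Icc.tendsto_subseq (x := u) (s := Icc 0 T) fun n => ⟨hu0 n, huT n⟩
  have hd : Tendsto (fun n => u n - v n) atTop (nhds 0) := by
    rw [tendsto_zero_iff_abs_tendsto_zero]
    exact squeeze_zero (fun n => abs_nonneg _) huv tendsto_one_div_add_atTop_nhds_zero_nat
  have hlim2 : Tendsto (v ∘ φ) atTop (nhds a) := by
    have := hlim.sub (hd.comp hφ.tendsto_atTop)
    rw [sub_zero] at this
    refine this.congr fun n => ?_
    simp
  have : TendstoInMeasure μ (fun n ω => Y (u (φ n)) ω - Y (v (φ n)) ω) atTop (fun _ => 0) := by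
    refine tendstoInMeasure_of_tendsto_ae (fun n => ((hm _ (hu0 _)).sub (hm _ (hv0 _))).aestronglyMeasurable) ?_
    filter_upwards [hc] with ω hω
    have h1 := (hω.tendsto a).comp hlim
    have h2 := (hω.tendsto a).comp hlim2
    have := h1.sub h2
    rw [sub_self] at this
    exact this
  have := TP_tim this hε
  simp only [sub_zero] at this
  have := ge_of_tendsto' (b := θ) this fun n => (hbig (φ n)).le
  linarith

/-- sampling with perturbed values -/
lemma NP.cz (h : NP μ Y) {T θ : ℝ} (hT : 0 < T) (hθ : 0 < θ) :
    ∃ ε > 0, ∃ θ' > 0, ∀ (δ : ℝ) (n : ℕ) (Z : ℕ → Ω → ℝ), 0 < δ → δ ≤ θ' → n * δ ≤ T →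
      (∀ j, Measurable (Z j)) → (∀ j < n, TP μ (fun ω => Z j ω - Y (j * δ) ω) ε ≤ θ') →
      δ * ∑ j ∈ Finset.range n, ∫ ω, |ind (Z j ω) - ind (Y (j * δ) ω)| ∂μ ≤ θ := by
  obtain ⟨ε, hε, hac⟩ := h.ac T (θ / 4) (θ / (8 * T)) (by positivity) (by positivity)
  refine ⟨ε, hε, min (θ / 4) (θ / (8 * T)), by positivity, ?_⟩
  intro δ n Z hδ hδ' hn hZ hTP
  have mY : ∀ j : ℕ, Measurable (Y (j * δ)) := fun j => h.ms _ (by positivity)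
  have := avg_bd (f := fun j => ∫ ω, |ind (Z j ω) - ind (Y (j * δ) ω)| ∂μ) (κ := θ / 4) (T := T)
    (θ := θ / (4 * T)) hδ (by positivity) (by positivity) hn (fun j _ => ind_E_one (mY j) (hZ j)) ?_
  · have e : T * (θ / (4 * T)) = θ / 4 := by field_simp
    have := min_le_left (θ / 4) (θ / (8 * T))
    linarith
  · intro j hj hκ
    have hjT : j * δ ≤ T := by
      refine le_trans ?_ hn
      exact mul_le_mul_of_nonneg_right (by exact_mod_cast hj.le) hδ.le
    refine (ind_close (mY j) (hZ j) ε).trans ?_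
    have a1 := hac _ hκ hjT
    have a2 := (hTP j hj).trans (min_le_right _ _)
    have e : θ / (4 * T) = θ / (8 * T) + θ / (8 * T) := by field_simp; norm_num
    linarith

lemma NP.cf (h : NP μ Y) {T θ : ℝ} (hT : 0 < T) (hθ : 0 < θ) :
    ∃ c > 0, ∀ (δ : ℝ) (n : ℕ) (a : ℕ → ℝ), 0 < δ → δ ≤ c → n * δ ≤ T →
      (∀ j, 0 ≤ a j) → (∀ j < n, a j ≤ j * δ ∧ j * δ - a j ≤ c) →
      δ * ∑ j ∈ Finset.range n, ∫ ω, |ind (Y (a j) ω) - ind (Y (j * δ) ω)| ∂μ ≤ θ := by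
  obtain ⟨ε, hε, θ', hθ', hcz⟩ := h.cz hT hθ
  obtain ⟨c, hc, huc⟩ := uc h.ms h.ct T hε hθ'
  refine ⟨min c θ', by positivity, fun δ n a hδ hδc hn ha0 ha => ?_⟩
  refine hcz δ n (fun j => Y (a j)) hδ (hδc.trans (min_le_right _ _)) hn (fun j => h.ms _ (ha0 j)) fun j hj => ?_
  obtain ⟨a1, a2⟩ := ha j hj
  have hjT : j * δ ≤ T := by
    refine le_trans ?_ hn
    exact mul_le_mul_of_nonneg_right (by exact_mod_cast hj.le) hδ.le
  refine huc _ _ (ha0 j) (a1.trans hjT) (by positivity) hjT ?_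
  rw [abs_sub_comm, abs_of_nonneg (by linarith)]
  exact a2.trans (min_le_left _ _)

lemma NP.null (h : NP μ Y) {t : ℝ} (ht : 0 < t) : μ {ω | Y t ω = 0} = 0 := by
  have : μ.real {ω | Y t ω = 0} ≤ 0 := by
    refine le_of_forall_pos_le_add fun θ hθ => ?_
    obtain ⟨ε, hε, hh⟩ := h.ac t t θ ht hθ
    rw [zero_add]
    refine (measureReal_mono fun ω hω => ?_).trans (hh t le_rfl le_rfl)
    simp only [mem_setOf_eq] at hω ⊢
    rw [hω, abs_zero]; exact hε.le
  have := le_antisymm this measureReal_nonneg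
  rwa [measureReal_eq_zero_iff] at this

lemma floor_tendsto (t : ℝ) (ht : 0 ≤ t) : Tendsto (fun L : ℕ => (⌊t * 2 ^ L⌋₊ : ℝ) * (1 / 2 ^ L)) atTop (nhds t) := by
  have : Tendsto (fun L : ℕ => (2 : ℝ) ^ L) atTop atTop := tendsto_pow_atTop_atTop_of_one_lt (by norm_num)
  have := (tendsto_nat_floor_mul_div_atTop ht).comp this
  refine this.congr fun L => ?_
  simp only [Function.comp]
  ring

/-- almost surely the zero set is Lebesgue null -/
lemma NP.zero_null (h : NP μ Y) : ∀ᵐ ω ∂μ, ∀ᵐ t ∂(volume.restrict (Ioi (0:ℝ))), Y t ω ≠ 0 := by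
  set S : Set (ℝ × Ω) := {x | Tendsto (fun L : ℕ => Y ((⌊x.1 * 2 ^ L⌋₊ : ℝ) * (1 / 2 ^ L)) x.2) atTop (nhds 0)} with hS
  have mS : MeasurableSet S := by
    refine measurableSet_tendsto (nhds (0:ℝ)) fun L => ?_
    have : Measurable (fun x : ℕ × Ω => Y ((x.1 : ℝ) * (1 / 2 ^ L)) x.2) :=
      measurable_from_prod_countable_right fun k => h.ms _ (mul_nonneg (Nat.cast_nonneg _) (by positivity))
    exact this.comp ((Nat.measurable_floor.comp (measurable_fst.mul_const _)).prodMk measurable_snd)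
  have e : ∀ᵐ ω ∂μ, ∀ t, 0 ≤ t → ((t, ω) ∈ S ↔ Y t ω = 0) := by
    filter_upwards [h.ct] with ω hω t ht
    have := (hω.tendsto t).comp (floor_tendsto t ht)
    constructor
    · intro hs
      exact tendsto_nhds_unique this hs
    · intro h0
      rw [h0] at this
      exact this
  have p0 : ((volume.restrict (Ioi (0:ℝ))).prod μ) S = 0 := by
    rw [Measure.measure_prod_null mS]
    filter_upwards [ae_restrict_mem measurableSet_Ioi] with t ht
    refine measure_mono_null_ae ?_ (h.null ht)
    filter_upwards [e] with ω hω
    intro hs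
    exact (hω t (le_of_lt ht)).1 hs
  have p1 : ∀ᵐ ω ∂μ, (volume.restrict (Ioi (0:ℝ))) ((fun t => (t, ω)) ⁻¹' S) = 0 := by
    have := Measure.measure_prod_null (μ := μ) (ν := volume.restrict (Ioi (0:ℝ))) (measurable_swap mS)
    rw [← Measure.prod_swap, Measure.map_apply measurable_swap mS] at p0
    exact this.1 p0
  filter_upwards [p1, e] with ω h1 h2
  have : ∀ᵐ t ∂(volume.restrict (Ioi (0:ℝ))), (t, ω) ∉ S := measure_eq_zero_iff_ae_notMem.1 h1
  filter_upwards [this, ae_restrict_mem measurableSet_Ioi] with t ht1 ht2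
  intro h0
  exact ht1 ((h2 t (le_of_lt ht2)).2 h0)

lemma step_int (f : ℕ → ℝ) {δ : ℝ} (hδ : 0 < δ) (n : ℕ) :
    ∫ u in (0:ℝ)..(n * δ), f ⌊u / δ⌋₊ = δ * ∑ j ∈ Finset.range n, f j := by
  have cell : ∀ j : ℕ, ∀ u ∈ Ioo (j * δ) ((j + 1 : ℕ) * δ), f ⌊u / δ⌋₊ = f j := by
    intro j u hu
    congr 1
    rw [Nat.floor_eq_iff (div_nonneg ((by positivity : (0:ℝ) ≤ j * δ).trans hu.1.le) hδ.le), le_div_iff₀ hδ, div_lt_iff₀ hδ]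
    have := hu.2
    push_cast at this
    exact ⟨hu.1.le, this⟩
  have le : ∀ j : ℕ, (j * δ : ℝ) ≤ (j + 1 : ℕ) * δ := fun j => by push_cast; nlinarith
  have cc : ∀ j : ℕ, ∀ᵐ u, u ∈ uIoc (j * δ) ((j + 1 : ℕ) * δ) → f j = f ⌊u / δ⌋₊ := by
    intro j
    have : ∀ᵐ u : ℝ, u ≠ (j + 1 : ℕ) * δ := by simp [ae_iff]
    filter_upwards [this] with u hu hu2
    rw [uIoc_of_le (le j)] at hu2
    exact (cell j u ⟨hu2.1, lt_of_le_of_ne hu2.2 hu⟩).symm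
  have := intervalIntegral.sum_integral_adjacent_intervals (μ := volume) (f := fun u => f ⌊u / δ⌋₊)
    (a := fun j : ℕ => (j * δ : ℝ)) (n := n) fun j _ => by
      refine IntervalIntegrable.congr_ae (f := fun _ => f j) intervalIntegrable_const ?_
      exact (ae_restrict_iff' measurableSet_uIoc).2 (cc j)
  simp only [Nat.cast_zero, zero_mul] at this
  rw [← this, Finset.mul_sum]
  refine Finset.sum_congr rfl fun j _ => ?_
  rw [← intervalIntegral.integral_congr_ae (cc j), intervalIntegral.integral_const, smul_eq_mul]
  push_cast; ring

lemma ind_tendsto {ι : Type*} {l : Filter ι} {f : ι → ℝ} {x : ℝ} (h : Tendsto f l (nhds x)) (hx : x ≠ 0) :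
    Tendsto (fun i => ind (f i)) l (nhds (ind x)) := by
  refine tendsto_const_nhds.congr' ?_
  rcases lt_or_gt_of_ne hx with h0 | h0
  · filter_upwards [h.eventually_lt_const h0] with i hi
    rw [ind, if_pos h0.le, ind, if_pos hi.le]
  · filter_upwards [h.eventually_const_lt h0] with i hi
    rw [ind, if_neg (not_le.2 h0), ind, if_neg (not_le.2 hi)]

/-- a.s. convergence of the sampled occupation integrals -/
lemma NP.drift (h : NP μ Y) : ∀ᵐ ω ∂μ, ∀ k M : ℕ, Tendsto (fun n : ℕ => 1 / 2 ^ (M + n) *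
    ∑ j ∈ Finset.range (k * 2 ^ n), ind (Y (j * (1 / 2 ^ (M + n))) ω)) atTop
    (nhds (∫ u in (0:ℝ)..(k * (1 / 2 ^ M)), ind (Y u ω))) := by
  filter_upwards [h.zero_null, h.ct] with ω h1 h2 k M
  have e : ∀ n : ℕ, (1 / 2 ^ (M + n) * ∑ j ∈ Finset.range (k * 2 ^ n), ind (Y (j * (1 / 2 ^ (M + n))) ω) : ℝ) =
      ∫ u in (0:ℝ)..(k * (1 / 2 ^ M)), ind (Y (⌊u * 2 ^ (M + n)⌋₊ * (1 / 2 ^ (M + n))) ω) := by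
    intro n
    have := step_int (fun j => ind (Y (j * (1 / 2 ^ (M + n))) ω)) (δ := 1 / 2 ^ (M + n)) (by positivity) (k * 2 ^ n)
    rw [← this]
    have e1 : ((k * 2 ^ n : ℕ) : ℝ) * (1 / 2 ^ (M + n)) = k * (1 / 2 ^ M) := by
      push_cast; rw [pow_add]; field_simp
    rw [e1]
    simp only [div_div_eq_mul_div, div_one]
  simp_rw [e]
  refine intervalIntegral.tendsto_integral_filter_of_dominated_convergence (fun _ => 1) ?_ ?_ ?_ ?_
  · refine Eventually.of_forall fun n => Measurable.aestronglyMeasurable ?_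
    have : Measurable (fun j : ℕ => ind (Y (j * (1 / 2 ^ (M + n))) ω)) := measurable_from_top
    exact this.comp (Nat.measurable_floor.comp (measurable_id.mul_const _))
  · refine Eventually.of_forall fun n => ae_of_all _ fun u _ => ?_
    rcases ind_bd (Y (⌊u * 2 ^ (M + n)⌋₊ * (1 / 2 ^ (M + n))) ω) with e | e <;> rw [e] <;> norm_num
  · exact intervalIntegrable_const
  · rw [ae_restrict_iff' measurableSet_Ioi] at h1
    filter_upwards [h1] with u hu hu2
    rw [uIoc_of_le (by positivity)] at hu2
    refine ind_tendsto ?_ (hu hu2.1)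
    have := (h2.tendsto u).comp ((floor_tendsto u hu2.1.le).comp (tendsto_add_atTop_nat M))
    refine this.congr fun n => ?_
    simp only [Function.comp, add_comm n M]

end proc

/-! ### Sampling on dyadic grids -/

lemma coarse_sum (a b : ℕ → ℝ) (r n : ℕ) : ∑ i ∈ Finset.range n, a i * (b ((i + 1) * r) - b (i * r)) =
    ∑ j ∈ Finset.range (n * r), a (j / r) * (b (j + 1) - b j) := by
  rcases Nat.eq_zero_or_pos r with rfl | hr
  · simp
  induction n with
  | zero => simp
  | succ n ih =>
    rw [Finset.sum_range_succ, ih, add_mul, one_mul, Finset.sum_range_add]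
    congr 1
    have : ∀ x ∈ Finset.range r, a ((n * r + x) / r) * (b (n * r + x + 1) - b (n * r + x)) =
        a n * (b (n * r + (x + 1)) - b (n * r + x)) := by
      intro x hx
      rw [show n * r + x = x + n * r by ring, Nat.add_mul_div_right _ _ hr, Nat.div_eq_of_lt (Finset.mem_range.1 hx)]
      rw [zero_add, show n * r + (x + 1) = x + n * r + 1 by ring]
    rw [Finset.sum_congr rfl this, ← Finset.mul_sum, Finset.sum_range_sub (fun x => b (n * r + x)), add_zero]

lemma coarse_inc (A : ℕ → ℝ) (B : ℝ → Ω → ℝ) {c δ : ℝ} {r : ℕ} (hc : c = r * δ) (n : ℕ) (ω : Ω) :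
    ∑ i ∈ Finset.range n, A i * (B ((i + 1) * c) ω - B (i * c) ω) =
    ∑ j ∈ Finset.range (n * r), A (j / r) * inc B 0 δ j ω := by
  have := coarse_sum A (fun j => B (j * δ) ω) r n
  simp only [inc, zero_add]
  push_cast at this
  rw [← this, hc]
  refine Finset.sum_congr rfl fun i _ => ?_
  rw [mul_assoc, mul_assoc]

section samp
variable {μ : Measure Ω} [IsProbabilityMeasure μ] {G : ℕ → MeasurableSpace Ω}
  {ξ η : ℕ → Ω → ℝ} {δ : ℝ} {p p' : ℕ → Ω → ℝ} {F : ℝ → MeasurableSpace Ω} {B₁ B₂ Y : ℝ → Ω → ℝ}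

lemma LS_diff (α₁ β₁ α₂ β₂ : ℝ) (n : ℕ) (ω : Ω) :
    LS (fun j ω => α₁ + β₁ * p j ω) (fun j ω => α₂ + β₂ * p j ω) ξ η n ω -
    LS (fun j ω => α₁ + β₁ * p' j ω) (fun j ω => α₂ + β₂ * p' j ω) ξ η n ω =
    LS (fun j ω => β₁ * (p j ω - p' j ω)) (fun j ω => β₂ * (p j ω - p' j ω)) ξ η n ω := by
  simp only [LS]
  rw [← Finset.sum_sub_distrib]
  refine Finset.sum_congr rfl fun i _ => ?_
  ring

lemma diff_E (d : DN μ G ξ η δ) (b : BP G p) (b' : BP G p') {β₁ β₂ : ℝ} (h1 : |β₁| ≤ 1) (h2 : |β₂| ≤ 1) (n : ℕ) :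
    δ * ∑ j ∈ Finset.range n, ∫ ω, ((β₁ * (p j ω - p' j ω)) ^ 2 + (β₂ * (p j ω - p' j ω)) ^ 2) ∂μ ≤
    2 * (δ * ∑ j ∈ Finset.range n, ∫ ω, |p j ω - p' j ω| ∂μ) := by
  have e0 : 2 * (δ * ∑ j ∈ Finset.range n, ∫ ω, |p j ω - p' j ω| ∂μ) =
      δ * ∑ j ∈ Finset.range n, 2 * ∫ ω, |p j ω - p' j ω| ∂μ := by
    rw [← Finset.mul_sum]; ring
  rw [e0]
  refine mul_le_mul_of_nonneg_left (Finset.sum_le_sum fun j _ => ?_) d.pos.le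
  rw [← integral_const_mul]
  have h1 := (sq_le_one_iff_abs_le_one _).2 h1
  have h2 := (sq_le_one_iff_abs_le_one _).2 h2
  have i1 : Integrable (fun ω => 2 * |p j ω - p' j ω|) μ := by
    refine Integrable.const_mul ?_ 2
    refine bdd_int (((d.mL (b.ms j)).sub (d.mL (b'.ms j))).abs) (C := 1) fun ω => ?_
    change |(|p j ω - p' j ω|)| ≤ 1
    rcases b.bd j ω with e | e <;> rcases b'.bd j ω with e' | e' <;> rw [e, e'] <;> norm_num
  refine integral_mono_of_nonneg (ae_of_all _ fun ω => by positivity) i1 (ae_of_all _ fun ω => ?_)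
  simp only
  rcases b.bd j ω with e | e <;> rcases b'.bd j ω with e' | e' <;> rw [e, e'] <;> norm_num <;> linarith

lemma doob_diff (d : DN μ G ξ η δ) (b : BP G p) (b' : BP G p') {β₁ β₂ : ℝ} (h1 : |β₁| ≤ 1) (h2 : |β₂| ≤ 1)
    (n : ℕ) (α₁ α₂ : ℝ) {ε : ℝ} (hε : 0 < ε) :
    μ.real {ω | ∃ k ≤ n, ε ≤ |LS (fun j ω => α₁ + β₁ * p j ω) (fun j ω => α₂ + β₂ * p j ω) ξ η k ω -
      LS (fun j ω => α₁ + β₁ * p' j ω) (fun j ω => α₂ + β₂ * p' j ω) ξ η k ω|} ≤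
      ε⁻¹ ^ 2 * (2 * (δ * ∑ j ∈ Finset.range n, ∫ ω, |p j ω - p' j ω| ∂μ)) := by
  simp_rw [LS_diff]
  exact (doob d (b.sub_ad b' h1) (b.sub_ad b' h2) n hε).trans
    (mul_le_mul_of_nonneg_left (diff_E d b b' h1 h2 n) (by positivity))

lemma TP_diff (d : DN μ G ξ η δ) (b : BP G p) (b' : BP G p') {β₁ β₂ : ℝ} (h1 : |β₁| ≤ 1) (h2 : |β₂| ≤ 1)
    (n : ℕ) (α₁ α₂ : ℝ) {ε : ℝ} (hε : 0 < ε) :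
    TP μ (fun ω => LS (fun j ω => α₁ + β₁ * p j ω) (fun j ω => α₂ + β₂ * p j ω) ξ η n ω -
      LS (fun j ω => α₁ + β₁ * p' j ω) (fun j ω => α₂ + β₂ * p' j ω) ξ η n ω) ε ≤
      ε⁻¹ ^ 2 * (2 * (δ * ∑ j ∈ Finset.range n, ∫ ω, |p j ω - p' j ω| ∂μ)) := by
  refine le_trans (measureReal_mono ?_) (doob_diff d b b' h1 h2 n α₁ α₂ hε)
  intro ω hω
  exact ⟨n, le_rfl, hω⟩

lemma samp_BP (hY : ∀ t, 0 ≤ t → Measurable[F t] (Y t)) (hF : Monotone F) {δ : ℝ} {a : ℕ → ℝ}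
    (ha : ∀ j, 0 ≤ a j ∧ a j ≤ j * δ) : BP (fun j => F (0 + j * δ)) (fun j ω => ind (Y (a j) ω)) :=
  ⟨fun j => ind_meas.comp ((hY _ (ha j).1).mono (hF (by rw [zero_add]; exact (ha j).2)) le_rfl),
    fun j ω => ind_bd _⟩

lemma rsum_fine (H B : ℝ → Ω → ℝ) (k M n : ℕ) (ω : Ω) : rsum H B (k * (1 / 2 ^ M)) n ω =
    ∑ j ∈ Finset.range (2 ^ n * k), H ((j / k : ℕ) * (k * (1 / 2 ^ (M + n)))) ω * inc B 0 (1 / 2 ^ (M + n)) j ω := by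
  rw [← coarse_inc (fun i => H (i * (k * (1 / 2 ^ (M + n)))) ω) B (c := k * (1 / 2 ^ (M + n))) rfl (2 ^ n) ω]
  simp only [rsum]
  have e : ∀ x : ℝ, (k * (1 / 2 ^ M)) * x / 2 ^ n = x * (k * (1 / 2 ^ (M + n)) : ℝ) := by
    intro x; rw [pow_add]; field_simp
  simp only [e]

lemma LS_fine (p : ℕ → Ω → ℝ) (α₁ β₁ α₂ β₂ : ℝ) (k M n : ℕ) (ω : Ω) :
    LS (fun j ω => α₁ + β₁ * p j ω) (fun j ω => α₂ + β₂ * p j ω) (inc B₁ 0 (1 / 2 ^ M)) (inc B₂ 0 (1 / 2 ^ M)) k ω =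
    LS (fun j ω => α₁ + β₁ * p (j / 2 ^ n) ω) (fun j ω => α₂ + β₂ * p (j / 2 ^ n) ω)
      (inc B₁ 0 (1 / 2 ^ (M + n))) (inc B₂ 0 (1 / 2 ^ (M + n))) (k * 2 ^ n) ω := by
  have e : (1 / 2 ^ M : ℝ) = (2 ^ n : ℕ) * (1 / 2 ^ (M + n)) := by push_cast; rw [pow_add]; field_simp
  have e1 := coarse_inc (fun j => α₁ + β₁ * p j ω) B₁ e k ω
  have e2 := coarse_inc (fun j => α₂ + β₂ * p j ω) B₂ e k ω
  simp only [LS]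
  rw [Finset.sum_add_distrib, Finset.sum_add_distrib, ← e1, ← e2]
  simp only [inc, zero_add]

/-- times of a coarse grid -/
lemma coarse_time {r j : ℕ} {δ : ℝ} (hδ : 0 < δ) : 0 ≤ ((j / r : ℕ) : ℝ) * (r * δ) ∧
    ((j / r : ℕ) : ℝ) * (r * δ) ≤ j * δ ∧ (r ≠ 0 → j * δ - ((j / r : ℕ) : ℝ) * (r * δ) ≤ r * δ) := by
  refine ⟨by positivity, ?_, fun hr => ?_⟩
  · rw [← mul_assoc]
    refine mul_le_mul_of_nonneg_right ?_ hδ.le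
    exact_mod_cast Nat.div_mul_le_self j r
  · rw [← mul_assoc, ← sub_mul]
    refine mul_le_mul_of_nonneg_right ?_ hδ.le
    have := Nat.div_add_mod j r
    have h2 := (Nat.mod_lt j (Nat.pos_of_ne_zero hr)).le
    have h3 : (j : ℝ) = r * (j / r : ℕ) + (j % r : ℕ) := by exact_mod_cast this.symm
    have h4 : ((j % r : ℕ) : ℝ) ≤ r := by exact_mod_cast h2
    linarith

lemma small_pow {c : ℝ} (hc : 0 < c) : ∃ M0 : ℕ, ∀ M ≥ M0, (1 / 2 ^ M : ℝ) ≤ c := by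
  obtain ⟨M0, h⟩ := exists_pow_lt_of_lt_one hc (by norm_num : (1 / 2 : ℝ) < 1)
  refine ⟨M0, fun M hM => ?_⟩
  have : (1 / 2 ^ M : ℝ) ≤ 1 / 2 ^ M0 :=
    one_div_le_one_div_of_le (by positivity) (pow_le_pow_right₀ (by norm_num) hM)
  rw [one_div_pow] at h
  linarith

/-- comparison of two coarse samplings at a fine level -/
lemma NP.cf2 (h : NP μ Y) {T θ : ℝ} (hT : 0 < T) (hθ : 0 < θ) :
    ∃ M0 : ℕ, ∀ M ≥ M0, ∀ n ≥ M0, ∀ k : ℕ, k * (1 / 2 ^ M) ≤ T →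
      1 / 2 ^ (M + n) * ∑ j ∈ Finset.range (k * 2 ^ n), ∫ ω, |ind (Y ((j / k : ℕ) * (k * (1 / 2 ^ (M + n)))) ω) -
        ind (Y (j * (1 / 2 ^ (M + n))) ω)| ∂μ ≤ θ ∧
      1 / 2 ^ (M + n) * ∑ j ∈ Finset.range (k * 2 ^ n), ∫ ω, |ind (Y ((j / 2 ^ n : ℕ) * ((2 ^ n : ℕ) * (1 / 2 ^ (M + n)))) ω) -
        ind (Y (j * (1 / 2 ^ (M + n))) ω)| ∂μ ≤ θ := by
  obtain ⟨c, hc, hcf⟩ := h.cf hT hθ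
  obtain ⟨M0, hM0⟩ := small_pow (c := min c (c / T)) (by positivity)
  refine ⟨M0, fun M hM n hn k hk => ?_⟩
  have hδ : (0:ℝ) < 1 / 2 ^ (M + n) := by positivity
  have hδc : (1 / 2 ^ (M + n) : ℝ) ≤ c := (hM0 _ (by omega)).trans (min_le_left _ _)
  have hkT : ((k * 2 ^ n : ℕ) : ℝ) * (1 / 2 ^ (M + n)) ≤ T := by
    refine le_trans (le_of_eq ?_) hk
    push_cast; rw [pow_add]; field_simp
  constructor
  · refine hcf _ _ (fun j => (j / k : ℕ) * (k * (1 / 2 ^ (M + n)))) hδ hδc hkT (fun j => (coarse_time hδ).1) fun j hj => ⟨(coarse_time hδ).2.1, ?_⟩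
    have k0 : k ≠ 0 := by rintro rfl; simp at hj
    refine ((coarse_time hδ).2.2 k0).trans ?_
    have e1 : (k * (1 / 2 ^ (M + n)) : ℝ) = k * (1 / 2 ^ M) * (1 / 2 ^ n) := by rw [pow_add]; field_simp
    rw [e1]
    have := (hM0 n hn).trans (min_le_right _ _)
    calc (k * (1 / 2 ^ M) * (1 / 2 ^ n) : ℝ) ≤ T * (c / T) := mul_le_mul hk this (by positivity) hT.le
      _ = c := by field_simp
  · refine hcf _ _ (fun j => (j / 2 ^ n : ℕ) * ((2 ^ n : ℕ) * (1 / 2 ^ (M + n)))) hδ hδc hkT (fun j => (coarse_time hδ).1) fun j hj => ⟨(coarse_time hδ).2.1, ?_⟩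
    refine ((coarse_time hδ).2.2 (by positivity)).trans ?_
    have e1 : ((2 ^ n : ℕ) * (1 / 2 ^ (M + n)) : ℝ) = 1 / 2 ^ M := by push_cast; rw [pow_add]; field_simp
    rw [e1]
    exact (hM0 _ hM).trans (min_le_left _ _)

lemma sum_tri (hY : ∀ t, 0 ≤ t → Measurable (Y t)) {δ : ℝ} (hδ : 0 < δ) (n : ℕ) (a b c : ℕ → ℝ) (ha : ∀ j, 0 ≤ a j)
    (hb : ∀ j, 0 ≤ b j) (hc : ∀ j, 0 ≤ c j) :
    δ * ∑ j ∈ Finset.range n, ∫ ω, |ind (Y (a j) ω) - ind (Y (b j) ω)| ∂μ ≤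
    δ * ∑ j ∈ Finset.range n, ∫ ω, |ind (Y (a j) ω) - ind (Y (c j) ω)| ∂μ +
    δ * ∑ j ∈ Finset.range n, ∫ ω, |ind (Y (b j) ω) - ind (Y (c j) ω)| ∂μ := by
  rw [← mul_add, ← Finset.sum_add_distrib]
  refine mul_le_mul_of_nonneg_left (Finset.sum_le_sum fun j _ => ?_) hδ.le
  have i1 := ind_int (μ := μ) (hY _ (hb j)) (hY _ (ha j))
  have i2 := ind_int (μ := μ) (hY _ (hc j)) (hY _ (ha j))
  have i3 := ind_int (μ := μ) (hY _ (hc j)) (hY _ (hb j))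
  rw [← integral_add i2 i3]
  refine integral_mono i1 (iadd i2 i3) fun ω => ?_
  simp only
  rw [abs_sub_comm (ind (Y (b j) ω)) (ind (Y (c j) ω))]
  exact abs_sub_le _ _ _

/-- Riemann sums versus dyadic sampling, uniformly in the time. -/
lemma samp_close (pb : IsPlanarBM μ F B₁ B₂) (h : NP μ Y) (hY : ∀ t, 0 ≤ t → Measurable[F t] (Y t))
    {α₁ β₁ α₂ β₂ : ℝ} (h1 : |β₁| ≤ 1) (h2 : |β₂| ≤ 1) {T ε θ : ℝ} (hT : 0 < T) (hε : 0 < ε) (hθ : 0 < θ) :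
    ∃ M0 : ℕ, ∀ M ≥ M0, ∀ n ≥ M0, ∀ k : ℕ, k * (1 / 2 ^ M) ≤ T →
      TP μ (fun ω => (rsum (fun s ω => α₁ + β₁ * ind (Y s ω)) B₁ (k * (1 / 2 ^ M)) n ω +
        rsum (fun s ω => α₂ + β₂ * ind (Y s ω)) B₂ (k * (1 / 2 ^ M)) n ω) -
        LS (fun j ω => α₁ + β₁ * ind (Y (j * (1 / 2 ^ M)) ω)) (fun j ω => α₂ + β₂ * ind (Y (j * (1 / 2 ^ M)) ω))
          (inc B₁ 0 (1 / 2 ^ M)) (inc B₂ 0 (1 / 2 ^ M)) k ω) ε ≤ θ := by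
  obtain ⟨M0, hM0⟩ := h.cf2 hT (θ := ε ^ 2 * θ / 4) (by positivity)
  refine ⟨M0, fun M hM n hn k hk => ?_⟩
  have hδ : (0:ℝ) < 1 / 2 ^ (M + n) := by positivity
  obtain ⟨c1, c2⟩ := hM0 M hM n hn k hk
  have d := pb.dn le_rfl hδ
  have b1 := samp_BP (δ := 1 / 2 ^ (M + n)) hY pb.1.mono
    (a := fun j => (j / k : ℕ) * (k * (1 / 2 ^ (M + n)))) (fun j => ⟨(coarse_time hδ).1, (coarse_time hδ).2.1⟩)
  have b2 := samp_BP (δ := 1 / 2 ^ (M + n)) hY pb.1.mono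
    (a := fun j => (j / 2 ^ n : ℕ) * ((2 ^ n : ℕ) * (1 / 2 ^ (M + n)))) (fun j => ⟨(coarse_time hδ).1, (coarse_time hδ).2.1⟩)
  have := TP_diff d b1 b2 h1 h2 (k * 2 ^ n) α₁ α₂ hε
  have tri := sum_tri (μ := μ) h.ms hδ (k * 2 ^ n) (fun j => (j / k : ℕ) * (k * (1 / 2 ^ (M + n))))
    (fun j => (j / 2 ^ n : ℕ) * ((2 ^ n : ℕ) * (1 / 2 ^ (M + n)))) (fun j => j * (1 / 2 ^ (M + n)))
    (fun j => (coarse_time hδ).1) (fun j => (coarse_time hδ).1) (fun j => by positivity)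
  refine le_trans (le_of_eq ?_) (this.trans ?_)
  · congr 1
    ext ω
    rw [LS_fine (fun j ω => ind (Y (j * (1 / 2 ^ M)) ω)) α₁ β₁ α₂ β₂ k M n ω, rsum_fine, rsum_fine, mul_comm (2 ^ n) k]
    rw [← Finset.sum_add_distrib]
    have e1 : ((2 ^ n : ℕ) * (1 / 2 ^ (M + n)) : ℝ) = 1 / 2 ^ M := by push_cast; rw [pow_add]; field_simp
    simp only [e1]
    rfl
  · calc ε⁻¹ ^ 2 * (2 * _) ≤ ε⁻¹ ^ 2 * (2 * (ε ^ 2 * θ / 4 + ε ^ 2 * θ / 4)) := by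
          gcongr
          exact tri.trans (add_le_add c1 c2)
      _ = θ := by field_simp; norm_num

/-- sampled drift, uniformly in time -/
lemma drift_close (h : NP μ Y) {T ε θ : ℝ} (hT : 0 < T) (hε : 0 < ε) (hθ : 0 < θ) :
    ∃ M0 : ℕ, ∀ M ≥ M0, ∀ k : ℕ, k * (1 / 2 ^ M) ≤ T →
      TP μ (fun ω => 1 / 2 ^ M * (∑ j ∈ Finset.range k, ind (Y (j * (1 / 2 ^ M)) ω)) -
        ∫ u in (0:ℝ)..(k * (1 / 2 ^ M)), ind (Y u ω)) ε ≤ θ := by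
  obtain ⟨M0, hM0⟩ := h.cf2 hT (θ := ε / 2 * θ) (by positivity)
  refine ⟨M0, fun M hM k hk => ?_⟩
  have mS : ∀ n : ℕ, Measurable (fun ω => 1 / 2 ^ (M + n) * ∑ j ∈ Finset.range (k * 2 ^ n), ind (Y (j * (1 / 2 ^ (M + n))) ω)) :=
    fun n => measurable_const.mul (Finset.measurable_fun_sum _ fun j _ => ind_meas.comp (h.ms _ (by positivity)))
  have lim : TendstoInMeasure μ (fun (n : ℕ) ω => 1 / 2 ^ (M + n) *
      ∑ j ∈ Finset.range (k * 2 ^ n), ind (Y (j * (1 / 2 ^ (M + n))) ω)) atTop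
      (fun ω => ∫ u in (0:ℝ)..(k * (1 / 2 ^ M)), ind (Y u ω)) := by
    refine tendstoInMeasure_of_tendsto_ae (fun n => (mS n).aestronglyMeasurable) ?_
    filter_upwards [h.drift] with ω hω
    exact hω k M
  have lim2 := TP_tim lim (half_pos hε)
  have lim3 := (tendsto_const_nhds (x := θ)).add lim2
  rw [add_zero] at lim3
  refine ge_of_tendsto lim3 ?_
  filter_upwards [eventually_ge_atTop M0] with n hn
  have hδ : (0:ℝ) < 1 / 2 ^ (M + n) := by positivity
  obtain ⟨-, c2⟩ := hM0 M hM n hn k hk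
  have tri := TP_tri (μ := μ) (fun ω => 1 / 2 ^ M * (∑ j ∈ Finset.range k, ind (Y (j * (1 / 2 ^ M)) ω)))
    (fun ω => 1 / 2 ^ (M + n) * ∑ j ∈ Finset.range (k * 2 ^ n), ind (Y (j * (1 / 2 ^ (M + n))) ω))
    (fun ω => ∫ u in (0:ℝ)..(k * (1 / 2 ^ M)), ind (Y u ω)) (ε / 2) (ε / 2)
  rw [add_halves] at tri
  refine tri.trans (add_le_add ?_ le_rfl)
  have e : ∀ ω, 1 / 2 ^ M * (∑ j ∈ Finset.range k, ind (Y (j * (1 / 2 ^ M)) ω)) -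
      1 / 2 ^ (M + n) * ∑ j ∈ Finset.range (k * 2 ^ n), ind (Y (j * (1 / 2 ^ (M + n))) ω) =
      1 / 2 ^ (M + n) * ∑ j ∈ Finset.range (k * 2 ^ n), (ind (Y ((j / 2 ^ n : ℕ) * ((2 ^ n : ℕ) * (1 / 2 ^ (M + n)))) ω) -
        ind (Y (j * (1 / 2 ^ (M + n))) ω)) := by
    intro ω
    have e1 : ((2 ^ n : ℕ) * (1 / 2 ^ (M + n)) : ℝ) = 1 / 2 ^ M := by push_cast; rw [pow_add]; field_simp
    have := coarse_sum (fun j => ind (Y (j * (1 / 2 ^ M)) ω)) (fun j => j * (1 / 2 ^ (M + n)) : ℕ → ℝ) (2 ^ n) k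
    have e2 : ∀ j : ℕ, ((j + 1 : ℕ) * (1 / 2 ^ (M + n)) - j * (1 / 2 ^ (M + n)) : ℝ) = 1 / 2 ^ (M + n) := by
      intro j; push_cast; ring
    have e3 : ∀ j : ℕ, (((j + 1) * 2 ^ n : ℕ) * (1 / 2 ^ (M + n)) - (j * 2 ^ n : ℕ) * (1 / 2 ^ (M + n)) : ℝ) = 1 / 2 ^ M := by
      intro j; rw [← e1]; push_cast; ring
    simp only [e2, e3] at this
    rw [← Finset.sum_mul, ← Finset.sum_mul] at this
    rw [mul_comm, this, Finset.sum_sub_distrib, mul_sub, mul_comm, e1]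
  have md : ∀ j : ℕ, Integrable (fun ω => |ind (Y ((j / 2 ^ n : ℕ) * ((2 ^ n : ℕ) * (1 / 2 ^ (M + n)))) ω) -
        ind (Y (j * (1 / 2 ^ (M + n))) ω)|) μ := fun j =>
    ind_int (h.ms _ (by positivity)) (h.ms _ (by positivity))
  have ii : Integrable (fun ω => 1 / 2 ^ M * (∑ j ∈ Finset.range k, ind (Y (j * (1 / 2 ^ M)) ω)) -
      1 / 2 ^ (M + n) * ∑ j ∈ Finset.range (k * 2 ^ n), ind (Y (j * (1 / 2 ^ (M + n))) ω)) μ := by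
    simp only [e]
    refine Integrable.const_mul (integrable_finsetSum _ fun j _ => ?_) _
    refine bdd_int (C := 1) ((ind_meas.comp (h.ms _ (by positivity))).sub (ind_meas.comp (h.ms _ (by positivity)))) fun ω => ind_abs_one _ _
  refine (TP_L1 ii (half_pos hε)).trans ?_
  have : ∫ ω, |1 / 2 ^ M * (∑ j ∈ Finset.range k, ind (Y (j * (1 / 2 ^ M)) ω)) -
      1 / 2 ^ (M + n) * ∑ j ∈ Finset.range (k * 2 ^ n), ind (Y (j * (1 / 2 ^ (M + n))) ω)| ∂μ ≤ ε / 2 * θ := by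
    refine le_trans ?_ c2
    rw [← integral_finsetSum _ fun j _ => md j, ← integral_const_mul]
    refine integral_mono ii.abs ((integrable_finsetSum _ fun j _ => md j).const_mul _) fun ω => ?_
    simp only
    rw [e, abs_mul, abs_of_pos hδ]
    exact mul_le_mul_of_nonneg_left (Finset.abs_sum_le_sum_abs _ _) hδ.le
  calc (ε / 2)⁻¹ * _ ≤ (ε / 2)⁻¹ * (ε / 2 * θ) := mul_le_mul_of_nonneg_left this (by positivity)
    _ = θ := by field_simp

end samp

/-! ### Solutions of the difference equation -/

section dsol
variable {μ : Measure Ω} [IsProbabilityMeasure μ] {F : ℝ → MeasurableSpace Ω} {B₁ B₂ Y A : ℝ → Ω → ℝ}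
  {ρ σ lam y : ℝ}

/-- solution of the equation for the difference -/
structure DS (μ : Measure Ω) (F : ℝ → MeasurableSpace Ω) (B₁ B₂ : ℝ → Ω → ℝ) (ρ σ lam y : ℝ)
    (Y A : ℝ → Ω → ℝ) : Prop where
  ms : ∀ t, 0 ≤ t → Measurable[F t] (Y t)
  ct : ∀ᵐ ω ∂μ, Continuous fun t => Y t ω
  eq : ∀ᵐ ω ∂μ, ∀ t : ℝ, 0 ≤ t → Y t ω = y + lam * (∫ s in (0:ℝ)..t, (1 - 2 * ind (Y s ω))) + A t ω
  si : ∀ t : ℝ, 0 ≤ t → TendstoInMeasure μ (fun n ω => rsum (fun s ω => σ + (ρ - σ) * ind (Y s ω)) B₁ t n ω +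
    rsum (fun s ω => -ρ + (ρ - σ) * ind (Y s ω)) B₂ t n ω) atTop (A t)

lemma ind_ii {f : ℝ → ℝ} (hf : Continuous f) (a b : ℝ) : IntervalIntegrable (fun u => ind (f u)) volume a b := by
  refine (intervalIntegrable_const (c := (1:ℝ))).mono_fun (ind_meas.comp hf.measurable).aestronglyMeasurable
    (ae_of_all _ fun u => ?_)
  rcases ind_bd (f u) with e | e <;> simp [e]

lemma tim_cos {f : ℕ → Ω → ℝ} {V : Ω → ℝ} (h : TendstoInMeasure μ f atTop V) (hf : ∀ n, Measurable (f n))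
    (u : ℝ) {b : ℕ → ℝ} {c : ℝ} (hb : Tendsto b atTop (nhds c))
    (hl : ∀ᶠ n in atTop, |∫ ω, Real.cos (u * f n ω) ∂μ| ≤ b n) : |∫ ω, Real.cos (u * V ω) ∂μ| ≤ c := by
  obtain ⟨ns, hns, hae⟩ := h.exists_seq_tendsto_ae
  have l1 : Tendsto (fun k => ∫ ω, Real.cos (u * f (ns k) ω) ∂μ) atTop (nhds (∫ ω, Real.cos (u * V ω) ∂μ)) := by
    refine tendsto_integral_of_dominated_convergence (fun _ => 1)
      (fun k => (Real.continuous_cos.measurable.comp ((hf _).const_mul u)).aestronglyMeasurable)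
      (integrable_const 1) (fun k => ae_of_all _ fun ω => by simpa using Real.abs_cos_le_one _) ?_
    filter_upwards [hae] with ω hω
    exact (Real.continuous_cos.tendsto _).comp (hω.const_mul u)
  exact le_of_tendsto_of_tendsto l1.abs (hb.comp hns.tendsto_atTop) (hns.tendsto_atTop.eventually hl)

lemma rsum_meas {H : ℝ → Ω → ℝ} {B : ℝ → Ω → ℝ} {t : ℝ} {M : MeasurableSpace Ω} (hH : ∀ s, 0 ≤ s → s ≤ t → Measurable[M] (H s))
    (hB : ∀ s, 0 ≤ s → s ≤ t → Measurable[M] (B s)) (ht : 0 ≤ t) (n : ℕ) : Measurable[M] (rsum H B t n) := by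
  refine Finset.measurable_fun_sum _ fun i hi => ?_
  have hi : (i : ℝ) + 1 ≤ 2 ^ n := by exact_mod_cast Finset.mem_range.1 hi
  have h1 : t * (i + 1) / 2 ^ n ≤ t := by
    rw [div_le_iff₀ (by positivity)]; exact mul_le_mul_of_nonneg_left hi ht
  have h2 : t * i / 2 ^ n ≤ t * (i + 1) / 2 ^ n := by gcongr; linarith
  exact (hH _ (by positivity) (h2.trans h1)).mul ((hB _ (by positivity) h1).sub (hB _ (by positivity) (h2.trans h1)))

/-- splitting off the last dyadic block of a Riemann sum -/
lemma rsum_split (H B : ℝ → Ω → ℝ) (t : ℝ) (a q : ℕ) (ω : Ω) : rsum H B t (a + q) ω =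
    (∑ i ∈ Finset.range ((2 ^ a - 1) * 2 ^ q), H (t * i / 2 ^ (a + q)) ω *
      (B (t * (i + 1) / 2 ^ (a + q)) ω - B (t * i / 2 ^ (a + q)) ω)) +
    ∑ j ∈ Finset.range (2 ^ q), H (t * (1 - 1 / 2 ^ a) + j * (t / 2 ^ (a + q))) ω *
      inc B (t * (1 - 1 / 2 ^ a)) (t / 2 ^ (a + q)) j ω := by
  have e : 2 ^ (a + q) = (2 ^ a - 1) * 2 ^ q + 2 ^ q := by
    rw [pow_add, Nat.sub_mul, one_mul, Nat.sub_add_cancel]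
    exact Nat.le_mul_of_pos_left _ (by positivity)
  simp only [rsum, inc]
  rw [e, Finset.sum_range_add]
  congr 1
  refine Finset.sum_congr rfl fun j _ => ?_
  have e1 : (((2 ^ a - 1) * 2 ^ q + j : ℕ) : ℝ) = (2 ^ a - 1) * 2 ^ q + j := by
    push_cast [Nat.cast_sub (Nat.one_le_two_pow (n := a))]; ring
  have e2 : t * ((2 ^ a - 1) * 2 ^ q + j) / 2 ^ (a + q) = t * (1 - 1 / 2 ^ a) + j * (t / 2 ^ (a + q)) := by
    rw [pow_add]; field_simp
  have e3 : t * ((2 ^ a - 1) * 2 ^ q + j + 1) / 2 ^ (a + q) = t * (1 - 1 / 2 ^ a) + (j + 1) * (t / 2 ^ (a + q)) := by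
    rw [pow_add]; field_simp; ring
  rw [e1, e2, e3]

lemma DS.mI (h : DS μ F B₁ B₂ ρ σ lam y Y A) (hF : Monotone F) {s t : ℝ} (hs : 0 ≤ s) (hst : s ≤ t) (α β : ℝ) :
    Measurable[F t] (fun ω => α + β * ind (Y s ω)) :=
  measurable_const.add (measurable_const.mul (ind_meas.comp ((h.ms s hs).mono (hF hst) le_rfl)))

lemma DS.cosb (pb : IsPlanarBM μ F B₁ B₂) (pr : PR ρ σ lam) (h : DS μ F B₁ B₂ ρ σ lam y Y A) {t : ℝ} (ht : 0 < t)
    (a : ℕ) (u : ℝ) :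
    |∫ ω, Real.cos (u * (Y (t * (1 - 1 / 2 ^ a)) ω - A (t * (1 - 1 / 2 ^ a)) ω + A t ω)) ∂μ| ≤
      Real.exp (-(t / 2 ^ a / 2 * u ^ 2)) := by
  set s := t * (1 - 1 / 2 ^ a) with hs
  have hF := pb.1.mono
  have ha1 : (1 : ℝ) / 2 ^ a ≤ 1 := by
    rw [div_le_one (by positivity)]; exact one_le_pow₀ (by norm_num)
  have hs0 : 0 ≤ s := mul_nonneg ht.le (by linarith)
  have hst : s ≤ t := by
    have : (0:ℝ) ≤ 1 / 2 ^ a := by positivity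
    rw [hs]; nlinarith
  set RA : ℝ → ℕ → Ω → ℝ := fun t n ω => rsum (fun s ω => σ + (ρ - σ) * ind (Y s ω)) B₁ t n ω +
    rsum (fun s ω => -ρ + (ρ - σ) * ind (Y s ω)) B₂ t n ω with hRA
  have mRA : ∀ r, 0 ≤ r → ∀ n, Measurable[F r] (RA r n) := fun r hr n =>
    (rsum_meas (fun s a b => h.mI hF a b _ _) (fun s a b => pb.1.meas a b) hr n).add
    (rsum_meas (fun s a b => h.mI hF a b _ _) (fun s a b => pb.2.1.meas a b) hr n)
  have tim : TendstoInMeasure μ (fun q ω => Y s ω - RA s (a + q) ω + RA t (a + q) ω) atTop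
      (fun ω => Y s ω - A s ω + A t ω) := by
    refine tim_TP fun ε hε => ?_
    have l1 := TP_tim (h.si s hs0) (half_pos hε)
    have l2 := TP_tim (h.si t ht.le) (half_pos hε)
    have := (l1.add l2).comp (tendsto_add_atTop_nat a)
    rw [add_zero] at this
    refine squeeze_zero (fun _ => TP_nonneg _ _) (fun q => ?_) this
    have := TP_add (μ := μ) (fun ω => A s ω - RA s (a + q) ω) (fun ω => RA t (a + q) ω - A t ω) (ε / 2) (ε / 2)
    rw [add_halves, TP_comm (A s)] at this
    simp only [Function.comp]
    rw [add_comm q a]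
    refine le_trans (le_of_eq ?_) this
    congr 1; ext ω; ring
  set δ : ℕ → ℝ := fun q => t / 2 ^ (a + q) with hδ
  have δ0 : ∀ q, 0 < δ q := fun q => by positivity
  have δl : Tendsto δ atTop (nhds 0) := by
    have : Tendsto (fun q : ℕ => t / 2 ^ a * (1 / 2 : ℝ) ^ q) atTop (nhds (t / 2 ^ a * 0)) :=
      (tendsto_pow_atTop_nhds_zero_of_lt_one (by norm_num) (by norm_num)).const_mul _
    rw [mul_zero] at this
    refine this.congr fun q => ?_
    simp only [hδ]; rw [pow_add, one_div_pow]; field_simp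
  have ηe : ∀ q : ℕ, ((2 ^ q : ℕ) : ℝ) * δ q = t / 2 ^ a := by
    intro q; simp only [hδ]; push_cast; rw [pow_add]; field_simp
  have lim : Tendsto (fun q => Real.exp (-(t / 2 ^ a / 2 * u ^ 2)) + (3 * CI 0 * (t / 2 ^ a) + 1) * √(δ q) * (1 + u ^ 4))
      atTop (nhds (Real.exp (-(t / 2 ^ a / 2 * u ^ 2)))) := by
    have := ((((Real.continuous_sqrt.tendsto 0).comp δl).const_mul (3 * CI 0 * (t / 2 ^ a) + 1)).mul_const
      (1 + u ^ 4)).const_add (Real.exp (-(t / 2 ^ a / 2 * u ^ 2)))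
    rw [Real.sqrt_zero, mul_zero, zero_mul, add_zero] at this
    exact this
  refine tim_cos tim (fun q => ?_) u lim ?_
  · exact (((h.ms s hs0).mono (pb.1.le _) le_rfl).sub ((mRA s hs0 _).mono (pb.1.le _) le_rfl)).add
      ((mRA t ht.le _).mono (pb.1.le _) le_rfl)
  filter_upwards [δl.eventually_le_const (by norm_num : (0:ℝ) < 1)] with q hq
  have d := pb.dn hs0 (δ0 q)
  have a1 : ∀ α : ℝ, |α| ≤ 1 → |α + (ρ - σ)| ≤ 1 → AD (fun j : ℕ => F (s + j * δ q)) (fun j ω => α + (ρ - σ) * ind (Y (s + j * δ q) ω)) 1 := by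
    intro α hα hα2
    refine ⟨fun j => h.mI hF (by have := δ0 q; positivity) le_rfl _ _, fun j ω => ?_⟩
    rcases ind_bd (Y (s + j * δ q) ω) with e | e <;> rw [e]
    · simpa using hα
    · simpa using hα2
  have r0 := pr.r0
  have r1 := pr.r1
  have s0 := pr.s0
  have s1 := pr.s1
  have ad1 := a1 σ (by rw [abs_of_nonneg s0]; exact s1) (by rw [abs_le]; constructor <;> linarith)
  have ad2 := a1 (-ρ) (by rw [abs_neg, abs_of_nonneg r0]; exact r1) (by rw [abs_le]; constructor <;> linarith)
  set V0 : Ω → ℝ := fun ω => Y s ω - RA s (a + q) ω +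
    ((∑ i ∈ Finset.range ((2 ^ a - 1) * 2 ^ q), (σ + (ρ - σ) * ind (Y (t * i / 2 ^ (a + q)) ω)) *
      (B₁ (t * (i + 1) / 2 ^ (a + q)) ω - B₁ (t * i / 2 ^ (a + q)) ω)) +
    (∑ i ∈ Finset.range ((2 ^ a - 1) * 2 ^ q), (-ρ + (ρ - σ) * ind (Y (t * i / 2 ^ (a + q)) ω)) *
      (B₂ (t * (i + 1) / 2 ^ (a + q)) ω - B₂ (t * i / 2 ^ (a + q)) ω))) with hV0
  have mV0 : Measurable[F (s + (0:ℕ) * δ q)] V0 := by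
    rw [Nat.cast_zero, zero_mul, add_zero]
    have ti : ∀ i ∈ Finset.range ((2 ^ a - 1) * 2 ^ q), t * (i + 1) / 2 ^ (a + q) ≤ s ∧ t * i / 2 ^ (a + q) ≤ s := by
      intro i hi
      have hi' : i + 1 ≤ (2 ^ a - 1) * 2 ^ q := Finset.mem_range.1 hi
      have hi'' : (i : ℝ) + 1 ≤ (2 ^ a - 1) * 2 ^ q := by
        have : ((i + 1 : ℕ) : ℝ) ≤ (((2 ^ a - 1) * 2 ^ q : ℕ) : ℝ) := by exact_mod_cast hi'
        push_cast [Nat.cast_sub (Nat.one_le_two_pow (n := a))] at this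
        exact this
      have es : s = t * ((2 ^ a - 1) * 2 ^ q) / 2 ^ (a + q) := by
        rw [hs, pow_add]; field_simp
      rw [es]
      constructor
      · gcongr
      · gcongr; linarith
    refine ((h.ms s hs0).sub (mRA s hs0 _)).add (Measurable.add ?_ ?_)
    · exact Finset.measurable_fun_sum _ fun i hi => (h.mI hF (by positivity) (ti i hi).2 _ _).mul
        ((pb.1.meas (by positivity) (ti i hi).1).sub (pb.1.meas (by positivity) (ti i hi).2))
    · exact Finset.measurable_fun_sum _ fun i hi => (h.mI hF (by positivity) (ti i hi).2 _ _).mul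
        ((pb.2.1.meas (by positivity) (ti i hi).1).sub (pb.2.1.meas (by positivity) (ti i hi).2))
  have cb := cos_bound d hq mV0 ad1 ad2 (fun j ω => by
    rcases ind_bd (Y (s + j * δ q) ω) with e | e <;> rw [e] <;> nlinarith [pr.nm]) u (2 ^ q)
  rw [ηe] at cb
  refine le_trans (le_of_eq ?_) cb
  congr 2
  ext ω
  congr 2
  simp only [hRA]
  rw [rsum_split _ _ t, rsum_split _ _ t]
  simp only [hV0, LS, hRA]
  rw [Finset.sum_add_distrib]
  ring

lemma DS.ac1 (pb : IsPlanarBM μ F B₁ B₂) (pr : PR ρ σ lam) (h : DS μ F B₁ B₂ ρ σ lam y Y A) {t ε : ℝ} (ht : 0 < t)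
    (a : ℕ) (hε : 0 < ε) (hε' : ε ≤ t / 2 ^ a) :
    μ.real {ω | |Y t ω| ≤ ε} ≤ 2 * (1 + lam) * √(t / 2 ^ a) := by
  set s := t * (1 - 1 / 2 ^ a) with hs
  have hl := pr.l0
  have hη : 0 < t / 2 ^ a := by positivity
  have ha1 : (1 : ℝ) / 2 ^ a ≤ 1 := by
    rw [div_le_one (by positivity)]; exact one_le_pow₀ (by norm_num)
  have hs0 : 0 ≤ s := mul_nonneg ht.le (by linarith)
  have hts : t - s = t / 2 ^ a := by rw [hs]; ring
  have mr : ∀ r, 0 ≤ r → ∀ n, Measurable (fun ω => rsum (fun s ω => σ + (ρ - σ) * ind (Y s ω)) B₁ r n ω +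
    rsum (fun s ω => -ρ + (ρ - σ) * ind (Y s ω)) B₂ r n ω) := fun r hr n => by
    refine Measurable.mono (ma := F r) ?_ (pb.1.le r) le_rfl
    exact (rsum_meas (fun s a b => h.mI pb.1.mono a b _ _) (fun s a b => pb.1.meas a b) hr n).add
      (rsum_meas (fun s a b => h.mI pb.1.mono a b _ _) (fun s a b => pb.2.1.meas a b) hr n)
  have mA : ∀ r, 0 ≤ r → AEMeasurable (A r) μ := fun r hr =>
    (h.si r hr).aemeasurable fun n => (mr r hr n).aemeasurable
  have mV : AEMeasurable (fun ω => Y s ω - A s ω + A t ω) μ :=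
    (((h.ms s hs0).mono (pb.1.le _) le_rfl).aemeasurable.sub (mA s hs0)).add (mA t ht.le)
  have ac := anticonc (V := mV.mk) (μ := μ) mV.measurable_mk (ε := ε + lam * (t / 2 ^ a)) (η := t / 2 ^ a) (E := 0)
    (by positivity) hη le_rfl (fun u => by
      have := h.cosb pb pr ht a u
      rw [zero_mul, add_zero]
      refine le_trans (le_of_eq ?_) this
      congr 1
      refine integral_congr_ae ?_
      filter_upwards [mV.ae_eq_mk] with ω hω
      rw [← hω])
  rw [zero_mul, add_zero] at ac
  have step : μ.real {ω | |Y t ω| ≤ ε} ≤ μ.real {ω | |mV.mk _ ω| ≤ ε + lam * (t / 2 ^ a)} := by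
    refine ENNReal.toReal_mono (measure_ne_top _ _) (measure_mono_ae ?_)
    filter_upwards [mV.ae_eq_mk, h.eq, h.ct] with ω hω he hc
    intro (hY : |Y t ω| ≤ ε)
    change |mV.mk _ ω| ≤ _
    rw [← hω]
    have e1 := he t ht.le
    have e2 := he s hs0
    have ii : ∀ p q, IntervalIntegrable (fun u => 1 - 2 * ind (Y u ω)) volume p q := fun p q =>
      intervalIntegrable_const.sub ((ind_ii hc p q).const_mul 2)
    have e3 := intervalIntegral.integral_add_adjacent_intervals (ii 0 s) (ii s t)
    have b : ‖∫ u in s..t, (1 - 2 * ind (Y u ω))‖ ≤ 1 * |t - s| := by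
      refine intervalIntegral.norm_integral_le_of_norm_le_const fun u _ => ?_
      rcases ind_bd (Y u ω) with e | e <;> rw [e] <;> norm_num
    rw [hts, abs_of_pos hη, one_mul, Real.norm_eq_abs] at b
    have e4 : Y s ω - A s ω + A t ω = Y t ω - lam * ∫ u in s..t, (1 - 2 * ind (Y u ω)) := by
      rw [e1, e2, ← e3]; ring
    rw [e4]
    refine (abs_sub _ _).trans (add_le_add hY ?_)
    rw [abs_mul, abs_of_nonneg hl]
    exact mul_le_mul_of_nonneg_left b hl
  refine step.trans (ac.trans ?_)
  have hsq := Real.mul_self_sqrt hη.le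
  have hsp := Real.sqrt_pos.2 hη
  calc 2 * ((ε + lam * (t / 2 ^ a)) / √(t / 2 ^ a)) ≤ 2 * ((t / 2 ^ a + lam * (t / 2 ^ a)) / √(t / 2 ^ a)) := by gcongr
    _ = 2 * (1 + lam) * √(t / 2 ^ a) := by
      have : t / 2 ^ a + lam * (t / 2 ^ a) = (1 + lam) * √(t / 2 ^ a) * √(t / 2 ^ a) := by rw [mul_assoc, hsq]; ring
      rw [this, mul_div_assoc, div_self hsp.ne']; ring

lemma DS.np (pb : IsPlanarBM μ F B₁ B₂) (pr : PR ρ σ lam) (h : DS μ F B₁ B₂ ρ σ lam y Y A) : NP μ Y := by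
  refine ⟨fun t ht => (h.ms t ht).mono (pb.1.le _) le_rfl, h.ct, fun T κ θ hκ hθ => ?_⟩
  have hl := pr.l0
  have lim : Tendsto (fun a : ℕ => 2 * (1 + lam) * √(T / 2 ^ a)) atTop (nhds 0) := by
    have : Tendsto (fun a : ℕ => T / 2 ^ a) atTop (nhds 0) := by
      have : Tendsto (fun q : ℕ => T * (1 / 2 : ℝ) ^ q) atTop (nhds (T * 0)) :=
        (tendsto_pow_atTop_nhds_zero_of_lt_one (by norm_num) (by norm_num)).const_mul _
      rw [mul_zero] at this
      refine this.congr fun q => ?_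
      rw [one_div_pow]; ring
    have := ((Real.continuous_sqrt.tendsto 0).comp this).const_mul (2 * (1 + lam))
    rw [Real.sqrt_zero, mul_zero] at this
    exact this
  obtain ⟨a, ha⟩ := (lim.eventually_le_const hθ).exists
  refine ⟨κ / 2 ^ a, by positivity, fun u h1 h2 => ?_⟩
  refine (h.ac1 pb pr (hκ.trans_le h1) a (by positivity) (by gcongr)).trans (le_trans ?_ ha)
  gcongr

end dsol

/-! ### Pathwise uniqueness -/

section uniq
variable {μ : Measure Ω} [IsProbabilityMeasure μ] {F : ℝ → MeasurableSpace Ω} {B₁ B₂ Y A Y' A' : ℝ → Ω → ℝ}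
  {ρ σ lam y : ℝ}

lemma PR.rs {ρ σ lam : ℝ} (pr : PR ρ σ lam) : |ρ - σ| ≤ 1 := by
  have r0 := pr.r0
  have r1 := pr.r1
  have s0 := pr.s0
  have s1 := pr.s1
  rw [abs_le]; constructor <;> linarith

lemma dyad_up (k L q : ℕ) : ((k * 2 ^ q : ℕ) : ℝ) * (1 / 2 ^ (L + q)) = k * (1 / 2 ^ L) := by
  rw [pow_add]; push_cast; field_simp

lemma TP_cmul {Z : Ω → ℝ} {c C ε : ℝ} (hc : |c| ≤ C) (hC : 0 < C) : TP μ (fun ω => c * Z ω) ε ≤ TP μ Z (ε / C) := by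
  refine measureReal_mono fun ω hω => ?_
  simp only [mem_setOf_eq] at hω ⊢
  rw [div_le_iff₀ hC]
  rw [abs_mul] at hω
  nlinarith [abs_nonneg (Z ω)]

lemma TP_congr {Z W : Ω → ℝ} (h : Z =ᵐ[μ] W) (ε : ℝ) : TP μ Z ε = TP μ W ε := by
  refine measureReal_congr ?_
  filter_upwards [h] with ω hω
  change (ε ≤ |Z ω|) = (ε ≤ |W ω|)
  rw [hω]

lemma YS_eq (p ξ η : ℕ → Ω → ℝ) (δ : ℝ) (k : ℕ) (ω : Ω) : YS ρ σ lam y p ξ η δ k ω =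
    y + lam * (k * δ) - 2 * lam * (δ * ∑ j ∈ Finset.range k, p j ω) +
      LS (fun j ω => σ + (ρ - σ) * p j ω) (fun j ω => -ρ + (ρ - σ) * p j ω) ξ η k ω := by
  simp only [YS]
  rw [PS_eq_LS]
  have e1 : ∑ j ∈ Finset.range k, lam * (1 - 2 * p j ω) * δ = lam * (k * δ) - 2 * lam * (δ * ∑ j ∈ Finset.range k, p j ω) := by
    rw [Finset.mul_sum, Finset.mul_sum]
    have : lam * (k * δ) = ∑ j ∈ Finset.range k, lam * δ := by
      rw [Finset.sum_const, Finset.card_range, nsmul_eq_mul]; ring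
    rw [this, ← Finset.sum_sub_distrib]
    exact Finset.sum_congr rfl fun j _ => by ring
  have e2 : (fun (j : ℕ) ω => -Ha σ ρ (p j ω)) = fun j ω => -ρ + (ρ - σ) * p j ω := by
    ext j ω; simp only [Ha]; ring
  rw [e1, e2]
  simp only [Ha]
  ring

lemma DS.close (pb : IsPlanarBM μ F B₁ B₂) (pr : PR ρ σ lam) (h : DS μ F B₁ B₂ ρ σ lam y Y A) {T ε θ : ℝ}
    (hT : 0 < T) (hε : 0 < ε) (hθ : 0 < θ) :
    ∃ M0 : ℕ, ∀ M ≥ M0, ∀ k : ℕ, k * (1 / 2 ^ M) ≤ T →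
      TP μ (fun ω => YS ρ σ lam y (fun j ω => ind (Y (j * (1 / 2 ^ M)) ω)) (inc B₁ 0 (1 / 2 ^ M)) (inc B₂ 0 (1 / 2 ^ M))
        (1 / 2 ^ M) k ω - Y (k * (1 / 2 ^ M)) ω) ε ≤ θ := by
  have np := h.np pb pr
  have hl := pr.l0
  have C0 : 0 < 2 * lam + 1 := by positivity
  obtain ⟨M1, h1⟩ := drift_close np hT (ε := ε / 3 / (2 * lam + 1)) (θ := θ / 2) (by positivity) (by positivity)
  obtain ⟨M2, h2⟩ := samp_close pb np h.ms pr.rs pr.rs (α₁ := σ) (α₂ := -ρ) hT (ε := ε / 3) (θ := θ / 2)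
    (by positivity) (by positivity)
  refine ⟨max M1 M2, fun M hM k hk => ?_⟩
  have h1 := h1 M ((le_max_left _ _).trans hM) k hk
  have hk0 : (0:ℝ) ≤ k * (1 / 2 ^ M) := by positivity
  have lim := TP_tim (h.si _ hk0) (ε := ε / 3) (by positivity)
  have lim := lim.const_add θ
  rw [add_zero] at lim
  refine ge_of_tendsto lim ?_
  filter_upwards [eventually_ge_atTop M2] with n hn
  have h2 := h2 M ((le_max_right _ _).trans hM) n hn k hk
  have h3 := (TP_cmul (μ := μ) (c := -(2 * lam)) (C := 2 * lam + 1) (ε := ε / 3) (by rw [abs_neg, abs_of_nonneg (by positivity)]; linarith) C0).trans h1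
  rw [TP_comm] at h2
  have t1 := TP_add (μ := μ) _ _ _ _ |>.trans (add_le_add h3 h2)
  have t2 := TP_add (μ := μ) _ (fun ω => (rsum (fun s ω => σ + (ρ - σ) * ind (Y s ω)) B₁ (k * (1 / 2 ^ M)) n ω +
        rsum (fun s ω => -ρ + (ρ - σ) * ind (Y s ω)) B₂ (k * (1 / 2 ^ M)) n ω) - A (k * (1 / 2 ^ M)) ω) _ (ε / 3)
     |>.trans (add_le_add_left t1 _)
  rw [add_halves, show ε / 3 + ε / 3 + ε / 3 = ε by ring] at t2
  refine le_trans (le_of_eq ?_) t2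
  refine TP_congr ?_ _
  filter_upwards [h.eq, h.ct] with ω he hc
  rw [he _ hk0, YS_eq, intervalIntegral.integral_sub intervalIntegrable_const ((ind_ii hc _ _).const_mul 2),
    intervalIntegral.integral_const_mul]
  simp only [intervalIntegral.integral_const, smul_eq_mul]
  ring

lemma sqrt_small {τ : ℝ} (hτ : 0 < τ) : ∃ M0 : ℕ, ∀ M ≥ M0, √(1 / 2 ^ M : ℝ) ≤ τ := by
  obtain ⟨M0, h⟩ := small_pow (c := τ ^ 2) (by positivity)
  refine ⟨M0, fun M hM => ?_⟩
  rw [Real.sqrt_le_left hτ.le]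
  exact h M hM

lemma DS.mis (pb : IsPlanarBM μ F B₁ B₂) (pr : PR ρ σ lam) (h : DS μ F B₁ B₂ ρ σ lam y Y A) {T τ : ℝ}
    (hT : 0 < T) (hτ : 0 < τ) :
    ∃ M0 : ℕ, ∀ M ≥ M0, ∀ n : ℕ, n * (1 / 2 ^ M) ≤ T →
      Mis μ (fun j ω => ind (Y (j * (1 / 2 ^ M)) ω)) (YS ρ σ lam y (fun j ω => ind (Y (j * (1 / 2 ^ M)) ω))
        (inc B₁ 0 (1 / 2 ^ M)) (inc B₂ 0 (1 / 2 ^ M)) (1 / 2 ^ M)) (1 / 2 ^ M) n ≤ τ := by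
  obtain ⟨ε, hε, θ, hθ, cz⟩ := (h.np pb pr).cz hT hτ
  obtain ⟨M1, h1⟩ := h.close pb pr hT hε hθ
  obtain ⟨M2, h2⟩ := small_pow hθ
  refine ⟨max M1 M2, fun M hM n hn => ?_⟩
  have hδ : (0:ℝ) < 1 / 2 ^ M := by positivity
  have d := pb.dn le_rfl hδ
  have b := samp_BP (δ := 1 / 2 ^ M) h.ms pb.1.mono (a := fun j => j * (1 / 2 ^ M)) (fun j => ⟨by positivity, le_rfl⟩)
  have := cz (1 / 2 ^ M) n _ hδ (h2 M ((le_max_right _ _).trans hM)) hn (fun j => d.mL (YS_meas (y := y) d pr b j))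
    (fun j hj => h1 M ((le_max_left _ _).trans hM) j (le_trans (by gcongr) hn))
  refine le_trans (le_of_eq ?_) this
  rw [Mis]
  simp_rw [abs_sub_comm]

lemma DS.uniq_dyad (pb : IsPlanarBM μ F B₁ B₂) (pr : PR ρ σ lam) (h : DS μ F B₁ B₂ ρ σ lam y Y A)
    (h' : DS μ F B₁ B₂ ρ σ lam y Y' A') (k L : ℕ) : ∀ᵐ ω ∂μ, Y (k * (1 / 2 ^ L)) ω = Y' (k * (1 / 2 ^ L)) ω := by
  set t : ℝ := k * (1 / 2 ^ L) with ht
  have ht0 : 0 ≤ t := by positivity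
  have key : ∀ γ > 0, TP μ (fun ω => Y t ω - Y' t ω) γ = 0 := by
    intro γ hγ
    refine le_antisymm (le_of_forall_pos_le_add fun κ hκ => ?_) (TP_nonneg _ _)
    rw [zero_add]
    obtain ⟨τ, hτ, st⟩ := stab (μ := μ) pr (T := t + 1) (γ := γ / 3) (κ := κ / 3) (by positivity) (by positivity) (by positivity)
    obtain ⟨M1, h1⟩ := h.mis pb pr (T := t + 1) (by positivity) hτ
    obtain ⟨M2, h2⟩ := h'.mis pb pr (T := t + 1) (by positivity) hτ
    obtain ⟨M3, h3⟩ := h.close pb pr (T := t + 1) (ε := γ / 3) (θ := κ / 3) (by positivity) (by positivity) (by positivity)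
    obtain ⟨M4, h4⟩ := h'.close pb pr (T := t + 1) (ε := γ / 3) (θ := κ / 3) (by positivity) (by positivity) (by positivity)
    obtain ⟨M5, h5⟩ := sqrt_small hτ
    set q := M1 + M2 + M3 + M4 + M5 with hq
    set M := L + q with hM
    have hδ : (0:ℝ) < 1 / 2 ^ M := by positivity
    have d := pb.dn le_rfl hδ
    have b := samp_BP (δ := 1 / 2 ^ M) h.ms pb.1.mono (a := fun j => j * (1 / 2 ^ M)) (fun j => ⟨by positivity, le_rfl⟩)
    have b' := samp_BP (δ := 1 / 2 ^ M) h'.ms pb.1.mono (a := fun j => j * (1 / 2 ^ M)) (fun j => ⟨by positivity, le_rfl⟩)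
    have te : ((k * 2 ^ q : ℕ) : ℝ) * (1 / 2 ^ M) = t := dyad_up k L q
    have tT : ((k * 2 ^ q : ℕ) : ℝ) * (1 / 2 ^ M) ≤ t + 1 := by rw [te]; linarith
    have g0 := st _ _ _ _ _ _ y (k * 2 ^ q) d b b' tT (h5 M (by omega)) (h1 M (by omega) _ tT) (h2 M (by omega) _ tT)
    have g1 := h3 M (by omega) _ tT
    have g2 := h4 M (by omega) _ tT
    rw [te] at g1 g2
    rw [TP_comm] at g1
    have t1 := (TP_tri (μ := μ) _ _ _ _ _).trans (add_le_add g1 g0)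
    have t2 := (TP_tri (μ := μ) _ _ _ _ _).trans (add_le_add t1 g2)
    rwa [show γ / 3 + γ / 3 + γ / 3 = γ by ring, show κ / 3 + κ / 3 + κ / 3 = κ by ring] at t2
  have : ∀ᵐ ω ∂μ, ∀ n : ℕ, |Y t ω - Y' t ω| < 1 / (n + 1) := by
    rw [ae_all_iff]
    intro n
    have := key (1 / (n + 1)) (by positivity)
    rw [TP, measureReal_eq_zero_iff] at this
    rw [ae_iff]
    simpa only [not_lt] using this
  filter_upwards [this] with ω hω
  have : |Y t ω - Y' t ω| ≤ 0 := ge_of_tendsto tendsto_one_div_add_atTop_nhds_zero_nat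
    (Eventually.of_forall fun n => (hω n).le)
  exact sub_eq_zero.1 (abs_nonpos_iff.1 this)

lemma indist {X X' : ℝ → Ω → ℝ} (hc : ∀ᵐ ω ∂μ, Continuous fun t => X t ω) (hc' : ∀ᵐ ω ∂μ, Continuous fun t => X' t ω)
    (h : ∀ k L : ℕ, ∀ᵐ ω ∂μ, X (k * (1 / 2 ^ L)) ω = X' (k * (1 / 2 ^ L)) ω) :
    ∀ᵐ ω ∂μ, ∀ t : ℝ, 0 ≤ t → X t ω = X' t ω := by
  filter_upwards [hc, hc', ae_all_iff.2 fun k => ae_all_iff.2 (h k)] with ω h1 h2 h3 t ht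
  have f := floor_tendsto t ht
  refine tendsto_nhds_unique ((h1.tendsto t).comp f) (((h2.tendsto t).comp f).congr fun L => ?_)
  exact (h3 _ _).symm

lemma ind_if (a b α β : ℝ) : (if a ≤ b then α else β) = α + (β - α) * ind (a - b) := by
  unfold ind
  by_cases h : a ≤ b
  · rw [if_pos h, if_pos (by linarith)]; ring
  · rw [if_neg h, if_neg (by linarith)]; ring

lemma rsum_neg (H B : ℝ → Ω → ℝ) (t : ℝ) (n : ℕ) (ω : Ω) : rsum (fun s ω => -H s ω) B t n ω = -rsum H B t n ω := by
  simp only [rsum]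
  rw [← Finset.sum_neg_distrib]
  exact Finset.sum_congr rfl fun i _ => by ring

lemma Solves11.ds {g h x₁ x₂ : ℝ} {X₁ X₂ : ℝ → Ω → ℝ} (s : Solves11 μ F g h ρ σ x₁ x₂ B₁ B₂ X₁ X₂) :
    ∃ A, DS μ F B₁ B₂ ρ σ (g + h) (x₁ - x₂) (fun t ω => X₁ t ω - X₂ t ω) A := by
  obtain ⟨ad, ct, I₁, I₂, s1, s2, eq⟩ := s
  refine ⟨fun t ω => I₁ t ω - I₂ t ω, ⟨fun t ht => ?_, ?_, ?_, fun t ht => ?_⟩⟩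
  · have : Measurable[F t] (fun ω => (X₁ t ω, X₂ t ω)) := Measurable.of_comap_le (ad t ht)
    exact (measurable_fst.comp this).sub (measurable_snd.comp this)
  · filter_upwards [ct] with ω hω
    exact hω.1.sub hω.2
  · filter_upwards [eq, ct] with ω hω hc t ht
    obtain ⟨e1, e2⟩ := hω t ht
    have ii : IntervalIntegrable (fun u => ind (X₁ u ω - X₂ u ω)) volume 0 t := ind_ii (hc.1.sub hc.2) 0 t
    rw [e1, e2]
    simp only [ind_if]
    rw [intervalIntegral.integral_add intervalIntegrable_const (ii.const_mul _),
      intervalIntegral.integral_add intervalIntegrable_const (ii.const_mul _),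
      intervalIntegral.integral_sub intervalIntegrable_const (ii.const_mul _)]
    simp only [intervalIntegral.integral_const_mul, intervalIntegral.integral_const, smul_eq_mul]
    ring
  · refine tim_TP fun ε hε => ?_
    have l := (TP_tim (s1.2 t ht) (half_pos hε)).add (TP_tim (s2.2 t ht) (half_pos hε))
    rw [add_zero] at l
    refine squeeze_zero (fun _ => TP_nonneg _ _) (fun n => ?_) l
    rw [TP_comm _ (I₂ t)]
    refine le_trans (le_of_eq ?_) (TP_add _ _ _ _)
    rw [add_halves]
    congr 1
    ext ω
    simp only [ind_if]
    have : rsum (fun s ω => -ρ + (ρ - σ) * ind (X₁ s ω - X₂ s ω)) B₂ t n ω =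
        - rsum (fun s ω => ρ + (σ - ρ) * ind (X₁ s ω - X₂ s ω)) B₂ t n ω := by
      rw [← rsum_neg]
      congr 1; ext s ω; ring
    rw [this]
    ring

lemma SI_eq {H H' B I I' : ℝ → Ω → ℝ} (h : IsSI μ H B I) (h' : IsSI μ H' B I')
    (e : ∀ᵐ ω ∂μ, ∀ t : ℝ, 0 ≤ t → H t ω = H' t ω) {t : ℝ} (ht : 0 ≤ t) : I t =ᵐ[μ] I' t := by
  have := h.2 t ht
  refine tendstoInMeasure_ae_unique this ((h'.2 t ht).congr (fun n => ?_) EventuallyEq.rfl)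
  filter_upwards [e] with ω hω
  simp only [rsum]
  exact Finset.sum_congr rfl fun i _ => by rw [hω _ (by positivity)]

lemma Solves11.unique {g h x₁ x₂ : ℝ} {X₁ X₂ X₁' X₂' : ℝ → Ω → ℝ} (pb : IsPlanarBM μ F B₁ B₂) (pr : PR ρ σ (g + h))
    (s : Solves11 μ F g h ρ σ x₁ x₂ B₁ B₂ X₁ X₂) (s' : Solves11 μ F g h ρ σ x₁ x₂ B₁ B₂ X₁' X₂') :
    ∀ᵐ ω ∂μ, ∀ t : ℝ, 0 ≤ t → X₁ t ω = X₁' t ω ∧ X₂ t ω = X₂' t ω := by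
  obtain ⟨A, ds⟩ := s.ds
  obtain ⟨A', ds'⟩ := s'.ds
  have uY := indist ds.ct ds'.ct (ds.uniq_dyad pb pr ds')
  obtain ⟨ad, ct, I₁, I₂, s1, s2, eq⟩ := s
  obtain ⟨ad', ct', I₁', I₂', s1', s2', eq'⟩ := s'
  have uH : ∀ α β : ℝ, ∀ᵐ ω ∂μ, ∀ t : ℝ, 0 ≤ t → (if X₁ t ω ≤ X₂ t ω then α else β) = if X₁' t ω ≤ X₂' t ω then α else β := by
    intro α β
    filter_upwards [uY] with ω hω t ht
    rw [ind_if, ind_if, hω t ht]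
  have ud : ∀ α β : ℝ, ∀ᵐ ω ∂μ, ∀ t : ℝ, 0 ≤ t → (∫ s in (0:ℝ)..t, (if X₁ s ω ≤ X₂ s ω then α else β)) =
      ∫ s in (0:ℝ)..t, (if X₁' s ω ≤ X₂' s ω then α else β) := by
    intro α β
    filter_upwards [uH α β] with ω hω t ht
    refine intervalIntegral.integral_congr fun u hu => ?_
    rw [uIcc_of_le ht] at hu
    exact hω u hu.1
  have e1 : ∀ t : ℝ, 0 ≤ t → ∀ᵐ ω ∂μ, X₁ t ω = X₁' t ω := by
    intro t ht
    filter_upwards [SI_eq s1 s1' (uH _ _) ht, eq, eq', ud g (-h)] with ω a1 a2 a3 a4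
    rw [(a2 t ht).1, (a3 t ht).1, a4 t ht, a1]
  have e2 : ∀ t : ℝ, 0 ≤ t → ∀ᵐ ω ∂μ, X₂ t ω = X₂' t ω := by
    intro t ht
    filter_upwards [SI_eq s2 s2' (uH _ _) ht, eq, eq', ud (-h) g] with ω a1 a2 a3 a4
    rw [(a2 t ht).2, (a3 t ht).2, a4 t ht, a1]
  have f1 := indist (ct.mono fun ω hω => hω.1) (ct'.mono fun ω hω => hω.1) fun k L => e1 _ (by positivity)
  have f2 := indist (ct.mono fun ω hω => hω.2) (ct'.mono fun ω hω => hω.2) fun k L => e2 _ (by positivity)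
  filter_upwards [f1, f2] with ω a b t ht
  exact ⟨a t ht, b t ht⟩

end uniq

/-! ### Euler schemes -/

/-- Euler scheme for the difference -/
def EU (ρ σ lam y : ℝ) (ξ η : ℕ → Ω → ℝ) (δ : ℝ) : ℕ → Ω → ℝ
  | 0 => fun _ => y
  | k + 1 => fun ω => EU ρ σ lam y ξ η δ k ω + (lam * (1 - 2 * ind (EU ρ σ lam y ξ η δ k ω)) * δ +
      (Ha ρ σ (ind (EU ρ σ lam y ξ η δ k ω)) * ξ k ω + -Ha σ ρ (ind (EU ρ σ lam y ξ η δ k ω)) * η k ω))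

/-- indicator of the Euler scheme at dyadic level N -/
def pE (ρ σ lam y : ℝ) (B₁ B₂ : ℝ → Ω → ℝ) (N j : ℕ) (ω : Ω) : ℝ :=
  ind (EU ρ σ lam y (inc B₁ 0 (1 / 2 ^ N)) (inc B₂ 0 (1 / 2 ^ N)) (1 / 2 ^ N) j ω)

section euler
variable {μ : Measure Ω} [IsProbabilityMeasure μ] {G : ℕ → MeasurableSpace Ω}
  {ξ η : ℕ → Ω → ℝ} {δ : ℝ} {F : ℝ → MeasurableSpace Ω} {B₁ B₂ : ℝ → Ω → ℝ} {ρ σ lam y : ℝ} {p : ℕ → Ω → ℝ}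

lemma YS_EU (k : ℕ) (ω : Ω) : YS ρ σ lam y (fun j ω => ind (EU ρ σ lam y ξ η δ j ω)) ξ η δ k ω = EU ρ σ lam y ξ η δ k ω := by
  induction k with
  | zero => simp [YS, PS, EU]
  | succ k ih =>
    simp only [YS] at ih ⊢
    rw [PS_succ, ih]
    rfl

lemma YS_pE (N k : ℕ) (ω : Ω) : YS ρ σ lam y (pE ρ σ lam y B₁ B₂ N) (inc B₁ 0 (1 / 2 ^ N)) (inc B₂ 0 (1 / 2 ^ N)) (1 / 2 ^ N) k ω =
    EU ρ σ lam y (inc B₁ 0 (1 / 2 ^ N)) (inc B₂ 0 (1 / 2 ^ N)) (1 / 2 ^ N) k ω := YS_EU k ω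

lemma EU_meas (d : DN μ G ξ η δ) (k : ℕ) : Measurable[G k] (EU ρ σ lam y ξ η δ k) := by
  induction k with
  | zero => exact measurable_const
  | succ k ih =>
    have h0 : Measurable[G (k + 1)] (EU ρ σ lam y ξ η δ k) := ih.mono (d.mono (Nat.le_succ k)) le_rfl
    have h1 : Measurable[G (k + 1)] (fun ω => ind (EU ρ σ lam y ξ η δ k ω)) := ind_meas.comp h0
    have hH : ∀ ρ σ : ℝ, Measurable[G (k + 1)] (fun ω => Ha ρ σ (ind (EU ρ σ lam y ξ η δ k ω))) → True := fun _ _ _ => trivial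
    have h2 : ∀ a b : ℝ, Measurable (fun x => Ha a b x) := fun a b => by unfold Ha; fun_prop
    exact h0.add (((measurable_const.mul (measurable_const.sub (measurable_const.mul h1))).mul measurable_const).add
      ((((h2 ρ σ).comp h1).mul (d.m1 k)).add (((h2 σ ρ).comp h1).neg.mul (d.m2 k))))

lemma EU_BP (d : DN μ G ξ η δ) : BP G (fun j ω => ind (EU ρ σ lam y ξ η δ j ω)) :=
  ⟨fun j => ind_meas.comp (EU_meas d j), fun j ω => ind_bd _⟩

lemma sum_div (f : ℕ → ℝ) (n r : ℕ) : ∑ j ∈ Finset.range (n * r), f (j / r) = r * ∑ j ∈ Finset.range n, f j := by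
  have := coarse_sum f (fun j => (j : ℝ)) r n
  have e1 : ∀ i : ℕ, (((i + 1) * r : ℕ) : ℝ) - ((i * r : ℕ) : ℝ) = r := fun i => by push_cast; ring
  have e2 : ∀ i : ℕ, ((i + 1 : ℕ) : ℝ) - (i : ℝ) = 1 := fun i => by push_cast; ring
  simp only [e1, e2, mul_one] at this
  rw [← this, Finset.mul_sum]
  exact Finset.sum_congr rfl fun i _ => mul_comm _ _

lemma YS_fine (p : ℕ → Ω → ℝ) (N r k : ℕ) (ω : Ω) :
    YS ρ σ lam y p (inc B₁ 0 (1 / 2 ^ N)) (inc B₂ 0 (1 / 2 ^ N)) (1 / 2 ^ N) k ω =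
    YS ρ σ lam y (fun j => p (j / 2 ^ r)) (inc B₁ 0 (1 / 2 ^ (N + r))) (inc B₂ 0 (1 / 2 ^ (N + r))) (1 / 2 ^ (N + r))
      (k * 2 ^ r) ω := by
  rw [YS_eq, YS_eq, LS_fine p σ (ρ - σ) (-ρ) (ρ - σ) k N r ω, dyad_up, sum_div (fun j => p j ω)]
  have : (1 / 2 ^ (N + r) : ℝ) * (((2 ^ r : ℕ) : ℝ) * ∑ j ∈ Finset.range k, p j ω) = 1 / 2 ^ N * ∑ j ∈ Finset.range k, p j ω := by
    rw [pow_add]; push_cast; field_simp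
  rw [this]

lemma coarse_BP (pb : IsPlanarBM μ F B₁ B₂) (N r : ℕ) (b : BP (fun j => F (0 + j * (1 / 2 ^ N))) p) :
    BP (fun j => F (0 + j * (1 / 2 ^ (N + r)))) (fun j => p (j / 2 ^ r)) := by
  refine ⟨fun j => (b.ms _).mono (pb.1.mono ?_) le_rfl, fun j ω => b.bd _ _⟩
  have := (coarse_time (r := 2 ^ r) (j := j) (δ := 1 / 2 ^ (N + r)) (by positivity)).2.1
  have e : ((2 ^ r : ℕ) : ℝ) * (1 / 2 ^ (N + r)) = 1 / 2 ^ N := by rw [pow_add]; push_cast; field_simp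
  rw [e] at this
  linarith

lemma YS_inc (d : DN μ G ξ η δ) (pr : PR ρ σ lam) (b : BP G p) (i l : ℕ) {ε : ℝ} (hε : 0 < ε)
    (hl : lam * (l * δ) ≤ ε / 2) :
    TP μ (fun ω => YS ρ σ lam y p ξ η δ (i + l) ω - YS ρ σ lam y p ξ η δ i ω) ε ≤ (ε / 2)⁻¹ ^ 2 * (l * δ) := by
  have d' := d.shift i
  have a1 := (b.ad1 pr).shift i
  have a2 := (b.ad2 pr).shift i
  have ab := (b.adb pr).shift i
  have e : ∀ ω, YS ρ σ lam y p ξ η δ (i + l) ω - YS ρ σ lam y p ξ η δ i ω =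
      (∑ j ∈ Finset.range l, lam * (1 - 2 * p (i + j) ω) * δ) +
      LS (fun j ω => Ha ρ σ (p (i + j) ω)) (fun j ω => -Ha σ ρ (p (i + j) ω)) (fun j => ξ (i + j)) (fun j => η (i + j)) l ω := by
    intro ω
    simp only [YS, PS, LS]
    rw [Finset.sum_range_add, ← Finset.sum_add_distrib]
    ring
  have h1 := TP_sq (LS_memLp d'.toDN0 a1 a2 l) (half_pos hε)
  rw [isometry d' a1 a2 l] at h1
  have e2 : ∑ j ∈ Finset.range l, ∫ ω, (Ha ρ σ (p (i + j) ω) ^ 2 + (-Ha σ ρ (p (i + j) ω)) ^ 2) ∂μ = l := by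
    have key : ∀ j ∈ Finset.range l, ∫ ω, (Ha ρ σ (p (i + j) ω) ^ 2 + (-Ha σ ρ (p (i + j) ω)) ^ 2) ∂μ = 1 := by
      intro j _
      have : ∀ ω, Ha ρ σ (p (i + j) ω) ^ 2 + (-Ha σ ρ (p (i + j) ω)) ^ 2 = 1 := fun ω => by
        rw [neg_sq]; exact Ha_sq pr (b.bd _ _)
      rw [integral_congr_ae (ae_of_all _ this)]
      simp
    rw [Finset.sum_congr rfl key]
    simp
  rw [e2, mul_comm δ] at h1
  refine le_trans (measureReal_mono fun ω hω => ?_) h1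
  simp only [mem_setOf_eq] at hω ⊢
  rw [e] at hω
  have h2 := drift_bd d.pos ab l ω
  have h3 := hω.trans (abs_add_le _ _)
  linarith

/-- E1 -/
lemma eu_mis (pb : IsPlanarBM μ F B₁ B₂) (pr : PR ρ σ lam) {T τ : ℝ} (hT : 0 < T) (hτ : 0 < τ) :
    ∃ N0 : ℕ, ∀ N ≥ N0, ∀ r n : ℕ, n * (1 / 2 ^ (N + r)) ≤ T →
      Mis μ (fun j => pE ρ σ lam y B₁ B₂ N (j / 2 ^ r)) (YS ρ σ lam y (fun j => pE ρ σ lam y B₁ B₂ N (j / 2 ^ r))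
        (inc B₁ 0 (1 / 2 ^ (N + r))) (inc B₂ 0 (1 / 2 ^ (N + r))) (1 / 2 ^ (N + r))) (1 / 2 ^ (N + r)) n ≤ τ := by
  have hl := pr.l0
  obtain ⟨ε, hε, N1, h1⟩ := ac_unif (μ := μ) pr (κ := τ / 4) (θ := τ / (4 * T)) (by positivity) (by positivity)
  obtain ⟨N2, h2⟩ := small_pow (c := min (τ / 4) (min (ε / 2 / (lam + 1)) (τ / (4 * T) * (ε / 2) ^ 2))) (by positivity)
  refine ⟨max N1 N2, fun N hN r n hn => ?_⟩
  have hN1 : N1 ≤ N + r := le_trans (le_trans (le_max_left _ _) hN) (Nat.le_add_right _ _)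
  have hδN := h2 N ((le_max_right _ _).trans hN)
  have hδN2 := hδN.trans (min_le_right _ _)
  have hδM := (h2 (N + r) (le_trans ((le_max_right _ _).trans hN) (Nat.le_add_right _ _))).trans (min_le_left _ _)
  have hδ : (0:ℝ) < 1 / 2 ^ (N + r) := by positivity
  have dN := pb.dn le_rfl (δ := 1 / 2 ^ N) (by positivity)
  have d := pb.dn le_rfl hδ
  have bN : BP (fun j : ℕ => F (0 + j * (1 / 2 ^ N))) (pE ρ σ lam y B₁ B₂ N) := EU_BP dN
  have b := coarse_BP pb N r bN
  set q := fun j => pE ρ σ lam y B₁ B₂ N (j / 2 ^ r) with hq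
  set Yq := YS ρ σ lam y q (inc B₁ 0 (1 / 2 ^ (N + r))) (inc B₂ 0 (1 / 2 ^ (N + r))) (1 / 2 ^ (N + r)) with hYq
  have qe : ∀ j ω, q j ω = ind (Yq (j / 2 ^ r * 2 ^ r) ω) := by
    intro j ω
    rw [hYq, hq, ← YS_fine (pE ρ σ lam y B₁ B₂ N)]
    rw [YS_pE]
    rfl
  have mY : ∀ j, Measurable (Yq j) := fun j => d.mL (YS_meas d pr b j)
  have := avg_bd (f := fun j => ∫ ω, |q j ω - ind (Yq j ω)| ∂μ) hδ (κ := τ / 4) (θ := τ / (4 * T) + τ / (4 * T))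
    (by positivity) (by positivity) hn (fun j _ => ?_) fun j _ hj => ?_
  · refine this.trans ?_
    have : T * (τ / (4 * T) + τ / (4 * T)) = τ / 2 := by field_simp; norm_num
    linarith
  · simp only [qe]
    exact ind_E_one (mY _) (mY _)
  · simp only [qe]
    refine (ind_close (mY _) (mY _) ε).trans (add_le_add (h1 _ hN1 _ _ _ _ y d b j ?_) ?_)
    · rw [mul_one_div] at hj; exact hj
    · rw [TP_comm]
      have hj := Nat.div_add_mod j (2 ^ r)
      have hl2 : j % 2 ^ r ≤ 2 ^ r := (Nat.mod_lt _ (by positivity)).le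
      have hlδ : ((j % 2 ^ r : ℕ) : ℝ) * (1 / 2 ^ (N + r)) ≤ 1 / 2 ^ N := by
        have e : ((2 ^ r : ℕ) : ℝ) * (1 / 2 ^ (N + r)) = 1 / 2 ^ N := by rw [pow_add]; push_cast; field_simp
        rw [← e]; gcongr
      have hlδ0 : 0 ≤ ((j % 2 ^ r : ℕ) : ℝ) * (1 / 2 ^ (N + r)) := by positivity
      have inc := YS_inc (y := y) d pr b (j / 2 ^ r * 2 ^ r) (j % 2 ^ r) hε ?_
      · rw [mul_comm (j / 2 ^ r), hj] at inc
        rw [mul_comm (j / 2 ^ r)]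
        refine inc.trans ?_
        have h3 := (hlδ.trans hδN2).trans (min_le_right _ _)
        calc (ε / 2)⁻¹ ^ 2 * _ ≤ (ε / 2)⁻¹ ^ 2 * (τ / (4 * T) * (ε / 2) ^ 2) := mul_le_mul_of_nonneg_left h3 (by positivity)
          _ = τ / (4 * T) := by field_simp
      · have h3 := (hlδ.trans hδN2).trans (min_le_left _ _)
        rw [le_div_iff₀ (by positivity)] at h3
        nlinarith

/-- E2 -/
lemma eu_close (pb : IsPlanarBM μ F B₁ B₂) (pr : PR ρ σ lam) {T γ κ : ℝ} (hT : 0 < T) (hγ : 0 < γ) (hκ : 0 < κ) :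
    ∃ N0 : ℕ, ∀ N ≥ N0, ∀ r k : ℕ, k * (1 / 2 ^ (N + r)) ≤ T →
      TP μ (fun ω => YS ρ σ lam y (fun j => pE ρ σ lam y B₁ B₂ N (j / 2 ^ r))
        (inc B₁ 0 (1 / 2 ^ (N + r))) (inc B₂ 0 (1 / 2 ^ (N + r))) (1 / 2 ^ (N + r)) k ω -
        EU ρ σ lam y (inc B₁ 0 (1 / 2 ^ (N + r))) (inc B₂ 0 (1 / 2 ^ (N + r))) (1 / 2 ^ (N + r)) k ω) γ ≤ κ := by
  obtain ⟨τ, hτ, st⟩ := stab (μ := μ) pr hT.le hγ hκ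
  obtain ⟨N1, h1⟩ := eu_mis (y := y) pb pr hT hτ
  obtain ⟨N2, h2⟩ := sqrt_small hτ
  refine ⟨max N1 N2, fun N hN r k hk => ?_⟩
  have hδ : (0:ℝ) < 1 / 2 ^ (N + r) := by positivity
  have dN := pb.dn le_rfl (δ := 1 / 2 ^ N) (by positivity)
  have d := pb.dn le_rfl hδ
  have bN : BP (fun j : ℕ => F (0 + j * (1 / 2 ^ N))) (pE ρ σ lam y B₁ B₂ N) := EU_BP dN
  have b := coarse_BP pb N r bN
  have b' : BP (fun j : ℕ => F (0 + j * (1 / 2 ^ (N + r)))) (pE ρ σ lam y B₁ B₂ (N + r)) := EU_BP d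
  have m1 := h1 N ((le_max_left _ _).trans hN) r k hk
  have := st _ _ _ _ _ _ y k d b b' hk (h2 _ (by have := le_max_right N1 N2; omega)) m1 ?_
  · simp only [YS_pE] at this
    exact this
  · refine le_trans (le_of_eq ?_) hτ.le
    rw [Mis]
    have : ∀ j ω, |pE ρ σ lam y B₁ B₂ (N + r) j ω - ind (YS ρ σ lam y (pE ρ σ lam y B₁ B₂ (N + r))
        (inc B₁ 0 (1 / 2 ^ (N + r))) (inc B₂ 0 (1 / 2 ^ (N + r))) (1 / 2 ^ (N + r)) j ω)| = 0 := by
      intro j ω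
      have := YS_EU (ρ := ρ) (σ := σ) (lam := lam) (y := y) (ξ := inc B₁ 0 (1 / 2 ^ (N + r))) (η := inc B₂ 0 (1 / 2 ^ (N + r)))
        (δ := 1 / 2 ^ (N + r)) j ω
      change |_ - ind (YS ρ σ lam y (fun j ω => ind _) _ _ _ j ω)| = 0
      rw [this]
      simp [pE]
    simp only [this, integral_zero, Finset.sum_const_zero, mul_zero]

/-- E3 -/
lemma eu_ind (pb : IsPlanarBM μ F B₁ B₂) (pr : PR ρ σ lam) {T τ : ℝ} (hT : 0 < T) (hτ : 0 < τ) :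
    ∃ N0 : ℕ, ∀ N ≥ N0, ∀ r n : ℕ, n * (1 / 2 ^ (N + r)) ≤ T →
      1 / 2 ^ (N + r) * ∑ j ∈ Finset.range n, ∫ ω, |pE ρ σ lam y B₁ B₂ N (j / 2 ^ r) ω - pE ρ σ lam y B₁ B₂ (N + r) j ω| ∂μ ≤ τ := by
  obtain ⟨ε, hε, N1, h1⟩ := ac_unif (μ := μ) pr (κ := τ / 8) (θ := τ / (8 * T)) (by positivity) (by positivity)
  obtain ⟨N2, h2⟩ := small_pow (c := τ / 8) (by positivity)
  obtain ⟨N3, h3⟩ := eu_mis (y := y) pb pr hT (half_pos hτ)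
  obtain ⟨N4, h4⟩ := eu_close (y := y) pb pr hT hε (κ := τ / (8 * T)) (by positivity)
  refine ⟨N1 + N2 + N3 + N4, fun N hN r n hn => ?_⟩
  have hδ : (0:ℝ) < 1 / 2 ^ (N + r) := by positivity
  have dN := pb.dn le_rfl (δ := 1 / 2 ^ N) (by positivity)
  have d := pb.dn le_rfl hδ
  have bN : BP (fun j : ℕ => F (0 + j * (1 / 2 ^ N))) (pE ρ σ lam y B₁ B₂ N) := EU_BP dN
  have b := coarse_BP pb N r bN
  have h3 := h3 N (by omega) r n hn
  have h4 := h4 N (by omega) r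
  set q := fun j => pE ρ σ lam y B₁ B₂ N (j / 2 ^ r) with hq
  set Yq := YS ρ σ lam y q (inc B₁ 0 (1 / 2 ^ (N + r))) (inc B₂ 0 (1 / 2 ^ (N + r))) (1 / 2 ^ (N + r)) with hYq
  have mY : ∀ j, Measurable (Yq j) := fun j => d.mL (YS_meas d pr b j)
  have mE : ∀ j, Measurable (EU ρ σ lam y (inc B₁ 0 (1 / 2 ^ (N + r))) (inc B₂ 0 (1 / 2 ^ (N + r))) (1 / 2 ^ (N + r)) j) :=
    fun j => d.mL (EU_meas d j)
  have := avg_bd (f := fun j => ∫ ω, |ind (Yq j ω) - pE ρ σ lam y B₁ B₂ (N + r) j ω| ∂μ) hδ (κ := τ / 8) (θ := τ / (8 * T) + τ / (8 * T))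
    (by positivity) (by positivity) hn (fun j _ => ?_) fun j hjn hj => ?_
  · have e : T * (τ / (8 * T) + τ / (8 * T)) = τ / 4 := by field_simp; norm_num
    have h2 := h2 (N + r) (by omega)
    have tri : 1 / 2 ^ (N + r) * ∑ j ∈ Finset.range n, ∫ ω, |q j ω - pE ρ σ lam y B₁ B₂ (N + r) j ω| ∂μ ≤
        Mis μ q Yq (1 / 2 ^ (N + r)) n +
        1 / 2 ^ (N + r) * ∑ j ∈ Finset.range n, ∫ ω, |ind (Yq j ω) - pE ρ σ lam y B₁ B₂ (N + r) j ω| ∂μ := by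
      rw [Mis, ← mul_add, ← Finset.sum_add_distrib]
      refine mul_le_mul_of_nonneg_left (Finset.sum_le_sum fun j _ => ?_) hδ.le
      have qb := d.mL (b.ms j)
      have i1 : Integrable (fun ω => |q j ω - ind (Yq j ω)|) μ := by
        refine ind_int (mY j) (dN.mL (EU_meas dN (j / 2 ^ r)))
      have i2 : Integrable (fun ω => |ind (Yq j ω) - pE ρ σ lam y B₁ B₂ (N + r) j ω|) μ := ind_int (mE j) (mY j)
      have i3 : Integrable (fun ω => |q j ω - pE ρ σ lam y B₁ B₂ (N + r) j ω|) μ :=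
        ind_int (mE j) (dN.mL (EU_meas dN (j / 2 ^ r)))
      rw [← integral_add i1 i2]
      exact integral_mono i3 (iadd i1 i2) fun ω => abs_sub_le _ _ _
    linarith
  · exact ind_E_one (mE j) (mY j)
  · have : ∫ ω, |ind (Yq j ω) - pE ρ σ lam y B₁ B₂ (N + r) j ω| ∂μ =
        ∫ ω, |ind (EU ρ σ lam y (inc B₁ 0 (1 / 2 ^ (N + r))) (inc B₂ 0 (1 / 2 ^ (N + r))) (1 / 2 ^ (N + r)) j ω) - ind (Yq j ω)| ∂μ := by
      simp_rw [pE, abs_sub_comm]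
    rw [this]
    refine (ind_close (mY _) (mE _) ε).trans (add_le_add (h1 _ (by omega) _ _ _ _ y d b j ?_) ?_)
    · rw [mul_one_div] at hj; exact hj
    · rw [TP_comm]
      exact h4 j (le_trans (by gcongr) hn)

end euler

/-! ### Interpolated Euler schemes -/

/-- coefficients of a component: start, drift `a + b p`, volatilities `a1 + b1 p`, `a2 + b2 p` -/
structure CP where
  x : ℝ
  a : ℝ
  b : ℝ
  a1 : ℝ
  b1 : ℝ
  a2 : ℝ
  b2 : ℝ
  h1 : |b1| ≤ 1
  h2 : |b2| ≤ 1

/-- discrete component driven by `q` -/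
def CS (c : CP) (q ξ η : ℕ → Ω → ℝ) (δ : ℝ) (k : ℕ) (ω : Ω) : ℝ :=
  c.x + c.a * (k * δ) + c.b * (δ * ∑ j ∈ Finset.range k, q j ω) +
    LS (fun j ω => c.a1 + c.b1 * q j ω) (fun j ω => c.a2 + c.b2 * q j ω) ξ η k ω

/-- stopped increments at level N -/
def SI0 (f : ℕ → ℝ) (φ : ℝ → ℝ) (N : ℕ) (t : ℝ) : ℝ :=
  ∑ j ∈ Finset.range (N * 2 ^ N), f j * (φ (min t (((j + 1 : ℕ) : ℝ) * (1 / 2 ^ N))) - φ (min t ((j : ℝ) * (1 / 2 ^ N))))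

/-- interpolated component -/
def IC (c : CP) (p : ℕ → Ω → ℝ) (B₁ B₂ : ℝ → Ω → ℝ) (N : ℕ) (t : ℝ) (ω : Ω) : ℝ :=
  c.x + SI0 (fun j => c.a + c.b * p j ω) (fun s => s) N t + SI0 (fun j => c.a1 + c.b1 * p j ω) (fun s => B₁ s ω) N t +
    SI0 (fun j => c.a2 + c.b2 * p j ω) (fun s => B₂ s ω) N t

lemma SI0_dyad (f : ℕ → ℝ) (φ : ℝ → ℝ) (N s k : ℕ) (hk : k ≤ N * 2 ^ (N + s)) :
    SI0 f φ N (k * (1 / 2 ^ (N + s))) = ∑ j ∈ Finset.range k, f (j / 2 ^ s) *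
      (φ (((j + 1 : ℕ) : ℝ) * (1 / 2 ^ (N + s))) - φ ((j : ℝ) * (1 / 2 ^ (N + s)))) := by
  have hδ : (0:ℝ) < 1 / 2 ^ (N + s) := by positivity
  have := coarse_sum f (fun i => φ (min (k * (1 / 2 ^ (N + s))) ((i : ℝ) * (1 / 2 ^ (N + s))))) (2 ^ s) (N * 2 ^ N)
  simp only [dyad_up] at this
  rw [SI0, this]
  symm
  have hk' : k ≤ N * 2 ^ N * 2 ^ s := by rw [mul_assoc, ← pow_add]; exact hk
  rw [← Finset.sum_subset (Finset.range_subset_range.2 hk')]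
  · refine Finset.sum_congr rfl fun j hj => ?_
    have hj := Finset.mem_range.1 hj
    have e1 : ((j + 1 : ℕ) : ℝ) * (1 / 2 ^ (N + s)) ≤ k * (1 / 2 ^ (N + s)) :=
      mul_le_mul_of_nonneg_right (by exact_mod_cast hj) hδ.le
    have e2 : (j : ℝ) * (1 / 2 ^ (N + s)) ≤ k * (1 / 2 ^ (N + s)) :=
      mul_le_mul_of_nonneg_right (by exact_mod_cast hj.le) hδ.le
    rw [min_eq_right e1, min_eq_right e2]
  · intro j _ hj
    have hj : k ≤ j := by simpa using hj
    have e1 : k * (1 / 2 ^ (N + s)) ≤ ((j + 1 : ℕ) : ℝ) * (1 / 2 ^ (N + s)) :=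
      mul_le_mul_of_nonneg_right (by exact_mod_cast Nat.le_succ_of_le hj) hδ.le
    have e2 : k * (1 / 2 ^ (N + s)) ≤ (j : ℝ) * (1 / 2 ^ (N + s)) :=
      mul_le_mul_of_nonneg_right (by exact_mod_cast hj) hδ.le
    rw [min_eq_left e1, min_eq_left e2, sub_self, mul_zero]

lemma IC_dyad (c : CP) (p : ℕ → Ω → ℝ) (B₁ B₂ : ℝ → Ω → ℝ) (N s k : ℕ) (hk : k ≤ N * 2 ^ (N + s)) (ω : Ω) :
    IC c p B₁ B₂ N (k * (1 / 2 ^ (N + s))) ω = CS c (fun j => p (j / 2 ^ s)) (inc B₁ 0 (1 / 2 ^ (N + s)))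
      (inc B₂ 0 (1 / 2 ^ (N + s))) (1 / 2 ^ (N + s)) k ω := by
  rw [IC, SI0_dyad _ _ _ _ _ hk, SI0_dyad _ _ _ _ _ hk, SI0_dyad _ _ _ _ _ hk, CS, LS, Finset.sum_add_distrib]
  have e : ∀ j : ℕ, ((j + 1 : ℕ) : ℝ) * (1 / 2 ^ (N + s)) - (j : ℝ) * (1 / 2 ^ (N + s)) = 1 / 2 ^ (N + s) := fun j => by
    push_cast; ring
  simp only [e, inc, zero_add, add_mul (c.a), Finset.sum_add_distrib, Finset.sum_const, Finset.card_range, nsmul_eq_mul]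
  have e2 : ∑ j ∈ Finset.range k, c.b * p (j / 2 ^ s) ω * (1 / 2 ^ (N + s)) =
      c.b * (1 / 2 ^ (N + s) * ∑ j ∈ Finset.range k, p (j / 2 ^ s) ω) := by
    rw [← Finset.sum_mul, ← Finset.mul_sum]; ring
  rw [e2]
  push_cast
  ring

lemma SI0_cont (f : ℕ → ℝ) {φ : ℝ → ℝ} (hφ : Continuous φ) (N : ℕ) : Continuous (SI0 f φ N) := by
  unfold SI0
  fun_prop

lemma IC_cont (c : CP) (p : ℕ → Ω → ℝ) {B₁ B₂ : ℝ → Ω → ℝ} (N : ℕ) {ω : Ω} (h1 : Continuous fun t => B₁ t ω)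
    (h2 : Continuous fun t => B₂ t ω) : Continuous (fun t => IC c p B₁ B₂ N t ω) :=
  ((continuous_const.add (SI0_cont _ continuous_id _)).add (SI0_cont _ h1 _)).add (SI0_cont _ h2 _)

lemma SI0_meas {f : ℕ → Ω → ℝ} {φ : ℝ → Ω → ℝ} {N : ℕ} {t : ℝ} {M : MeasurableSpace Ω} (ht : 0 ≤ t)
    (hf : ∀ j : ℕ, (j : ℝ) * (1 / 2 ^ N) ≤ t → Measurable[M] (f j)) (hφ : ∀ s, 0 ≤ s → s ≤ t → Measurable[M] (φ s)) :
    Measurable[M] (fun ω => SI0 (fun j => f j ω) (fun s => φ s ω) N t) := by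
  unfold SI0
  refine Finset.measurable_fun_sum _ fun j _ => ?_
  by_cases h : (j : ℝ) * (1 / 2 ^ N) ≤ t
  · exact (hf j h).mul ((hφ _ (le_min ht (by positivity)) (min_le_left _ _)).sub (hφ _ (le_min ht (by positivity)) (min_le_left _ _)))
  · push Not at h
    have e : t ≤ ((j + 1 : ℕ) : ℝ) * (1 / 2 ^ N) := h.le.trans (mul_le_mul_of_nonneg_right (by push_cast; linarith) (by positivity))
    simp only [min_eq_left h.le, min_eq_left e, sub_self, mul_zero]
    exact measurable_const

section ic
variable {μ : Measure Ω} [IsProbabilityMeasure μ] {G : ℕ → MeasurableSpace Ω}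
  {ξ η : ℕ → Ω → ℝ} {δ : ℝ} {F : ℝ → MeasurableSpace Ω} {B₁ B₂ : ℝ → Ω → ℝ} {ρ σ lam y : ℝ} {p p' : ℕ → Ω → ℝ}

lemma IC_meas (pb : IsPlanarBM μ F B₁ B₂) (c : CP) (N : ℕ) (b : BP (fun j => F (0 + j * (1 / 2 ^ N))) p) {t : ℝ} (ht : 0 ≤ t) :
    Measurable[F t] (IC c p B₁ B₂ N t) := by
  have hp : ∀ j : ℕ, (j : ℝ) * (1 / 2 ^ N) ≤ t → Measurable[F t] (p j) := fun j hj =>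
    (b.ms j).mono (pb.1.mono (by rw [zero_add]; exact hj)) le_rfl
  have hp' : ∀ (u v : ℝ) (j : ℕ), (j : ℝ) * (1 / 2 ^ N) ≤ t → Measurable[F t] (fun ω => u + v * p j ω) := fun u v j hj =>
    measurable_const.add (measurable_const.mul (hp j hj))
  have m0 : ∀ s, 0 ≤ s → s ≤ t → Measurable[F t] (fun _ : Ω => s) := fun s _ _ => measurable_const
  exact ((measurable_const.add (SI0_meas ht (hp' c.a c.b) m0)).add
    (SI0_meas ht (hp' c.a1 c.b1) fun s hs hst => pb.1.meas hs hst)).add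
    (SI0_meas ht (hp' c.a2 c.b2) fun s hs hst => pb.2.1.meas hs hst)

lemma cs_sup (d : DN μ G ξ η δ) (b : BP G p) (b' : BP G p') (c : CP) (n : ℕ) {ε : ℝ} (hε : 0 < ε) :
    μ.real {ω | ∃ k ≤ n, ε ≤ |CS c p ξ η δ k ω - CS c p' ξ η δ k ω|} ≤
      ((ε / 2)⁻¹ * |c.b| + (ε / 2)⁻¹ ^ 2 * 2) * (δ * ∑ j ∈ Finset.range n, ∫ ω, |p j ω - p' j ω| ∂μ) := by
  have h1 := doob_diff d b b' c.h1 c.h2 n c.a1 c.a2 (half_pos hε)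
  have ij : ∀ j, Integrable (fun ω => |p j ω - p' j ω|) μ := fun j => by
    refine bdd_int (((d.mL (b.ms j)).sub (d.mL (b'.ms j))).abs) (C := 1) fun ω => ?_
    change |(|p j ω - p' j ω|)| ≤ 1
    rcases b.bd j ω with e | e <;> rcases b'.bd j ω with e' | e' <;> rw [e, e'] <;> norm_num
  have i0 : Integrable (fun ω => |c.b| * (δ * ∑ j ∈ Finset.range n, |p j ω - p' j ω|)) μ :=
    ((integrable_finsetSum _ fun j _ => ij j).const_mul _).const_mul _
  have h2 := TP_L1 i0 (half_pos hε)
  have p0 : ∀ ω, 0 ≤ |c.b| * (δ * ∑ j ∈ Finset.range n, |p j ω - p' j ω|) := fun ω =>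
    mul_nonneg (abs_nonneg _) (mul_nonneg d.pos.le (Finset.sum_nonneg fun _ _ => abs_nonneg _))
  have e : ∫ ω, |(|c.b| * (δ * ∑ j ∈ Finset.range n, |p j ω - p' j ω|))| ∂μ =
      |c.b| * (δ * ∑ j ∈ Finset.range n, ∫ ω, |p j ω - p' j ω| ∂μ) := by
    simp_rw [abs_of_nonneg (p0 _)]
    rw [integral_const_mul, integral_const_mul, integral_finsetSum _ fun j _ => ij j]
  rw [e] at h2
  refine (measureReal_mono (s₂ := {ω | ε / 2 ≤ |(|c.b| * (δ * ∑ j ∈ Finset.range n, |p j ω - p' j ω|))|} ∪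
    {ω | ∃ k ≤ n, ε / 2 ≤ |LS (fun j ω => c.a1 + c.b1 * p j ω) (fun j ω => c.a2 + c.b2 * p j ω) ξ η k ω -
      LS (fun j ω => c.a1 + c.b1 * p' j ω) (fun j ω => c.a2 + c.b2 * p' j ω) ξ η k ω|}) ?_).trans
    ((measureReal_union_le _ _).trans ((add_le_add h2 h1).trans (le_of_eq (by ring))))
  rintro ω ⟨k, hk, hω⟩
  by_contra hh
  simp only [mem_union, mem_setOf_eq, not_or, not_exists, not_and, not_le] at hh
  obtain ⟨g1, g2⟩ := hh
  have g2 := g2 k hk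
  rw [abs_of_nonneg (p0 ω)] at g1
  have g3 : |c.b * (δ * ∑ j ∈ Finset.range k, (p j ω - p' j ω))| ≤ |c.b| * (δ * ∑ j ∈ Finset.range n, |p j ω - p' j ω|) := by
    rw [abs_mul, abs_mul, abs_of_pos d.pos]
    refine mul_le_mul_of_nonneg_left (mul_le_mul_of_nonneg_left ?_ d.pos.le) (abs_nonneg _)
    exact (Finset.abs_sum_le_sum_abs _ _).trans (Finset.sum_le_sum_of_subset_of_nonneg (Finset.range_subset_range.2 hk)
      fun _ _ _ => abs_nonneg _)
  rw [Finset.sum_sub_distrib] at g3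
  have e3 : CS c p ξ η δ k ω - CS c p' ξ η δ k ω = c.b * (δ * (∑ j ∈ Finset.range k, p j ω - ∑ j ∈ Finset.range k, p' j ω)) +
      (LS (fun j ω => c.a1 + c.b1 * p j ω) (fun j ω => c.a2 + c.b2 * p j ω) ξ η k ω -
      LS (fun j ω => c.a1 + c.b1 * p' j ω) (fun j ω => c.a2 + c.b2 * p' j ω) ξ η k ω) := by
    simp only [CS]; ring
  rw [e3] at hω
  have := abs_add_le (c.b * (δ * (∑ j ∈ Finset.range k, p j ω - ∑ j ∈ Finset.range k, p' j ω)))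
      (LS (fun j ω => c.a1 + c.b1 * p j ω) (fun j ω => c.a2 + c.b2 * p j ω) ξ η k ω -
      LS (fun j ω => c.a1 + c.b1 * p' j ω) (fun j ω => c.a2 + c.b2 * p' j ω) ξ η k ω)
  linarith

lemma pE_BP (pb : IsPlanarBM μ F B₁ B₂) (N : ℕ) : BP (fun j : ℕ => F (0 + j * (1 / 2 ^ N))) (pE ρ σ lam y B₁ B₂ N) :=
  EU_BP (pb.dn le_rfl (by positivity))

/-- E4 at dyadic times -/
lemma ic_dyad (pb : IsPlanarBM μ F B₁ B₂) (pr : PR ρ σ lam) (c : CP) (T : ℕ) {ε θ : ℝ} (hε : 0 < ε) (hθ : 0 < θ) :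
    ∃ N0 : ℕ, ∀ N ≥ N0, ∀ r s : ℕ, μ.real {ω | ∃ k ≤ T * 2 ^ (N + r + s), ε ≤
      |IC c (pE ρ σ lam y B₁ B₂ N) B₁ B₂ N (k * (1 / 2 ^ (N + r + s))) ω -
       IC c (pE ρ σ lam y B₁ B₂ (N + r)) B₁ B₂ (N + r) (k * (1 / 2 ^ (N + r + s))) ω|} ≤ θ := by
  set C := ((ε / 2)⁻¹ * |c.b| + (ε / 2)⁻¹ ^ 2 * 2) with hC
  have hC0 : 0 < C := by positivity
  obtain ⟨N1, h1⟩ := eu_ind (y := y) pb pr (T := T + 1) (τ := θ / C) (by positivity) (by positivity)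
  refine ⟨N1 + T, fun N hN r s => ?_⟩
  have h1 := h1 N (by omega) r (T * 2 ^ (N + r)) (by push_cast; field_simp; linarith)
  have hδ : (0:ℝ) < 1 / 2 ^ (N + r + s) := by positivity
  have d := pb.dn le_rfl hδ
  have b' := coarse_BP pb (N + r) s (pE_BP (ρ := ρ) (σ := σ) (lam := lam) (y := y) pb (N + r))
  have b := coarse_BP pb N (r + s) (pE_BP (ρ := ρ) (σ := σ) (lam := lam) (y := y) pb N)
  rw [← add_assoc] at b
  have := cs_sup d b b' c (T * 2 ^ (N + r + s)) hε
  rw [← hC] at this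
  have e : (1 / 2 ^ (N + r + s) * ∑ j ∈ Finset.range (T * 2 ^ (N + r + s)),
      ∫ ω, |pE ρ σ lam y B₁ B₂ N (j / 2 ^ (r + s)) ω - pE ρ σ lam y B₁ B₂ (N + r) (j / 2 ^ s) ω| ∂μ : ℝ) =
      1 / 2 ^ (N + r) * ∑ j ∈ Finset.range (T * 2 ^ (N + r)),
      ∫ ω, |pE ρ σ lam y B₁ B₂ N (j / 2 ^ r) ω - pE ρ σ lam y B₁ B₂ (N + r) j ω| ∂μ := by
    have e0 := sum_div (fun j => ∫ ω, |pE ρ σ lam y B₁ B₂ N (j / 2 ^ r) ω - pE ρ σ lam y B₁ B₂ (N + r) j ω| ∂μ) (T * 2 ^ (N + r)) (2 ^ s)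
    simp only [Nat.div_div_eq_div_mul, ← pow_add, mul_assoc] at e0
    rw [add_comm s r] at e0
    rw [e0, pow_add _ (N + r) s]
    push_cast
    field_simp
  rw [e] at this
  refine le_trans (le_of_eq ?_) (this.trans ((mul_le_mul_of_nonneg_left h1 hC0.le).trans (le_of_eq (by field_simp))))
  congr 1
  ext ω
  simp only [mem_setOf_eq]
  refine exists_congr fun k => and_congr_right fun hk => ?_
  have k1 : k ≤ (N + r) * 2 ^ (N + r + s) := hk.trans (Nat.mul_le_mul_right _ (by omega))
  have k2 : k ≤ N * 2 ^ (N + (r + s)) := by rw [← add_assoc]; exact hk.trans (Nat.mul_le_mul_right _ (by omega))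
  have e1 := IC_dyad c (pE ρ σ lam y B₁ B₂ (N + r)) B₁ B₂ (N + r) s k k1 ω
  have e2 := IC_dyad c (pE ρ σ lam y B₁ B₂ N) B₁ B₂ N (r + s) k k2 ω
  rw [← add_assoc] at e2
  rw [e1, e2]

end ic

/-! ### Limits of the Euler schemes -/

lemma lim_unif {f : ℕ → ℝ → ℝ} (h : ∀ᶠ m : ℕ in atTop, ∀ t : ℝ, 0 ≤ t → t ≤ m → |f m t - f (m + 1) t| ≤ 1 / 2 ^ m) (T : ℕ) :
    ∀ᶠ m : ℕ in atTop, ∀ t : ℝ, 0 ≤ t → t ≤ T → |f m t - limsup (fun n => f n t) atTop| ≤ 2 / 2 ^ m := by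
  obtain ⟨M, hM⟩ := eventually_atTop.1 h
  filter_upwards [eventually_ge_atTop (max M T)] with m hm t ht htT
  have hM' : M ≤ m := (le_max_left _ _).trans hm
  have hT' : (T : ℝ) ≤ m := by exact_mod_cast (le_max_right _ _).trans hm
  have hd : ∀ n, dist (f (m + n) t) (f (m + (n + 1)) t) ≤ (2 / 2 ^ m) / 2 / 2 ^ n := by
    intro n
    rw [Real.dist_eq]
    refine (hM (m + n) (by omega) t ht (htT.trans (hT'.trans (by push_cast; linarith [(n.cast_nonneg : (0:ℝ) ≤ n)])))).trans (le_of_eq ?_)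
    rw [pow_add]; field_simp
  have cs : CauchySeq (fun n => f (m + n) t) := cauchySeq_of_le_geometric_two hd
  obtain ⟨a, ha⟩ := cauchySeq_tendsto_of_complete cs
  have h0 := dist_le_of_le_geometric_two_of_tendsto₀ hd ha
  have ha' : Tendsto (fun n => f n t) atTop (nhds a) := by
    rw [← tendsto_add_atTop_iff_nat m]
    simpa only [add_comm] using ha
  rw [ha'.limsup_eq]
  simpa [Real.dist_eq] using h0

section lim
variable {μ : Measure Ω} [IsProbabilityMeasure μ] {F : ℝ → MeasurableSpace Ω} {B₁ B₂ : ℝ → Ω → ℝ} {ρ σ lam y : ℝ}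

/-- E4 -/
lemma ic_sup (pb : IsPlanarBM μ F B₁ B₂) (pr : PR ρ σ lam) (c : CP) (T : ℕ) {ε θ : ℝ} (hε : 0 < ε) (hθ : 0 < θ) :
    ∃ N0 : ℕ, ∀ N ≥ N0, ∀ r : ℕ, μ {ω | ∃ t : ℝ, 0 ≤ t ∧ t ≤ T ∧ ε <
      |IC c (pE ρ σ lam y B₁ B₂ N) B₁ B₂ N t ω - IC c (pE ρ σ lam y B₁ B₂ (N + r)) B₁ B₂ (N + r) t ω|} ≤ ENNReal.ofReal θ := by
  obtain ⟨N0, h0⟩ := ic_dyad (y := y) pb pr c T hε hθ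
  refine ⟨N0, fun N hN r => ?_⟩
  set f : ℝ → Ω → ℝ := fun t ω => |IC c (pE ρ σ lam y B₁ B₂ N) B₁ B₂ N t ω -
    IC c (pE ρ σ lam y B₁ B₂ (N + r)) B₁ B₂ (N + r) t ω| with hf
  set A : ℕ → Set Ω := fun s => {ω | ∃ k ≤ T * 2 ^ (N + r + s), ε ≤ f (k * (1 / 2 ^ (N + r + s))) ω} with hA
  have mA : Monotone A := by
    refine monotone_nat_of_le_succ fun s => ?_
    rintro ω ⟨k, hk, hω⟩
    refine ⟨k * 2 ^ 1, ?_, ?_⟩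
    · rw [← add_assoc, pow_succ (n := N + r + s), ← mul_assoc]
      exact Nat.mul_le_mul_right _ hk
    · rw [← add_assoc, dyad_up]; exact hω
  have hU : μ (⋃ s, A s) ≤ ENNReal.ofReal θ := by
    rw [mA.measure_iUnion]
    refine iSup_le fun s => ?_
    rw [← ofReal_measureReal]
    exact ENNReal.ofReal_le_ofReal (h0 N hN r s)
  have hc : ∀ᵐ ω ∂μ, Continuous fun t => f t ω := by
    filter_upwards [pb.1.cont, pb.2.1.cont] with ω h1 h2
    exact ((IC_cont _ _ _ h1 h2).sub (IC_cont _ _ _ h1 h2)).abs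
  refine le_trans (measure_mono_ae ?_) hU
  filter_upwards [hc] with ω hω
  rintro ⟨t, ht, htT, hlt⟩
  have h1 := ((hω.tendsto t).comp (floor_tendsto t ht)).eventually_const_lt hlt
  obtain ⟨L, hL, hL2⟩ := (h1.and (eventually_ge_atTop (N + r))).exists
  obtain ⟨s, rfl⟩ := Nat.exists_eq_add_of_le hL2
  refine mem_iUnion.2 ⟨s, ⌊t * 2 ^ (N + r + s)⌋₊, ?_, hL.le⟩
  refine Nat.floor_le_of_le ?_
  push_cast
  gcongr

/-- existence of a limiting component -/
lemma exists_comp (pb : IsPlanarBM μ F B₁ B₂) (pr : PR ρ σ lam) (c : CP) :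
    ∃ X : ℝ → Ω → ℝ, (∀ t, 0 ≤ t → Measurable[F t] (X t)) ∧ (∀ᵐ ω ∂μ, Continuous fun t => X t ω) ∧
      ∀ (T : ℕ) (ε θ : ℝ), 0 < ε → 0 < θ → ∃ N0 : ℕ, ∀ N ≥ N0, ∀ k : ℕ, (k : ℝ) * (1 / 2 ^ N) ≤ T →
        TP μ (fun ω => CS c (pE ρ σ lam y B₁ B₂ N) (inc B₁ 0 (1 / 2 ^ N)) (inc B₂ 0 (1 / 2 ^ N)) (1 / 2 ^ N) k ω -
          X (k * (1 / 2 ^ N)) ω) ε ≤ θ := by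
  set P : ℕ → ℝ → Ω → ℝ := fun N => IC c (pE ρ σ lam y B₁ B₂ N) B₁ B₂ N with hP
  have mP : ∀ N t, 0 ≤ t → Measurable[F t] (P N t) := fun N t ht => IC_meas pb c N (pE_BP pb N) ht
  have cP : ∀ᵐ ω ∂μ, ∀ N, Continuous fun t => P N t ω := by
    filter_upwards [pb.1.cont, pb.2.1.cont] with ω h1 h2 N
    exact IC_cont _ _ _ h1 h2
  choose n0 hn0 using fun m : ℕ => ic_sup (y := y) pb pr c m (ε := 1 / 2 ^ m) (θ := 1 / 2 ^ m) (by positivity) (by positivity)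
  set ν : ℕ → ℕ := fun m => m + ∑ i ∈ Finset.range (m + 1), n0 i with hν
  have ν0 : ∀ m, n0 m ≤ ν m := fun m =>
    (Finset.single_le_sum (f := n0) (fun _ _ => Nat.zero_le _) (Finset.self_mem_range_succ m)).trans (Nat.le_add_left _ _)
  have ν1 : ∀ m, m ≤ ν m := fun m => Nat.le_add_right _ _
  have ν2 : ∀ m, ν m ≤ ν (m + 1) := fun m => by
    simp only [hν]
    rw [Finset.sum_range_succ _ (m + 1)]
    omega
  have bc : ∀ᵐ ω ∂μ, ∀ᶠ m : ℕ in atTop, ω ∉ {ω | ∃ t : ℝ, 0 ≤ t ∧ t ≤ (m : ℕ) ∧ (1 / 2 ^ m : ℝ) <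
      |P (ν m) t ω - P (ν (m + 1)) t ω|} := by
    refine ae_eventually_notMem ?_
    refine ne_top_of_le_ne_top (b := ∑' m : ℕ, ENNReal.ofReal (1 / 2 ^ m)) ?_ (ENNReal.tsum_le_tsum fun m => ?_)
    · rw [← ENNReal.ofReal_tsum_of_nonneg (fun _ => by positivity)]
      · exact ENNReal.ofReal_ne_top
      · simpa using summable_geometric_two
    · have := hn0 m (ν m) (ν0 m) (ν (m + 1) - ν m)
      rw [Nat.add_sub_cancel' (ν2 m)] at this
      exact this
  set X : ℝ → Ω → ℝ := fun t ω => limsup (fun n => P (ν n) (max t 0) ω) atTop with hX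
  have key : ∀ᵐ ω ∂μ, ∀ T : ℕ, ∀ᶠ m : ℕ in atTop, ∀ t : ℝ, 0 ≤ t → t ≤ T → |P (ν m) t ω - X t ω| ≤ 2 / 2 ^ m := by
    filter_upwards [bc] with ω hω T
    have := lim_unif (f := fun m t => P (ν m) t ω) (hω.mono fun m hm t ht htm => ?_) T
    · filter_upwards [this] with m hm t ht htT
      simp only [hX, max_eq_left ht]
      exact hm t ht htT
    · by_contra hh
      exact hm ⟨t, ht, htm, not_le.1 hh⟩
  have t0 : Tendsto (fun m : ℕ => (2 / 2 ^ m : ℝ)) atTop (nhds 0) := by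
    have := (tendsto_pow_atTop_nhds_zero_of_lt_one (r := (1 / 2 : ℝ)) (by norm_num) (by norm_num)).const_mul 2
    simpa [div_eq_mul_inv] using this
  have pw : ∀ t, 0 ≤ t → ∀ᵐ ω ∂μ, Tendsto (fun m => P (ν m) t ω) atTop (nhds (X t ω)) := by
    intro t ht
    filter_upwards [key] with ω hω
    obtain ⟨T, hT⟩ := exists_nat_ge t
    rw [tendsto_iff_dist_tendsto_zero]
    refine squeeze_zero' (Eventually.of_forall fun _ => dist_nonneg) ?_ t0
    filter_upwards [hω T] with m hm
    exact hm t ht hT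
  have mX : ∀ t, 0 ≤ t → Measurable[F t] (X t) := by
    intro t ht
    simp only [hX, max_eq_left ht]
    exact Measurable.limsup fun n => mP _ t ht
  refine ⟨X, mX, ?_, ?_⟩
  · filter_upwards [key, cP] with ω h1 h2
    have : TendstoLocallyUniformly (fun m t => P (ν m) (max t 0) ω) (fun t => X t ω) atTop := by
      rw [Metric.tendstoLocallyUniformly_iff]
      intro ε hε t
      obtain ⟨T, hT⟩ := exists_nat_gt (max t 0)
      refine ⟨Iio T, Iio_mem_nhds ((le_max_left _ _).trans_lt hT), ?_⟩
      filter_upwards [h1 T, t0.eventually_lt_const hε] with m hm hm2 s hs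
      rw [dist_comm]
      have e : X s ω = X (max s 0) ω := by simp [hX]
      rw [e]
      exact (hm (max s 0) (le_max_right _ _) (max_le (le_of_lt hs) (Nat.cast_nonneg _))).trans_lt hm2
    exact this.continuous (Frequently.of_forall fun m => (h2 (ν m)).comp (continuous_id.max continuous_const))
  · intro T ε θ hε hθ
    obtain ⟨N1, h1⟩ := ic_sup (y := y) pb pr c T (ε := ε / 4) (θ := θ) (by positivity) hθ
    refine ⟨N1 + T, fun N hN k hk => ?_⟩
    have hkN : k ≤ N * 2 ^ (N + 0) := by
      have : (k : ℝ) ≤ T * 2 ^ N := by rw [mul_one_div, div_le_iff₀ (by positivity)] at hk; exact hk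
      have : k ≤ T * 2 ^ N := by exact_mod_cast this
      exact this.trans (Nat.mul_le_mul_right _ (by omega))
    have e := IC_dyad c (pE ρ σ lam y B₁ B₂ N) B₁ B₂ N 0 k hkN
    simp only [add_zero, pow_zero, Nat.div_one] at e
    simp_rw [← e]
    set t : ℝ := (k : ℝ) * (1 / 2 ^ N) with ht
    have ht0 : 0 ≤ t := by positivity
    have mle : ∀ N, Measurable (P N t) := fun N => (mP N t ht0).mono (pb.1.le t) le_rfl
    have tim : TendstoInMeasure μ (fun m => P (ν m) t) atTop (X t) :=
      tendstoInMeasure_of_tendsto_ae (fun m => (mle _).aestronglyMeasurable) (pw t ht0)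
    have l1 := (tendsto_const_nhds (x := θ)).add (TP_tim tim (half_pos hε))
    rw [add_zero] at l1
    refine ge_of_tendsto l1 ?_
    filter_upwards [eventually_ge_atTop N] with m hm
    have tri := TP_tri (μ := μ) (P N t) (P (ν m) t) (X t) (ε / 2) (ε / 2)
    rw [add_halves] at tri
    refine tri.trans (add_le_add ?_ le_rfl)
    have h2 := h1 N (by omega) (ν m - N)
    rw [Nat.add_sub_cancel' (hm.trans (ν1 m))] at h2
    refine ENNReal.toReal_le_of_le_ofReal hθ.le (le_trans (measure_mono ?_) h2)
    intro ω hω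
    exact ⟨t, ht0, hk, lt_of_lt_of_le (by linarith) hω⟩

end lim

/-! ### The limit solves the system -/

section sol
variable {μ : Measure Ω} [IsProbabilityMeasure μ] {F : ℝ → MeasurableSpace Ω} {B₁ B₂ : ℝ → Ω → ℝ} {ρ σ lam y : ℝ}
  {X Y : ℝ → Ω → ℝ} {c : CP}

lemma TP_lim {Z : ℕ → Ω → ℝ} {W : Ω → ℝ} (h : ∀ᵐ ω ∂μ, Tendsto (fun n => Z n ω) atTop (nhds (W ω))) {ε' ε θ : ℝ}
    (hθ : 0 ≤ θ) (hε : ε' < ε) (hZ : ∀ n, TP μ (Z n) ε' ≤ θ) : TP μ W ε ≤ θ := by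
  set A : ℕ → Set Ω := fun n => {ω | ∀ k ≥ n, ε' ≤ |Z k ω|} with hA
  have mA : Monotone A := fun n k hnk ω hω l hl => hω l (hnk.trans hl)
  have hU : μ (⋃ n, A n) ≤ ENNReal.ofReal θ := by
    rw [mA.measure_iUnion]
    refine iSup_le fun n => ?_
    have hsub : A n ⊆ {ω | ε' ≤ |Z n ω|} := fun ω hω => hω n le_rfl
    refine (measure_mono hsub).trans ?_
    rw [← ofReal_measureReal]
    exact ENNReal.ofReal_le_ofReal (hZ n)
  refine ENNReal.toReal_le_of_le_ofReal hθ (le_trans (measure_mono_ae ?_) hU)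
  filter_upwards [h] with ω hω hω2
  have hω2 : ε ≤ |W ω| := hω2
  obtain ⟨n, hn⟩ := eventually_atTop.1 (hω.abs.eventually_const_lt (lt_of_lt_of_le hε hω2))
  exact mem_iUnion.2 ⟨n, fun k hk => (hn k hk).le⟩

/-- the limit component is approximated by the Euler scheme -/
def EL (μ : Measure Ω) (B₁ B₂ : ℝ → Ω → ℝ) (ρ σ lam y : ℝ) (c : CP) (X : ℝ → Ω → ℝ) : Prop :=
  ∀ (T : ℕ) (ε θ : ℝ), 0 < ε → 0 < θ → ∃ N0 : ℕ, ∀ N ≥ N0, ∀ k : ℕ, (k : ℝ) * (1 / 2 ^ N) ≤ T →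
    TP μ (fun ω => CS c (pE ρ σ lam y B₁ B₂ N) (inc B₁ 0 (1 / 2 ^ N)) (inc B₂ 0 (1 / 2 ^ N)) (1 / 2 ^ N) k ω -
      X (k * (1 / 2 ^ N)) ω) ε ≤ θ

/-- the difference is approximated by the Euler scheme -/
def DL (μ : Measure Ω) (B₁ B₂ : ℝ → Ω → ℝ) (ρ σ lam y : ℝ) (Y : ℝ → Ω → ℝ) : Prop :=
  ∀ (T : ℕ) (ε θ : ℝ), 0 < ε → 0 < θ → ∃ N0 : ℕ, ∀ N ≥ N0, ∀ k : ℕ, (k : ℝ) * (1 / 2 ^ N) ≤ T →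
    TP μ (fun ω => EU ρ σ lam y (inc B₁ 0 (1 / 2 ^ N)) (inc B₂ 0 (1 / 2 ^ N)) (1 / 2 ^ N) k ω -
      Y (k * (1 / 2 ^ N)) ω) ε ≤ θ

lemma DL.np (pb : IsPlanarBM μ F B₁ B₂) (pr : PR ρ σ lam) (hm : ∀ t, 0 ≤ t → Measurable (Y t))
    (hc : ∀ᵐ ω ∂μ, Continuous fun t => Y t ω) (h : DL μ B₁ B₂ ρ σ lam y Y) : NP μ Y := by
  refine ⟨hm, hc, fun T κ θ hκ hθ => ?_⟩
  obtain ⟨ε, hε, N1, h1⟩ := ac_unif (μ := μ) pr (κ := κ / 2) (θ := θ / 3) (by positivity) (by positivity)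
  obtain ⟨T', hT'⟩ := exists_nat_ge T
  obtain ⟨N2, h2⟩ := h T' (ε / 3) (θ / 3) (by positivity) (by positivity)
  obtain ⟨s, hs, h3⟩ := uc hm hc T (ε := ε / 3) (θ := θ / 3) (by positivity) (by positivity)
  obtain ⟨N3, h4⟩ := small_pow (c := min s (κ / 2)) (by positivity)
  refine ⟨ε / 3, by positivity, fun u hu huT => ?_⟩
  set N := N1 + N2 + N3 with hN
  have hδ : (0:ℝ) < 1 / 2 ^ N := by positivity
  have h4 := h4 N (by omega)
  have hu0 : 0 ≤ u := hκ.le.trans hu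
  set k := ⌊u * 2 ^ N⌋₊ with hk
  have k1 : (k : ℝ) * (1 / 2 ^ N) ≤ u := by
    rw [mul_one_div, div_le_iff₀ (by positivity)]; exact Nat.floor_le (by positivity)
  have k2 : u ≤ (k : ℝ) * (1 / 2 ^ N) + 1 / 2 ^ N := by
    rw [← add_one_mul, mul_one_div, le_div_iff₀ (by positivity)]
    exact (Nat.lt_floor_add_one _).le
  have k0 : 0 ≤ (k : ℝ) * (1 / 2 ^ N) := by positivity
  have d := pb.dn le_rfl hδ
  have g1 := h1 N (by omega) _ _ _ _ y d (pE_BP (ρ := ρ) (σ := σ) (lam := lam) (y := y) pb N) k (by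
    have := min_le_right s (κ / 2)
    have e : (k:ℝ) / 2 ^ N = k * (1 / 2 ^ N) := by rw [mul_one_div]
    rw [e]; linarith)
  simp only [YS_pE] at g1
  have g2 := h2 N (by omega) k (k1.trans (huT.trans hT'))
  have g3 := h3 u (k * (1 / 2 ^ N)) hu0 huT k0 (k1.trans huT) (by
    have := min_le_left s (κ / 2)
    rw [abs_le]; constructor <;> linarith)
  have : θ = θ / 3 + θ / 3 + θ / 3 := by ring
  rw [this]
  refine le_trans (measureReal_mono ?_) (le_trans (measureReal_union_le _ _) (add_le_add
    (le_trans (measureReal_union_le _ _) (add_le_add g1 g2)) g3))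
  intro ω hω
  simp only [mem_union, mem_setOf_eq] at hω ⊢
  by_contra hh
  push Not at hh
  obtain ⟨⟨e1, e2⟩, e3⟩ := hh
  set E := EU ρ σ lam y (inc B₁ 0 (1 / 2 ^ N)) (inc B₂ 0 (1 / 2 ^ N)) (1 / 2 ^ N) k ω
  rw [abs_le] at hω
  rw [abs_lt] at e2 e3
  rcases lt_abs.1 e1 with e1 | e1 <;> linarith [e2.1, e2.2, e3.1, e3.2, hω.1, hω.2]

/-- the stochastic integral candidate -/
def Ican (c : CP) (X Y : ℝ → Ω → ℝ) (t : ℝ) (ω : Ω) : ℝ := X t ω - c.x - ∫ u in (0:ℝ)..t, (c.a + c.b * ind (Y u ω))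

/-- Riemann sums of the component -/
def RSc (c : CP) (Y B₁ B₂ : ℝ → Ω → ℝ) (t : ℝ) (n : ℕ) (ω : Ω) : ℝ :=
  rsum (fun s ω => c.a1 + c.b1 * ind (Y s ω)) B₁ t n ω + rsum (fun s ω => c.a2 + c.b2 * ind (Y s ω)) B₂ t n ω

lemma si_dyad (pb : IsPlanarBM μ F B₁ B₂) (np : NP μ Y) (hY : ∀ t, 0 ≤ t → Measurable[F t] (Y t))
    (dl : DL μ B₁ B₂ ρ σ lam y Y) (el : EL μ B₁ B₂ ρ σ lam y c X) (T : ℕ) {ε θ : ℝ} (hε : 0 < ε) (hθ : 0 < θ) :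
    ∃ n0 : ℕ, ∀ n ≥ n0, ∀ M k : ℕ, (k : ℝ) * (1 / 2 ^ M) ≤ T →
      TP μ (fun ω => RSc c Y B₁ B₂ (k * (1 / 2 ^ M)) n ω - Ican c X Y (k * (1 / 2 ^ M)) ω) ε ≤ θ := by
  have hT1 : (0:ℝ) < (T : ℝ) + 1 := by positivity
  obtain ⟨n1, h1⟩ := samp_close pb np hY c.h1 c.h2 (α₁ := c.a1) (α₂ := c.a2) hT1 (ε := ε / 4) (θ := θ / 4) (by positivity) (by positivity)
  set C := ((ε / 4 / 2)⁻¹ * |c.b| + (ε / 4 / 2)⁻¹ ^ 2 * 2) with hC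
  have hC0 : 0 < C := by positivity
  obtain ⟨ε', hε', θ', hθ', h2⟩ := np.cz hT1 (θ := θ / 4 / C) (by positivity)
  obtain ⟨n2, h3⟩ := dl T ε' θ' hε' hθ'
  obtain ⟨n3, h4⟩ := small_pow hθ'
  obtain ⟨n4, h5⟩ := el T (ε / 4) (θ / 4) (by positivity) (by positivity)
  obtain ⟨n5, h6⟩ := drift_close np hT1 (ε := ε / 4 / (|c.b| + 1)) (θ := θ / 4) (by positivity) (by positivity)
  set n0 := n1 + n2 + n3 + n4 + n5 with hn0
  have fine : ∀ n ≥ n0, ∀ M ≥ n0, ∀ k : ℕ, (k : ℝ) * (1 / 2 ^ M) ≤ T →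
      TP μ (fun ω => RSc c Y B₁ B₂ (k * (1 / 2 ^ M)) n ω - Ican c X Y (k * (1 / 2 ^ M)) ω) ε ≤ θ := by
    intro n hn M hM k hk
    have hδ : (0:ℝ) < 1 / 2 ^ M := by positivity
    have hk1 : (k : ℝ) * (1 / 2 ^ M) ≤ T + 1 := by linarith
    have d := pb.dn le_rfl hδ
    have bE := pE_BP (ρ := ρ) (σ := σ) (lam := lam) (y := y) pb M
    have bY := samp_BP (δ := 1 / 2 ^ M) hY pb.1.mono (a := fun j => (j : ℝ) * (1 / 2 ^ M)) fun j => ⟨by positivity, le_rfl⟩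
    have t1 := h1 M (by omega) n (by omega) k hk1
    have t2 : TP μ (fun ω => CS c (pE ρ σ lam y B₁ B₂ M) (inc B₁ 0 (1 / 2 ^ M)) (inc B₂ 0 (1 / 2 ^ M)) (1 / 2 ^ M) k ω -
        CS c (fun j ω => ind (Y (j * (1 / 2 ^ M)) ω)) (inc B₁ 0 (1 / 2 ^ M)) (inc B₂ 0 (1 / 2 ^ M)) (1 / 2 ^ M) k ω) (ε / 4) ≤ θ / 4 := by
      have := cs_sup d bE bY c k (ε := ε / 4) (by positivity)
      rw [← hC] at this
      have D := h2 (1 / 2 ^ M) k _ hδ (h4 M (by omega)) hk1 (fun j => d.mL (EU_meas (ρ := ρ) (σ := σ) (lam := lam) (y := y) d j))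
        (fun j hj => h3 M (by omega) j (le_trans (by gcongr) hk))
      refine le_trans (measureReal_mono ?_) (this.trans ((mul_le_mul_of_nonneg_left D hC0.le).trans (le_of_eq (by field_simp))))
      intro ω hω
      exact ⟨k, le_rfl, hω⟩
    rw [TP_comm] at t2
    have t3 := h5 M (by omega) k hk
    have t4 := h6 M (by omega) k hk1
    rw [TP_comm] at t4
    have t4 := (TP_cmul (c := c.b) (C := |c.b| + 1) (by linarith) (by positivity)).trans t4
    have t5 := (TP_add _ _ _ _).trans (add_le_add ((TP_add _ _ _ _).trans (add_le_add ((TP_add _ _ _ _).trans (add_le_add t1 t2)) t3)) t4)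
    have e1 : ε / 4 + ε / 4 + ε / 4 + ε / 4 = ε := by ring
    have e2 : θ / 4 + θ / 4 + θ / 4 + θ / 4 = θ := by ring
    rw [e1, e2] at t5
    refine le_trans (le_of_eq (TP_congr ?_ _)) t5
    filter_upwards [np.ct] with ω hω
    have e3 : ∫ u in (0:ℝ)..(k * (1 / 2 ^ M)), (c.a + c.b * ind (Y u ω)) =
        c.a * (k * (1 / 2 ^ M)) + c.b * ∫ u in (0:ℝ)..(k * (1 / 2 ^ M)), ind (Y u ω) := by
      rw [intervalIntegral.integral_add intervalIntegrable_const ((ind_ii hω _ _).const_mul _),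
        intervalIntegral.integral_const, intervalIntegral.integral_const_mul, smul_eq_mul]
      ring
    simp only [Ican, RSc, e3]
    rw [CS, CS]
    ring
  refine ⟨n0, fun n hn M k hk => ?_⟩
  have := fine n hn (M + n0) (Nat.le_add_left _ _) (k * 2 ^ n0)
  rw [dyad_up] at this
  exact this hk

lemma si_tim (pb : IsPlanarBM μ F B₁ B₂) (np : NP μ Y) (hY : ∀ t, 0 ≤ t → Measurable[F t] (Y t))
    (dl : DL μ B₁ B₂ ρ σ lam y Y) (el : EL μ B₁ B₂ ρ σ lam y c X) (hX : ∀ᵐ ω ∂μ, Continuous fun t => X t ω) {t : ℝ} (ht : 0 ≤ t) :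
    TendstoInMeasure μ (fun n => RSc c Y B₁ B₂ t n) atTop (Ican c X Y t) := by
  refine tim_TP fun ε hε => ?_
  rw [Metric.tendsto_atTop]
  intro θ hθ
  obtain ⟨T, hT⟩ := exists_nat_ge t
  obtain ⟨n0, h0⟩ := si_dyad (c := c) pb np hY dl el T (half_pos hε) (half_pos hθ)
  refine ⟨n0, fun n hn => ?_⟩
  rw [Real.dist_eq, sub_zero, abs_of_nonneg (TP_nonneg _ _)]
  refine lt_of_le_of_lt ?_ (half_lt_self hθ)
  rcases ht.eq_or_lt with rfl | ht'
  · have := h0 n hn 0 0 (by simp)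
    simp only [Nat.cast_zero, zero_mul] at this
    exact (TP_mono (half_le_self hε.le)).trans this
  set s : ℕ → ℝ := fun L => (⌊t * 2 ^ L⌋₊ : ℝ) * (1 / 2 ^ L) with hs
  have hst : Tendsto s atTop (nhds t) := floor_tendsto t ht
  have hsT : ∀ L, s L ≤ T := fun L => by
    refine le_trans ?_ hT
    simp only [hs]
    rw [mul_one_div, div_le_iff₀ (by positivity)]; exact Nat.floor_le (by positivity)
  refine TP_lim (Z := fun L ω => RSc c Y B₁ B₂ (s L) n ω - Ican c X Y (s L) ω) ?_ (half_pos hθ).le (half_lt_self hε)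
    (fun L => h0 n hn L _ (hsT L))
  have nz : ∀ᵐ ω ∂μ, ∀ i : ℕ, i ≠ 0 → Y (t * i / 2 ^ n) ω ≠ 0 := by
    rw [ae_all_iff]; intro i
    by_cases hi : i = 0
    · exact ae_of_all _ fun ω h => absurd hi h
    · have hi' : (0:ℝ) < i := by exact_mod_cast Nat.pos_of_ne_zero hi
      have := np.null (t := t * i / 2 ^ n) (by positivity)
      filter_upwards [compl_mem_ae_iff.2 this] with ω hω _
      exact hω
  filter_upwards [hX, np.ct, pb.1.cont, pb.2.1.cont, nz] with ω c1 c2 c3 c4 nz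
  have lt : ∀ x : ℝ, Tendsto (fun L => s L * x / 2 ^ n) atTop (nhds (t * x / 2 ^ n)) := fun x =>
    (hst.mul_const x).div_const _
  have rs : ∀ (α β : ℝ) (B : ℝ → Ω → ℝ), (Continuous fun t => B t ω) →
      Tendsto (fun L => rsum (fun s ω => α + β * ind (Y s ω)) B (s L) n ω) atTop
        (nhds (rsum (fun s ω => α + β * ind (Y s ω)) B t n ω)) := by
    intro α β B cB
    simp only [rsum]
    refine tendsto_finsetSum _ fun i _ => Tendsto.mul ?_ (((cB.tendsto _).comp (lt _)).sub ((cB.tendsto _).comp (lt _)))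
    by_cases hi : i = 0
    · subst hi
      simp only [Nat.cast_zero, mul_zero, zero_div]
      exact tendsto_const_nhds
    · exact ((ind_tendsto ((c2.tendsto _).comp (lt _)) (nz i hi)).const_mul β).const_add α
  have cI : Continuous fun t => ∫ u in (0:ℝ)..t, (c.a + c.b * ind (Y u ω)) :=
    intervalIntegral.continuous_primitive (fun a b => intervalIntegrable_const.add ((ind_ii c2 a b).const_mul _)) 0
  exact ((rs _ _ _ c3).add (rs _ _ _ c4)).sub ((((c1.tendsto t).comp hst).sub tendsto_const_nhds).sub ((cI.tendsto t).comp hst))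

lemma si_zero (pb : IsPlanarBM μ F B₁ B₂) (np : NP μ Y) (hY : ∀ t, 0 ≤ t → Measurable[F t] (Y t))
    (dl : DL μ B₁ B₂ ρ σ lam y Y) (el : EL μ B₁ B₂ ρ σ lam y c X) (hX : ∀ᵐ ω ∂μ, Continuous fun t => X t ω) :
    ∀ᵐ ω ∂μ, Ican c X Y 0 ω = 0 := by
  have h := si_tim (c := c) pb np hY dl el hX le_rfl
  have e : (fun n => RSc c Y B₁ B₂ 0 n) = fun _ _ => (0:ℝ) := by
    ext n ω; simp [RSc, rsum]
  rw [e] at h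
  have h2 : TendstoInMeasure μ (fun (_ : ℕ) (_ : Ω) => (0:ℝ)) atTop (fun _ => 0) :=
    tendstoInMeasure_of_tendsto_ae (fun _ => aestronglyMeasurable_const) (ae_of_all _ fun _ => tendsto_const_nhds)
  exact tendstoInMeasure_ae_unique h h2

/-- existence of a solution adapted to the filtration -/
lemma exists_sol {g h : ℝ} (pb : IsPlanarBM μ F B₁ B₂) (pr : PR ρ σ (g + h)) (x₁ x₂ : ℝ) :
    ∃ X₁ X₂ : ℝ → Ω → ℝ, Solves11 μ F g h ρ σ x₁ x₂ B₁ B₂ X₁ X₂ := by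
  have rs := pr.rs
  set c1 : CP := ⟨x₁, g, -h - g, σ, ρ - σ, 0, 0, rs, by simp⟩ with hc1
  set c2 : CP := ⟨x₂, -h, g - -h, 0, 0, ρ, σ - ρ, by simp, by rw [abs_sub_comm]; exact rs⟩ with hc2
  obtain ⟨X₁, m1, t1, l1⟩ := exists_comp (y := x₁ - x₂) pb pr c1
  obtain ⟨X₂, m2, t2, l2⟩ := exists_comp (y := x₁ - x₂) pb pr c2
  change EL μ B₁ B₂ ρ σ (g + h) (x₁ - x₂) c1 X₁ at l1
  change EL μ B₁ B₂ ρ σ (g + h) (x₁ - x₂) c2 X₂ at l2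
  set Y : ℝ → Ω → ℝ := fun t ω => X₁ t ω - X₂ t ω with hY
  have mY : ∀ t, 0 ≤ t → Measurable[F t] (Y t) := fun t ht => (m1 t ht).sub (m2 t ht)
  have mY' : ∀ t, 0 ≤ t → Measurable (Y t) := fun t ht => (mY t ht).mono (pb.1.le t) le_rfl
  have tY : ∀ᵐ ω ∂μ, Continuous fun t => Y t ω := by
    filter_upwards [t1, t2] with ω h1 h2
    exact h1.sub h2
  have dl : DL μ B₁ B₂ ρ σ (g + h) (x₁ - x₂) Y := by
    intro T ε θ hε hθ
    obtain ⟨N1, h1⟩ := l1 T (ε / 2) (θ / 2) (by positivity) (by positivity)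
    obtain ⟨N2, h2⟩ := l2 T (ε / 2) (θ / 2) (by positivity) (by positivity)
    refine ⟨N1 + N2, fun N hN k hk => ?_⟩
    have h1 := h1 N (by omega) k hk
    have h2 := h2 N (by omega) k hk
    rw [TP_comm] at h2
    have := (TP_add _ _ _ _).trans (add_le_add h1 h2)
    rw [add_halves, add_halves] at this
    refine le_trans (le_of_eq ?_) this
    congr 1
    ext ω
    rw [← YS_pE, YS_eq, CS, CS]
    simp only [hY, hc1, hc2]
    have eL : ∀ p ξ η : ℕ → Ω → ℝ, LS (fun j ω => σ + (ρ - σ) * p j ω) (fun j ω => -ρ + (ρ - σ) * p j ω) ξ η k ω =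
        LS (fun j ω => σ + (ρ - σ) * p j ω) (fun j ω => 0 + 0 * p j ω) ξ η k ω -
        LS (fun j ω => 0 + 0 * p j ω) (fun j ω => ρ + (σ - ρ) * p j ω) ξ η k ω := by
      intro p ξ η
      simp only [LS]
      rw [← Finset.sum_sub_distrib]
      exact Finset.sum_congr rfl fun j _ => by ring
    rw [eL]
    ring
  have np := DL.np pb pr mY' tY dl
  refine ⟨X₁, X₂, fun t ht => ((m1 t ht).prodMk (m2 t ht)).comap_le, ?_, Ican c1 X₁ Y, Ican c2 X₂ Y, ⟨?_, fun t ht => ?_⟩,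
    ⟨?_, fun t ht => ?_⟩, ?_⟩
  · filter_upwards [t1, t2] with ω h1 h2
    exact ⟨h1, h2⟩
  · exact si_zero pb np mY dl l1 t1
  · have := si_tim (c := c1) pb np mY dl l1 t1 ht
    have e : (fun n => RSc c1 Y B₁ B₂ t n) = fun n => rsum (fun s ω => if X₁ s ω ≤ X₂ s ω then σ else ρ) B₁ t n := by
      ext n ω; simp [RSc, rsum, ind_if, hY, hc1]
    rw [e] at this; exact this
  · exact si_zero pb np mY dl l2 t2
  · have := si_tim (c := c2) pb np mY dl l2 t2 ht
    have e : (fun n => RSc c2 Y B₁ B₂ t n) = fun n => rsum (fun s ω => if X₁ s ω ≤ X₂ s ω then ρ else σ) B₂ t n := by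
      ext n ω; simp [RSc, rsum, ind_if, hY, hc2]
    rw [e] at this; exact this
  · refine ae_of_all _ fun ω t ht => ⟨?_, ?_⟩
    · simp only [Ican, ind_if, hY, hc1]; ring
    · simp only [Ican, ind_if, hY, hc2]; ring

end sol


lemma natSA_mono' {E : Type*} [MeasurableSpace E] (Ξ : ℝ → Ω → E) : Monotone (natSA Ξ) := by
  intro s t hst
  exact iSup₂_le fun u hu => le_iSup₂_of_le (f := fun (s : ℝ) (_ : s ∈ Icc (0:ℝ) t) =>
    MeasurableSpace.comap (Ξ s) inferInstance) u ⟨hu.1, hu.2.trans hst⟩ le_rfl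

lemma comap_le_natSA {E : Type*} [MeasurableSpace E] (Ξ : ℝ → Ω → E) {t : ℝ} (ht : 0 ≤ t) :
    MeasurableSpace.comap (Ξ t) inferInstance ≤ natSA Ξ t :=
  le_iSup₂_of_le (f := fun (s : ℝ) (_ : s ∈ Icc (0:ℝ) t) =>
    MeasurableSpace.comap (Ξ s) inferInstance) t ⟨ht, le_rfl⟩ le_rfl

lemma IsPlanarBM.natSA_le {μ : Measure Ω} {F : ℝ → MeasurableSpace Ω} {B₁ B₂ : ℝ → Ω → ℝ}
    (pb : IsPlanarBM μ F B₁ B₂) (t : ℝ) : natSA (fun s ω => (B₁ s ω, B₂ s ω)) t ≤ F t := by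
  refine iSup₂_le fun s hs => ?_
  have h1 : Measurable[F t] (B₁ s) := measurable_iff_comap_le.2 ((pb.1.adapted s hs.1).trans (pb.1.mono hs.2))
  have h2 : Measurable[F t] (B₂ s) := measurable_iff_comap_le.2 ((pb.2.1.adapted s hs.1).trans (pb.1.mono hs.2))
  exact (h1.prodMk h2).comap_le

lemma IsPlanarBM.nat {μ : Measure Ω} {F : ℝ → MeasurableSpace Ω} {B₁ B₂ : ℝ → Ω → ℝ}
    (pb : IsPlanarBM μ F B₁ B₂) : IsPlanarBM μ (natSA (fun s ω => (B₁ s ω, B₂ s ω))) B₁ B₂ := by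
  have hm : ∀ t, 0 ≤ t → Measurable[natSA (fun s ω => (B₁ s ω, B₂ s ω)) t] (fun ω => (B₁ t ω, B₂ t ω)) :=
    fun t ht => measurable_iff_comap_le.2 (comap_le_natSA (fun s ω => (B₁ s ω, B₂ s ω)) ht)
  refine ⟨?_, ?_, pb.2.2⟩
  · exact ⟨fun t => (pb.natSA_le t).trans (pb.1.le t), natSA_mono' _, fun t ht => (measurable_fst.comp (hm t ht)).comap_le,
      pb.1.init, pb.1.cont, pb.1.law, fun s t hs hst => indep_of_indep_of_le_right (pb.1.indep s t hs hst) (pb.natSA_le s)⟩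
  · exact ⟨fun t => (pb.natSA_le t).trans (pb.1.le t), natSA_mono' _, fun t ht => (measurable_snd.comp (hm t ht)).comap_le,
      pb.2.1.init, pb.2.1.cont, pb.2.1.law,
      fun s t hs hst => indep_of_indep_of_le_right (pb.2.1.indep s t hs hst) (pb.natSA_le s)⟩


/-- Theorem 3 of the paper. The system (1.1)-(1.2) admits a pathwise
unique, strong solution: on every filtered probability space carrying a planar Brownian
motion `(B₁, B₂)` there is a solution whose augmented natural filtration is contained
in the augmented filtration of `(B₁, B₂)` (i.e. `𝔉^{(X₁,X₂)}(t) ⊆ 𝔉^{(B₁,B₂)}(t)` for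
all `t ≥ 0`), and any two solutions on the same space with the same driving Brownian
motions are indistinguishable. -/
theorem system11_strong_and_pathwise_unique
    (g h ρ σ : ℝ) (hg : 0 ≤ g) (hh : 0 ≤ h) (hρ : 0 ≤ ρ) (hσ : 0 ≤ σ)
    (hnorm : ρ ^ 2 + σ ^ 2 = 1) (hgh : 0 < g + h) (x₁ x₂ : ℝ) :
    (∀ (Ω : Type) [mΩ : MeasurableSpace Ω] (μ : Measure Ω) [IsProbabilityMeasure μ]
        (F : ℝ → MeasurableSpace Ω) (B₁ B₂ : ℝ → Ω → ℝ),
      IsPlanarBM μ F B₁ B₂ →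
        ∃ X₁ X₂ : ℝ → Ω → ℝ, Solves11 μ F g h ρ σ x₁ x₂ B₁ B₂ X₁ X₂ ∧
          ∀ t : ℝ, 0 ≤ t →
            natFilt μ (fun s ω => (X₁ s ω, X₂ s ω)) t ≤
              natFilt μ (fun s ω => (B₁ s ω, B₂ s ω)) t) ∧
    (∀ (Ω : Type) [mΩ : MeasurableSpace Ω] (μ : Measure Ω) [IsProbabilityMeasure μ]
        (F : ℝ → MeasurableSpace Ω) (B₁ B₂ X₁ X₂ X₁' X₂' : ℝ → Ω → ℝ),
      IsPlanarBM μ F B₁ B₂ →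
        Solves11 μ F g h ρ σ x₁ x₂ B₁ B₂ X₁ X₂ →
        Solves11 μ F g h ρ σ x₁ x₂ B₁ B₂ X₁' X₂' →
        ∀ᵐ ω ∂μ, ∀ t : ℝ, 0 ≤ t → X₁ t ω = X₁' t ω ∧ X₂ t ω = X₂' t ω) := by
  have pr : PR ρ σ (g + h) := ⟨hρ, hσ, hnorm, hgh.le⟩
  refine ⟨?_, ?_⟩
  · intro Ω mΩ μ _ F B₁ B₂ pb
    obtain ⟨X₁, X₂, s1, s2, s3⟩ := exists_sol (g := g) (h := h) pb.nat pr x₁ x₂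
    refine ⟨X₁, X₂, ⟨fun t ht => (s1 t ht).trans (pb.natSA_le t), s2, s3⟩, fun t ht => ?_⟩
    refine sup_le_sup_right (iSup₂_le fun s hs => ?_) _
    exact (s1 s hs.1).trans (natSA_mono' _ hs.2)
  · intro Ω mΩ μ _ F B₁ B₂ X₁ X₂ X₁' X₂' pb s s'
    exact Solves11.unique pb pr s s'

end SDEPaper
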